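/- Let c_n denote the number of strong-Baxter permutations of size n and let F = Σ_{n≥1} c_n·xⁿ ∈ ℚ[[x]] be the generating function of strong-Baxter numbers. Then F is not D-finite: there do not exist an integer k ≥ 0 and polynomials Q, Q₀, Q₁, …, Q_k ∈ ℚ[x] with Q_k ≠ 0 such that Q₀·F + Q₁·F' + Q₂·F'' + ⋯ + Q_k·F^{(k)} = Q, where F^{(i)} denotes the i-th formal derivative of the power series F. (Theorem 5.7.) -/

import Mathlib

/-- `f` contains the vincular pattern 2-41-3. -/
def Contains2413 {m : ℕ} (f : Fin m → Fin m) : Prop :=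
  ∃ i j j' k : Fin m, (i : ℕ) < (j : ℕ) ∧ (j' : ℕ) = (j : ℕ) + 1 ∧ (j' : ℕ) < (k : ℕ) ∧
    f j' < f i ∧ f i < f k ∧ f k < f j

/-- `f` contains the vincular pattern 3-14-2. -/
def Contains3142 {m : ℕ} (f : Fin m → Fin m) : Prop :=
  ∃ i j j' k : Fin m, (i : ℕ) < (j : ℕ) ∧ (j' : ℕ) = (j : ℕ) + 1 ∧ (j' : ℕ) < (k : ℕ) ∧
    f j < f k ∧ f k < f i ∧ f i < f j'

/-- `f` contains the vincular pattern 3-41-2. -/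
def Contains3412 {m : ℕ} (f : Fin m → Fin m) : Prop :=
  ∃ i j j' k : Fin m, (i : ℕ) < (j : ℕ) ∧ (j' : ℕ) = (j : ℕ) + 1 ∧ (j' : ℕ) < (k : ℕ) ∧
    f j' < f k ∧ f k < f i ∧ f i < f j

/-- A strong-Baxter permutation avoids 2-41-3, 3-14-2 and 3-41-2. -/
def IsStrongBaxter {n : ℕ} (π : Equiv.Perm (Fin n)) : Prop :=
  ¬ Contains2413 ⇑π ∧ ¬ Contains3142 ⇑π ∧ ¬ Contains3412 ⇑π

/-- The number of strong-Baxter permutations of size `n`. -/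
noncomputable def strongBaxterCount (n : ℕ) : ℕ :=
  Nat.card {π : Equiv.Perm (Fin n) // IsStrongBaxter π}

/-- The generating function `F = Σ_{n ≥ 1} c_n xⁿ` of the strong-Baxter numbers. -/
noncomputable def strongBaxterGF : PowerSeries ℚ :=
  PowerSeries.mk fun n => if n = 0 then 0 else (strongBaxterCount n : ℚ)

open NumberField

/-- Siegel's lemma over a number field with twice as many unknowns as equations. -/
theorem exists_siegel_const (K : Type*) [Field K] [NumberField K] :
    ∃ C : ℝ, 1 ≤ C ∧ ∀ (α β : Type) [Fintype α] [Fintype β] (a : Matrix α β (𝓞 K)) (p : ℕ)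
      (A : ℝ), 0 < p → 0 ≤ A → a ≠ 0 → Fintype.card α = p → Fintype.card β = 2 * p →
      (∀ k l, house ((algebraMap (𝓞 K) K) (a k l)) ≤ A) →
      ∃ ξ : β → 𝓞 K, ξ ≠ 0 ∧ a.mulVec ξ = 0 ∧
        ∀ l, house ((ξ l : K)) ≤ C * (C * (2 * p) * A) := by
  classical
  have key : ∃ C₀ : ℝ, ∀ (α β : Type) [Fintype α] [Fintype β] (a : Matrix α β (𝓞 K)) (p : ℕ)
      (A : ℝ), 0 < p → a ≠ 0 → Fintype.card α = p → Fintype.card β = 2 * p →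
      (∀ k l, house ((algebraMap (𝓞 K) K) (a k l)) ≤ A) →
      ∃ ξ : β → 𝓞 K, ξ ≠ 0 ∧ a.mulVec ξ = 0 ∧
        ∀ l, house ((ξ l : K)) ≤
          C₀ * (C₀ * ((2 * p : ℕ) : ℝ) * A) ^ ((p : ℝ) / (((2 * p : ℕ) : ℝ) - p)) :=
    ⟨_, fun α β _ _ a p A hp ha hα hβ hA =>
      NumberField.house.exists_ne_zero_int_vec_house_le K a ha hp (by omega) hβ hA hα⟩
  obtain ⟨C₀, key⟩ := key
  refine ⟨max 1 |C₀|, le_max_left _ _, fun α β _ _ a p A hp hA0 ha hα hβ hA => ?_⟩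
  obtain ⟨ξ, h1, h2, h3⟩ := key α β a p A hp ha hα hβ hA
  refine ⟨ξ, h1, h2, fun l => (h3 l).trans ?_⟩
  have hp' : (0 : ℝ) < p := by exact_mod_cast hp
  have hexp : (p : ℝ) / (((2 * p : ℕ) : ℝ) - p) = 1 := by
    push_cast
    rw [show (2 * (p : ℝ) - p) = p by ring]
    exact div_self hp'.ne'
  rw [hexp, Real.rpow_one]
  push_cast
  calc C₀ * (C₀ * (2 * p) * A) = |C₀| * (|C₀| * (2 * p) * A) := by
        rw [show C₀ * (C₀ * (2 * p) * A) = (C₀ * C₀) * ((2 * p) * A) by ring, ← abs_mul_abs_self]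
        ring
    _ ≤ _ := by gcongr <;> exact le_max_right _ _

/-- An entire function vanishing on a finite set is divisible by the corresponding product. -/
theorem exists_entire_factor {F : ℂ → ℂ} (hF : Differentiable ℂ F) (T : Finset ℂ)
    (hT : ∀ t ∈ T, F t = 0) :
    ∃ H : ℂ → ℂ, Differentiable ℂ H ∧ ∀ z, F z = (∏ t ∈ T, (z - t)) * H z := by
  classical
  induction T using Finset.induction_on with
  | empty => exact ⟨F, hF, by simp⟩
  | insert a s ha ih =>
    obtain ⟨H, hH, hH'⟩ := ih fun t ht => hT t (Finset.mem_insert_of_mem ht)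
    have hHa : H a = 0 := by
      have h := hH' a
      rw [hT a (Finset.mem_insert_self _ _)] at h
      refine (mul_eq_zero.1 h.symm).resolve_left (Finset.prod_ne_zero_iff.2 fun t ht => ?_)
      exact sub_ne_zero.2 fun h => ha (h ▸ ht)
    refine ⟨dslope H a, ?_, fun z => ?_⟩
    · have := (Complex.differentiableOn_dslope (s := Set.univ) (c := a) Filter.univ_mem).2
        hH.differentiableOn
      exact differentiableOn_univ.1 this
    · rw [Finset.prod_insert ha, hH' z, mul_comm (z - a), mul_assoc]
      congr 1
      have := sub_smul_dslope H a z
      rw [smul_eq_mul] at this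
      rw [this, hHa, sub_zero]

/-- Schwarz lemma: many zeros near the origin force small values near the origin. -/
theorem norm_le_of_zeros {F : ℂ → ℂ} (hF : Differentiable ℂ F) (T : Finset ℂ)
    (hT : ∀ t ∈ T, F t = 0) {r R M : ℝ} (hr : 0 ≤ r) (hR : r < R) (hTr : ∀ t ∈ T, ‖t‖ ≤ r)
    (hM : ∀ z, ‖z‖ = R → ‖F z‖ ≤ M) {w : ℂ} (hw : ‖w‖ ≤ r) :
    ‖F w‖ ≤ M * (2 * r / (R - r)) ^ T.card := by
  obtain ⟨H, hH, hH'⟩ := exists_entire_factor hF T hT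
  have hRr : 0 < R - r := sub_pos.2 hR
  have hR0 : 0 < R := hr.trans_lt hR
  have hbd : ‖H w‖ ≤ M / (R - r) ^ T.card := by
    refine Complex.norm_le_of_forall_mem_frontier_norm_le (U := Metric.ball 0 R)
      Metric.isBounded_ball hH.diffContOnCl (fun z hz => ?_) (subset_closure ?_)
    · rw [frontier_ball _ hR0.ne', mem_sphere_zero_iff_norm] at hz
      rw [le_div_iff₀ (by positivity)]
      refine le_trans ?_ (hM z hz)
      rw [hH' z, norm_mul, norm_prod, mul_comm]
      gcongr
      rw [← Finset.prod_const]
      refine Finset.prod_le_prod (fun _ _ => hRr.le) fun t ht => ?_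
      have := norm_sub_norm_le z t
      have := hTr t ht
      linarith
    · rw [mem_ball_zero_iff]; linarith
  rw [hH' w, norm_mul, norm_prod]
  have : ∏ t ∈ T, ‖w - t‖ ≤ (2 * r) ^ T.card := by
    rw [← Finset.prod_const]
    refine Finset.prod_le_prod (fun _ _ => norm_nonneg _) fun t ht => ?_
    have := norm_sub_le w t
    have := hTr t ht
    linarith
  calc _ ≤ (2 * r) ^ T.card * (M / (R - r) ^ T.card) := by gcongr
    _ = _ := by rw [div_pow]; ring

theorem one_le_norm_mul_house_pow {K : Type*} [Field K] [NumberField K] (φ : K →+* ℂ)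
    {α : 𝓞 K} (hα : α ≠ 0) :
    1 ≤ ‖φ α‖ * house (α : K) ^ (Module.finrank ℚ K - 1) := by
  refine le_trans ?_ (norm_norm_le_norm_mul_house_pow (α : K) φ)
  rw [← Algebra.coe_norm_int, ← Rat.norm_cast_real, Rat.cast_intCast, Real.norm_eq_abs,
    ← Int.cast_abs]
  exact_mod_cast Int.one_le_abs (Algebra.norm_ne_zero_iff.mpr hα)

theorem Nat.pow_le_pow_swap {a b : ℕ} (ha : 3 ≤ a) (hab : a ≤ b) : b ^ a ≤ a ^ b := by
  have ha0 : (0 : ℝ) < a := by positivity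
  have hb0 : (0 : ℝ) < b := ha0.trans_le (by exact_mod_cast hab)
  have he : Real.exp 1 ≤ a :=
    (Real.exp_one_lt_d9.le.trans (by norm_num)).trans (show (3 : ℝ) ≤ a by exact_mod_cast ha)
  have h := Real.log_div_self_antitoneOn (a := (a : ℝ)) (b := (b : ℝ)) he
    (he.trans (by exact_mod_cast hab)) (by exact_mod_cast hab)
  simp only at h
  rw [div_le_div_iff₀ hb0 ha0] at h
  have : (b : ℝ) ^ a ≤ (a : ℝ) ^ b := by
    rw [← Real.log_le_log_iff (by positivity) (by positivity), Real.log_pow, Real.log_pow]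
    linarith
  exact_mod_cast this

/-- Cleared-denominator value at `m + n γ` of the function `w ^ k * exp (π i l w)`. -/
noncomputable def schneiderEntry {K : Type*} [Field K] (D : ℤ) (g z : 𝓞 K) (E m n k l : ℕ) : 𝓞 K :=
  D ^ (E - k - l * n) * (m * D + n * g) ^ k * (-1) ^ (m * l) * z ^ (l * n)

theorem house_schneiderEntry_le {K : Type*} [Field K] [NumberField K] {D : ℤ} {g z : 𝓞 K}
    {B : ℝ} (hB : 1 ≤ B) (hD : house (D : K) ≤ B) (hg : house (g : K) ≤ B)
    (hz : house (z : K) ≤ B) {E T m n k l : ℕ} (hm : m ≤ T) (hn : n ≤ T) (hE : k + l * n ≤ E) :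
    house ((schneiderEntry D g z E m n k l : 𝓞 K) : K) ≤ B ^ E * (2 * T) ^ k := by
  have h1 : house ((m : K) * D + n * g) ≤ B * (2 * T) := by
    refine (house_add_le _ _).trans ?_
    rw [house_nat_mul, house_nat_mul]
    have : (m : ℝ) * house (D : K) ≤ T * B := by
      gcongr
      exact house_nonneg _
    have : (n : ℝ) * house (g : K) ≤ T * B := by
      gcongr
      exact house_nonneg _
    linarith
  have h2 : house ((-1 : K) ^ (m * l)) ≤ 1 := by
    refine (house_pow_le _ _).trans ?_
    have : house (-1 : K) = 1 := by
      have := house_intCast (K := K) (-1)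
      simpa using this
    rw [this, one_pow]
  have e : ((schneiderEntry D g z E m n k l : 𝓞 K) : K) =
      (D : K) ^ (E - k - l * n) * ((m : K) * D + n * g) ^ k * (-1) ^ (m * l) * (z : K) ^ (l * n) := by
    simp [schneiderEntry]
  rw [e]
  have hn0 := house_nonneg (K := K)
  calc _ ≤ house (D : K) ^ (E - k - l * n) * house ((m : K) * D + n * g) ^ k
          * house ((-1 : K) ^ (m * l)) * house (z : K) ^ (l * n) := by
        refine (house_mul_le _ _).trans (mul_le_mul ?_ (house_pow_le _ _) (hn0 _) ?_)
        · refine (house_mul_le _ _).trans (mul_le_mul_of_nonneg_right ?_ (hn0 _))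
          refine (house_mul_le _ _).trans (mul_le_mul (house_pow_le _ _) (house_pow_le _ _)
            (hn0 _) (pow_nonneg (hn0 _) _))
        · exact mul_nonneg (mul_nonneg (pow_nonneg (hn0 _) _) (pow_nonneg (hn0 _) _)) (hn0 _)
    _ ≤ B ^ (E - k - l * n) * (B * (2 * T)) ^ k * 1 * B ^ (l * n) := by
        have := hn0 (D : K)
        have := hn0 ((m : K) * D + n * g)
        have := hn0 (z : K)
        have := hn0 ((-1 : K) ^ (m * l))
        gcongr
    _ = B ^ E * (2 * T) ^ k := by
        rw [mul_pow, mul_one]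
        obtain ⟨e', rfl⟩ := Nat.exists_eq_add_of_le hE
        rw [show k + l * n + e' - k - l * n = e' by omega, pow_add, pow_add]
        ring

theorem map_schneiderEntry {K : Type*} [Field K] (φ : K →+* ℂ) {D : ℤ} {g z : 𝓞 K}
    {γ : ℝ} (hg : φ g = D * γ) (hz : φ z = D * Complex.exp (Real.pi * Complex.I * γ))
    {E m n k l : ℕ} (hE : k + l * n ≤ E) :
    φ ((schneiderEntry D g z E m n k l : 𝓞 K) : K) =
      D ^ E * ((m + n * γ : ℂ) ^ k * Complex.exp (Real.pi * Complex.I * l * (m + n * γ))) := by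
  obtain ⟨e, rfl⟩ := Nat.exists_eq_add_of_le hE
  have h : Complex.exp (Real.pi * Complex.I * l * (m + n * γ)) =
      (-1) ^ (m * l) * Complex.exp (Real.pi * Complex.I * γ) ^ (l * n) := by
    rw [← Complex.exp_nat_mul, ← Complex.exp_pi_mul_I, ← Complex.exp_nat_mul, ← Complex.exp_add]
    congr 1
    push_cast
    ring
  rw [h]
  simp only [schneiderEntry, map_mul, map_pow, map_add, map_natCast, map_intCast, map_neg, map_one,
    hg, hz]
  rw [show k + l * n + e - k - l * n = e by omega, pow_add, pow_add]
  rw [show (m : ℂ) * D + n * (D * γ) = D * (m + n * γ) by ring, mul_pow, mul_pow]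
  ring

theorem exp_pi_mul_injective {γ : ℝ} (hγ : Irrational γ) :
    Function.Injective fun n : ℕ => Complex.exp (Real.pi * Complex.I * γ) ^ n := by
  intro a b h
  by_contra hab
  simp only [← Complex.exp_nat_mul] at h
  obtain ⟨n, hn⟩ := Complex.exp_eq_exp_iff_exists_int.1 h
  have hI : (Real.pi : ℂ) * Complex.I ≠ 0 := by simp [Real.pi_ne_zero]
  have h2 : ((a : ℂ) - b) * γ = 2 * n := by
    apply mul_left_cancel₀ hI
    linear_combination hn
  have h3 : ((a : ℝ) - b) * γ = 2 * n := by exact_mod_cast h2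
  have hab' : (a : ℝ) - b ≠ 0 := sub_ne_zero.2 (by exact_mod_cast hab)
  refine hγ ⟨(2 * n) / ((a : ℚ) - b), ?_⟩
  push_cast
  rw [div_eq_iff hab', ← h3]
  ring

/-- A nonzero exponential polynomial `Σ ξ k l w ^ k exp (π i l w)` cannot vanish at all
points `m + n γ`. -/
theorem exists_ne_zero_of_irrational {γ : ℝ} (hγ : Irrational γ) {N L : ℕ}
    (ξ : Fin N × Fin L → ℂ) (hξ : ξ ≠ 0) :
    ∃ m n : ℕ, ∑ p, ξ p * ((m + n * γ : ℂ) ^ (p.1 : ℕ) *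
      Complex.exp (Real.pi * Complex.I * (p.2 : ℕ) * (m + n * γ))) ≠ 0 := by
  by_contra! H
  set ζ := Complex.exp (Real.pi * Complex.I * γ) with hζ
  have h1 : ∀ (n : ℕ) (k : Fin N), ∑ l : Fin L, ξ (k, l) * (ζ ^ n) ^ (l : ℕ) = 0 := by
    intro n
    set P : Polynomial ℂ := ∑ k : Fin N, Polynomial.C (∑ l : Fin L, ξ (k, l) * (ζ ^ n) ^ (l : ℕ))
      * Polynomial.X ^ (k : ℕ) with hP
    have hP0 : P = 0 := by
      refine Polynomial.eq_zero_of_infinite_isRoot P (Set.infinite_of_injective_forall_mem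
        (f := fun m : ℕ => ((2 * m : ℕ) + n * γ : ℂ)) ?_ fun m => ?_)
      · intro a b hab
        have : ((2 * a : ℕ) : ℂ) = ((2 * b : ℕ) : ℂ) := by simpa using hab
        have := Nat.cast_injective this
        omega
      · have := H (2 * m) n
        rw [Fintype.sum_prod_type] at this
        rw [Set.mem_ofPred_eq, Polynomial.IsRoot.def, hP, Polynomial.eval_finsetSum, ← this]
        refine Finset.sum_congr rfl fun k _ => ?_
        simp only [Polynomial.eval_mul, Polynomial.eval_C, Polynomial.eval_pow, Polynomial.eval_X]
        rw [Finset.sum_mul]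
        refine Finset.sum_congr rfl fun l _ => ?_
        have e : Complex.exp (Real.pi * Complex.I * (l : ℕ) * ((2 * m : ℕ) + n * γ)) =
            (ζ ^ n) ^ (l : ℕ) := by
          rw [hζ, ← Complex.exp_nat_mul, ← Complex.exp_nat_mul]
          refine Complex.exp_eq_exp_iff_exists_int.2 ⟨l * m, ?_⟩
          push_cast
          ring
        rw [e]
        ring
    intro k
    have := congrArg (fun P => Polynomial.coeff P k) hP0
    simpa only [hP, Polynomial.finsetSum_coeff, Polynomial.coeff_C_mul, Polynomial.coeff_X_pow,
      Fin.val_inj, mul_ite, mul_one, mul_zero, Finset.sum_ite_eq, Finset.mem_univ, if_true,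
      Polynomial.coeff_zero] using this
  apply hξ
  ext ⟨k, l⟩
  set P : Polynomial ℂ := ∑ l : Fin L, Polynomial.C (ξ (k, l)) * Polynomial.X ^ (l : ℕ) with hP
  have hP0 : P = 0 := by
    refine Polynomial.eq_zero_of_infinite_isRoot P (Set.infinite_of_injective_forall_mem
      (exp_pi_mul_injective hγ) fun n => ?_)
    rw [Set.mem_ofPred_eq, Polynomial.IsRoot.def, hP, Polynomial.eval_finsetSum, ← h1 n k]
    simp [hζ]
  have := congrArg (fun P => Polynomial.coeff P l) hP0
  simpa [hP, Polynomial.coeff_X_pow, Fin.val_inj] using this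

section numeric
variable {Y T : ℕ}

theorem schneider_pow_bound (hY : 2 ≤ Y) (hT : Y ^ 4 ≤ T) :
    ((T : ℝ) ^ 2) ^ (2 * Y ^ 6) ≤ (Y : ℝ) ^ (16 * Y ^ 2 * T) := by
  have h1 : T ^ Y ^ 4 ≤ (Y ^ 4) ^ T := by
    refine Nat.pow_le_pow_swap ?_ hT
    calc 3 ≤ 2 ^ 4 := by norm_num
      _ ≤ Y ^ 4 := Nat.pow_le_pow_left hY 4
  have h2 : (T ^ 2) ^ (2 * Y ^ 6) ≤ Y ^ (16 * Y ^ 2 * T) := by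
    calc (T ^ 2) ^ (2 * Y ^ 6) = (T ^ Y ^ 4) ^ (4 * Y ^ 2) := by
          rw [← pow_mul, ← pow_mul]
          congr 1
          ring
      _ ≤ ((Y ^ 4) ^ T) ^ (4 * Y ^ 2) := Nat.pow_le_pow_left h1 _
      _ = _ := by
          rw [← pow_mul, ← pow_mul]
          congr 1
          ring
  exact_mod_cast h2

end numeric

/-- A cleared-denominator bound for all entries used in the construction. -/
theorem house_schneiderEntry_le' {K : Type*} [Field K] [NumberField K] {D : ℤ} {g z : 𝓞 K}
    {B : ℝ} (hB : 1 ≤ B) (hD : house (D : K) ≤ B) (hg : house (g : K) ≤ B)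
    (hz : house (z : K) ≤ B) {Y T m n k l : ℕ} (hY : 2 ≤ Y) (hBY : B ≤ Y) (hT : Y ^ 4 ≤ T)
    (hm : m ≤ T) (hn : n ≤ T) (hk : k ≤ 2 * Y ^ 6) (hl : l ≤ Y ^ 2) :
    house ((schneiderEntry D g z (2 * Y ^ 6 + Y ^ 2 * T) m n k l : 𝓞 K) : K) ≤
      (Y : ℝ) ^ (19 * Y ^ 2 * T) := by
  have hY1 : (1 : ℝ) ≤ Y := by exact_mod_cast (by omega : 1 ≤ Y)
  have hTY : 2 * Y ^ 6 + Y ^ 2 * T ≤ 3 * Y ^ 2 * T := by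
    have : Y ^ 2 * Y ^ 4 ≤ Y ^ 2 * T := Nat.mul_le_mul_left _ hT
    nlinarith
  have hT2 : 2 ≤ T := by
    have : 2 ^ 4 ≤ Y ^ 4 := Nat.pow_le_pow_left hY 4
    omega
  have h2T : (2 * T : ℝ) ≤ (T : ℝ) ^ 2 := by
    have : (2 : ℝ) ≤ T := by exact_mod_cast hT2
    nlinarith
  have h1T : (1 : ℝ) ≤ (T : ℝ) ^ 2 := by
    have : (2 : ℝ) ≤ T := by exact_mod_cast hT2
    nlinarith
  calc _ ≤ B ^ (2 * Y ^ 6 + Y ^ 2 * T) * (2 * T) ^ k :=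
        house_schneiderEntry_le hB hD hg hz hm hn (by nlinarith [Nat.mul_le_mul hl hn])
    _ ≤ (Y : ℝ) ^ (3 * Y ^ 2 * T) * ((T : ℝ) ^ 2) ^ (2 * Y ^ 6) := by
        gcongr
        · calc B ^ (2 * Y ^ 6 + Y ^ 2 * T) ≤ (Y : ℝ) ^ (2 * Y ^ 6 + Y ^ 2 * T) := by gcongr
            _ ≤ _ := pow_le_pow_right₀ hY1 hTY
        · calc (2 * T : ℝ) ^ k ≤ ((T : ℝ) ^ 2) ^ k := by gcongr
            _ ≤ _ := pow_le_pow_right₀ h1T hk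
    _ ≤ (Y : ℝ) ^ (3 * Y ^ 2 * T) * (Y : ℝ) ^ (16 * Y ^ 2 * T) := by
        gcongr
        exact schneider_pow_bound hY hT
    _ = _ := by
        rw [← pow_add]
        congr 1
        ring

/-- Growth bound for the auxiliary function on a large disc. -/
theorem schneider_growth {Y T : ℕ} (hY : 20 ≤ Y) (hYe : Real.exp 19 ≤ Y) (hT : Y ^ 4 ≤ T)
    (ξ : Fin (2 * Y ^ 6) × Fin (Y ^ 2) → ℂ) (hξ : ∀ p, ‖ξ p‖ ≤ (Y : ℝ) ^ (20 * Y ^ 2 * T))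
    {w : ℂ} (hw : ‖w‖ ≤ 6 * T * Y ^ 2) :
    ‖∑ p, ξ p * (w ^ (p.1 : ℕ) * Complex.exp (Real.pi * Complex.I * (p.2 : ℕ) * w))‖ ≤
      (Y : ℝ) ^ (37 * Y ^ 2 * T + T ^ 2) := by
  have hY1 : (20 : ℝ) ≤ Y := by exact_mod_cast hY
  have hTr : (Y : ℝ) ^ 4 ≤ T := by exact_mod_cast hT
  have hY400 : (400 : ℝ) ≤ (Y : ℝ) ^ 2 := by nlinarith
  have hYT : 6 * (Y : ℝ) ^ 2 ≤ T := by nlinarith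
  have hT1 : (1 : ℝ) ≤ T := by nlinarith
  have hwT : ‖w‖ ≤ (T : ℝ) ^ 2 := by nlinarith
  have hterm : ∀ p : Fin (2 * Y ^ 6) × Fin (Y ^ 2),
      ‖ξ p * (w ^ (p.1 : ℕ) * Complex.exp (Real.pi * Complex.I * (p.2 : ℕ) * w))‖ ≤
      (Y : ℝ) ^ (20 * Y ^ 2 * T) * ((Y : ℝ) ^ (16 * Y ^ 2 * T) * (Y : ℝ) ^ (T ^ 2)) := by
    intro p
    rw [norm_mul, norm_mul, norm_pow]
    have h1 : ‖w‖ ^ (p.1 : ℕ) ≤ (Y : ℝ) ^ (16 * Y ^ 2 * T) := by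
      refine le_trans ?_ (schneider_pow_bound (by omega) hT)
      calc ‖w‖ ^ (p.1 : ℕ) ≤ ((T : ℝ) ^ 2) ^ (p.1 : ℕ) := by gcongr
        _ ≤ _ := pow_le_pow_right₀ (by nlinarith) p.1.2.le
    have h2 : ‖Complex.exp (Real.pi * Complex.I * (p.2 : ℕ) * w)‖ ≤ (Y : ℝ) ^ (T ^ 2) := by
      refine (Complex.norm_exp_le_exp_norm _).trans ?_
      have : ‖(Real.pi * Complex.I * (p.2 : ℕ) * w : ℂ)‖ ≤ (T ^ 2 : ℕ) * 19 := by
        simp only [norm_mul, Complex.norm_real, Complex.norm_I, Complex.norm_natCast, mul_one,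
          Real.norm_eq_abs, abs_of_pos Real.pi_pos]
        have hp2 : ((p.2 : ℕ) : ℝ) ≤ Y ^ 2 := by exact_mod_cast p.2.2.le
        have hpi := Real.pi_lt_d2
        calc Real.pi * (p.2 : ℕ) * ‖w‖ ≤ 3.15 * Y ^ 2 * (6 * T * Y ^ 2) := by
              gcongr
          _ = 18.9 * (Y ^ 4 * T) := by ring
          _ ≤ 18.9 * (T * T) := by gcongr
          _ ≤ _ := by push_cast; nlinarith
      calc _ ≤ Real.exp ((T ^ 2 : ℕ) * 19) := Real.exp_le_exp.2 this
        _ = Real.exp 19 ^ (T ^ 2) := by rw [← Real.exp_nat_mul]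
        _ ≤ _ := by gcongr
    gcongr
    exact hξ p
  calc _ ≤ ∑ p : Fin (2 * Y ^ 6) × Fin (Y ^ 2), _ := norm_sum_le_of_le _ fun p _ => hterm p
    _ = 2 * (Y : ℝ) ^ 8 * ((Y : ℝ) ^ (20 * Y ^ 2 * T) * ((Y : ℝ) ^ (16 * Y ^ 2 * T) *
          (Y : ℝ) ^ (T ^ 2))) := by
        rw [Finset.sum_const, Finset.card_univ]
        simp only [Fintype.card_prod, Fintype.card_fin, nsmul_eq_mul]
        push_cast
        ring
    _ ≤ (Y : ℝ) ^ 9 * ((Y : ℝ) ^ (20 * Y ^ 2 * T) * ((Y : ℝ) ^ (16 * Y ^ 2 * T) *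
          (Y : ℝ) ^ (T ^ 2))) := by
        gcongr
        rw [show (Y : ℝ) ^ 9 = Y * Y ^ 8 by ring]
        gcongr
        linarith
    _ = (Y : ℝ) ^ (9 + (20 * Y ^ 2 * T + (16 * Y ^ 2 * T + T ^ 2))) := by simp only [pow_add]
    _ ≤ _ := by
        refine pow_le_pow_right₀ (by linarith) ?_
        have : 9 ≤ Y ^ 2 * T := by
          have h3 : 20 ^ 2 ≤ Y ^ 2 := Nat.pow_le_pow_left hY 2
          have : 1 ≤ T := by exact_mod_cast hT1
          nlinarith
        nlinarith

theorem schneider_numeric {Y T d : ℕ} (hY : 20 ≤ Y) (hd1 : 1 ≤ d) (hYd : 41 * d ≤ Y)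
    (hT : Y ^ 4 ≤ T)
    (h1 : (1 : ℝ) ≤ ((Y : ℝ) ^ (3 * Y ^ 2 * T) * ((Y : ℝ) ^ (37 * Y ^ 2 * T + T ^ 2) *
      (1 / (Y : ℝ) ^ 2) ^ T ^ 2)) * ((Y : ℝ) ^ (40 * Y ^ 2 * T)) ^ (d - 1)) : False := by
  have hYpos : 0 < Y := by omega
  have hT0 : 0 < T := lt_of_lt_of_le (by positivity) hT
  have hY1 : (20 : ℝ) ≤ Y := by exact_mod_cast hY
  have h2 : (Y : ℝ) ^ (2 * T ^ 2) ≤ (Y : ℝ) ^ (40 * Y ^ 2 * T * d + T ^ 2) := by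
    obtain ⟨d', hd'⟩ := Nat.exists_eq_add_of_le' hd1
    have hpos : (0 : ℝ) < (Y : ℝ) ^ (2 * T ^ 2) := by positivity
    calc (Y : ℝ) ^ (2 * T ^ 2) = (Y : ℝ) ^ (2 * T ^ 2) * 1 := (mul_one _).symm
      _ ≤ _ := mul_le_mul_of_nonneg_left h1 hpos.le
      _ = (Y : ℝ) ^ (2 * T ^ 2) * (1 / (Y : ℝ) ^ 2) ^ T ^ 2 * ((Y : ℝ) ^ (3 * Y ^ 2 * T) *
          (Y : ℝ) ^ (37 * Y ^ 2 * T + T ^ 2) * ((Y : ℝ) ^ (40 * Y ^ 2 * T)) ^ (d - 1)) := by ring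
      _ = 1 * ((Y : ℝ) ^ (3 * Y ^ 2 * T) *
          (Y : ℝ) ^ (37 * Y ^ 2 * T + T ^ 2) * ((Y : ℝ) ^ (40 * Y ^ 2 * T)) ^ (d - 1)) := by
          congr 1
          rw [one_div, inv_pow, ← pow_mul]
          exact mul_inv_cancel₀ hpos.ne'
      _ = _ := by
          rw [hd', Nat.add_sub_cancel, one_mul, ← pow_mul, ← pow_add, ← pow_add]
          congr 1
          ring
  have h3 : 2 * T ^ 2 ≤ 40 * Y ^ 2 * T * d + T ^ 2 :=
    (pow_le_pow_iff_right₀ (by linarith)).1 h2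
  have h4 : T ≤ 40 * Y ^ 2 * d := by
    have : T * T ≤ (40 * Y ^ 2 * d) * T := by nlinarith
    exact Nat.le_of_mul_le_mul_right this hT0
  have h5 : 40 * Y ^ 2 * d < Y ^ 4 := by
    have h6 : 0 < Y ^ 2 := by positivity
    calc 40 * Y ^ 2 * d < Y ^ 2 * (41 * d) := by nlinarith
      _ ≤ Y ^ 2 * Y := Nat.mul_le_mul_left _ hYd
      _ ≤ Y ^ 2 * (Y * Y) := Nat.mul_le_mul_left _ (Nat.le_mul_of_pos_left _ hYpos)
      _ = Y ^ 4 := by ring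
  omega

set_option maxHeartbeats 1000000 in
theorem schneider_contradiction {K : Type} [Field K] [NumberField K] (φ : K →+* ℂ) {γ : ℝ}
    (hγ0 : 0 < γ) (hγ1 : γ < 1) (hγ : Irrational γ) {D : ℤ} (hD0 : D ≠ 0) (g z : 𝓞 K)
    (hg : φ g = D * γ) (hz : φ z = D * Complex.exp (Real.pi * Complex.I * γ)) : False := by
  classical
  obtain ⟨C, hC1, hC⟩ := exists_siegel_const K
  set d := Module.finrank ℚ K with hd
  have hd1 : 1 ≤ d := Module.finrank_pos
  obtain ⟨Y, hYbig⟩ := exists_nat_ge (20 + Real.exp 19 + C + (1 + house (D : K) + house (g : K) +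
    house (z : K)) + 41 * d)
  have hhD := house_nonneg (D : K)
  have hhg := house_nonneg (g : K)
  have hhz := house_nonneg (z : K)
  have hex := Real.exp_pos 19
  have hd0 : (0 : ℝ) ≤ d := Nat.cast_nonneg _
  set B := 1 + house (D : K) + house (g : K) + house (z : K) with hB
  have hYr : (20 : ℝ) ≤ Y := by linarith
  have hY : 20 ≤ Y := by exact_mod_cast hYr
  have hYe : Real.exp 19 ≤ Y := by linarith
  have hYC : C ≤ Y := by linarith
  have hYB : B ≤ Y := by linarith
  have hYd : 41 * d ≤ Y := by
    have : (41 * d : ℝ) ≤ Y := by linarith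
    exact_mod_cast this
  have hY1 : (1 : ℝ) ≤ Y := by linarith
  have hbound := fun {T m n k l : ℕ} => house_schneiderEntry_le' (K := K) (D := D) (g := g)
    (z := z) (B := B) (by linarith) (by linarith) (by linarith) (by linarith) (Y := Y) (T := T)
    (m := m) (n := n) (k := k) (l := l) (by omega) hYB
  let a : Matrix (Fin (Y ^ 4) × Fin (Y ^ 4)) (Fin (2 * Y ^ 6) × Fin (Y ^ 2)) (𝓞 K) :=
    fun p q => schneiderEntry D g z (2 * Y ^ 6 + Y ^ 2 * Y ^ 4) p.1 p.2 q.1 q.2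
  have hYpos : 0 < Y := by omega
  have ha : a ≠ 0 := by
    intro h
    have := congrFun (congrFun h (⟨0, by positivity⟩, ⟨0, by positivity⟩))
      (⟨0, by positivity⟩, ⟨0, by positivity⟩)
    simp [a, schneiderEntry, hD0] at this
  obtain ⟨ξ, hξ0, hξ1, hξ2⟩ := hC _ _ a (Y ^ 8) ((Y : ℝ) ^ (19 * Y ^ 2 * Y ^ 4)) (by positivity)
    (by positivity) ha (by simp; ring) (by simp; ring)
    (fun p q => hbound le_rfl p.1.2.le p.2.2.le q.1.2.le q.2.2.le)
  have hξb : ∀ q, house (ξ q : K) ≤ (Y : ℝ) ^ (20 * Y ^ 2 * Y ^ 4) := by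
    intro q
    refine (hξ2 q).trans ?_
    push_cast
    calc C * (C * (2 * (Y : ℝ) ^ 8) * (Y : ℝ) ^ (19 * Y ^ 2 * Y ^ 4)) ≤
        Y * (Y * (Y * (Y : ℝ) ^ 8) * (Y : ℝ) ^ (19 * Y ^ 2 * Y ^ 4)) := by
          gcongr
          linarith
      _ = (Y : ℝ) ^ (11 + 19 * Y ^ 2 * Y ^ 4) := by rw [pow_add]; ring
      _ ≤ _ := by
          refine pow_le_pow_right₀ hY1 ?_
          have : 20 ^ 2 ≤ Y ^ 2 := Nat.pow_le_pow_left hY 2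
          have : 0 < Y ^ 4 := by positivity
          nlinarith
  set F : ℂ → ℂ := fun w => ∑ p : Fin (2 * Y ^ 6) × Fin (Y ^ 2), φ (ξ p : K) *
    (w ^ (p.1 : ℕ) * Complex.exp (Real.pi * Complex.I * (p.2 : ℕ) * w)) with hF
  have hFd : Differentiable ℂ F := by
    rw [hF]
    fun_prop
  let ν : ℕ → ℕ → ℕ → 𝓞 K := fun T m n =>
    ∑ p : Fin (2 * Y ^ 6) × Fin (Y ^ 2), ξ p *
      schneiderEntry D g z (2 * Y ^ 6 + Y ^ 2 * T) m n p.1 p.2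
  have hν : ∀ {T m n : ℕ}, n ≤ T →
      φ (ν T m n : K) = D ^ (2 * Y ^ 6 + Y ^ 2 * T) * F (m + n * γ) := by
    intro T m n hn
    simp only [ν, hF, map_sum, map_mul, Finset.mul_sum]
    refine Finset.sum_congr rfl fun p _ => ?_
    have := map_schneiderEntry φ hg hz (m := m) (n := n) (k := p.1) (l := p.2)
      (E := 2 * Y ^ 6 + Y ^ 2 * T) (by nlinarith [Nat.mul_le_mul p.2.2.le hn, p.1.2.le])
    rw [this]
    ring
  have hDc : ∀ e : ℕ, (D : ℂ) ^ e ≠ 0 := fun e => pow_ne_zero _ (by exact_mod_cast hD0)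
  have hzero : ∀ m < Y ^ 4, ∀ n < Y ^ 4, F (m + n * γ) = 0 := by
    intro m hm n hn
    have h1 : ν (Y ^ 4) m n = 0 := by
      have := congrFun hξ1 (⟨m, hm⟩, ⟨n, hn⟩)
      simp only [Matrix.mulVec, dotProduct, a, Pi.zero_apply] at this
      rw [← this]
      exact Finset.sum_congr rfl fun p _ => mul_comm _ _
    have h2 := hν (T := Y ^ 4) (m := m) hn.le
    rw [h1] at h2
    simpa [hDc] using h2.symm
  have hex : ∃ T, ∃ m n : ℕ, m ≤ T ∧ n ≤ T ∧ F (m + n * γ) ≠ 0 := by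
    obtain ⟨m, n, h⟩ := exists_ne_zero_of_irrational hγ (fun p => φ (ξ p : K)) (by
      intro h
      apply hξ0
      ext p
      simpa using congrFun h p)
    exact ⟨max m n, m, n, le_max_left _ _, le_max_right _ _, h⟩
  obtain ⟨m, n, hm, hn, hmn⟩ := Nat.find_spec hex
  set T := Nat.find hex with hTdef
  have hmin : ∀ m' < T, ∀ n' < T, F (m' + n' * γ) = 0 := by
    intro m' hm' n' hn'
    by_contra h
    exact Nat.find_min hex (max_lt hm' hn') ⟨m', n', le_max_left _ _, le_max_right _ _, h⟩
  have hT : Y ^ 4 ≤ T := by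
    by_contra! h
    exact hmn (hzero m (hm.trans_lt h) n (hn.trans_lt h))
  have hT0 : 0 < T := lt_of_lt_of_le (by positivity) hT
  have hTr : (0 : ℝ) < T := by exact_mod_cast hT0
  have hinj : Function.Injective fun q : ℕ × ℕ => ((q.1 : ℂ) + q.2 * γ) := by
    rintro ⟨a, b⟩ ⟨a', b'⟩ h
    have h' : ((a : ℝ) + b * γ) = a' + b' * γ := by
      simp only at h
      exact_mod_cast h
    have hb : b = b' := by
      by_contra hb
      have hb' : (b : ℝ) - b' ≠ 0 := sub_ne_zero.2 (by exact_mod_cast hb)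
      refine hγ ⟨((a' : ℚ) - a) / (b - b'), ?_⟩
      push_cast
      rw [div_eq_iff hb']
      linarith
    subst hb
    simpa using h'
  set S : Finset ℂ := (Finset.range T ×ˢ Finset.range T).image
    fun q : ℕ × ℕ => ((q.1 : ℂ) + q.2 * γ) with hS
  have hScard : S.card = T ^ 2 := by
    rw [hS, Finset.card_image_of_injective _ hinj]
    simp [sq]
  have hnorm : ∀ {m n : ℕ}, m ≤ T → n ≤ T → ‖(m + n * γ : ℂ)‖ ≤ 2 * T := by
    intro m n hm hn
    refine (norm_add_le _ _).trans ?_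
    rw [norm_mul, Complex.norm_natCast, Complex.norm_natCast, Complex.norm_real,
      Real.norm_of_nonneg hγ0.le]
    have h1 : (m : ℝ) ≤ T := by exact_mod_cast hm
    have h2 : (n : ℝ) ≤ T := by exact_mod_cast hn
    nlinarith
  have hξT : ∀ q, house (ξ q : K) ≤ (Y : ℝ) ^ (20 * Y ^ 2 * T) := fun q =>
    (hξb q).trans (pow_le_pow_right₀ hY1 (Nat.mul_le_mul_left _ hT))
  have hFsmall : ‖F (m + n * γ)‖ ≤ (Y : ℝ) ^ (37 * Y ^ 2 * T + T ^ 2) * (1 / (Y : ℝ) ^ 2) ^ T ^ 2 := by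
    have := norm_le_of_zeros hFd S (by
        intro t ht
        obtain ⟨⟨m', n'⟩, hq, rfl⟩ := Finset.mem_image.1 ht
        rw [Finset.mem_product, Finset.mem_range, Finset.mem_range] at hq
        exact hmin m' hq.1 n' hq.2) (r := 2 * T) (R := 2 * T + 4 * T * (Y : ℝ) ^ 2)
      (M := (Y : ℝ) ^ (37 * Y ^ 2 * T + T ^ 2)) (by positivity)
      (by
        have : 0 < 4 * T * (Y : ℝ) ^ 2 := by positivity
        linarith) (by
        intro t ht
        obtain ⟨⟨m', n'⟩, hq, rfl⟩ := Finset.mem_image.1 ht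
        rw [Finset.mem_product, Finset.mem_range, Finset.mem_range] at hq
        exact hnorm hq.1.le hq.2.le) (fun w hw => schneider_growth hY hYe hT _
          (fun p => (norm_embedding_le_house _ φ).trans (hξT p)) (by
            rw [hw]
            have : (1 : ℝ) ≤ (Y : ℝ) ^ 2 := one_le_pow₀ hY1
            nlinarith)) (hnorm hm hn)
    rw [hScard] at this
    have e : 2 * (2 * (T : ℝ)) / (2 * T + 4 * T * (Y : ℝ) ^ 2 - 2 * T) = 1 / (Y : ℝ) ^ 2 := by
      have : (Y : ℝ) ≠ 0 := by linarith
      field_simp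
      ring
    rwa [e] at this
  have hνne : ν T m n ≠ 0 := by
    intro h
    have := hν (T := T) (m := m) hn
    rw [h] at this
    simp [hDc, hmn] at this
  have hνhouse : house (ν T m n : K) ≤ (Y : ℝ) ^ (40 * Y ^ 2 * T) := by
    have e : (ν T m n : K) = ∑ p : Fin (2 * Y ^ 6) × Fin (Y ^ 2), (ξ p : K) *
      (schneiderEntry D g z (2 * Y ^ 6 + Y ^ 2 * T) m n p.1 p.2 : 𝓞 K) := by
        simp [ν]
    rw [e]
    refine (house_sum_le_sum_house _ _).trans ?_
    calc _ ≤ ∑ p : Fin (2 * Y ^ 6) × Fin (Y ^ 2),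
          ((Y : ℝ) ^ (20 * Y ^ 2 * T) * (Y : ℝ) ^ (19 * Y ^ 2 * T)) :=
          Finset.sum_le_sum fun p _ => (house_mul_le _ _).trans
            (mul_le_mul (hξT p) (hbound hT hm hn p.1.2.le p.2.2.le) (house_nonneg _) (by positivity))
      _ = 2 * (Y : ℝ) ^ 8 * ((Y : ℝ) ^ (20 * Y ^ 2 * T) * (Y : ℝ) ^ (19 * Y ^ 2 * T)) := by
          rw [Finset.sum_const, Finset.card_univ]
          simp only [Fintype.card_prod, Fintype.card_fin, nsmul_eq_mul]
          push_cast
          ring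
      _ ≤ (Y : ℝ) ^ 9 * ((Y : ℝ) ^ (20 * Y ^ 2 * T) * (Y : ℝ) ^ (19 * Y ^ 2 * T)) := by
          gcongr
          rw [show (Y : ℝ) ^ 9 = Y * Y ^ 8 by ring]
          gcongr
          linarith
      _ = (Y : ℝ) ^ (9 + (20 * Y ^ 2 * T + 19 * Y ^ 2 * T)) := by simp only [pow_add]
      _ ≤ _ := by
          refine pow_le_pow_right₀ hY1 ?_
          have : 20 ^ 2 ≤ Y ^ 2 := Nat.pow_le_pow_left hY 2
          nlinarith
  have hDY : ‖(D : ℂ) ^ (2 * Y ^ 6 + Y ^ 2 * T)‖ ≤ (Y : ℝ) ^ (3 * Y ^ 2 * T) := by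
    rw [norm_pow]
    have h1 : ‖(D : ℂ)‖ ≤ Y := by
      have := norm_embedding_le_house (D : K) φ
      rw [map_intCast] at this
      linarith
    calc _ ≤ (Y : ℝ) ^ (2 * Y ^ 6 + Y ^ 2 * T) := by gcongr
      _ ≤ _ := by
        refine pow_le_pow_right₀ hY1 ?_
        have : Y ^ 2 * Y ^ 4 ≤ Y ^ 2 * T := Nat.mul_le_mul_left _ hT
        nlinarith
  have hmain := one_le_norm_mul_house_pow φ hνne
  rw [show φ (ν T m n) = _ from hν hn, norm_mul] at hmain
  have h1 : (1 : ℝ) ≤ ((Y : ℝ) ^ (3 * Y ^ 2 * T) * ((Y : ℝ) ^ (37 * Y ^ 2 * T + T ^ 2) *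
      (1 / (Y : ℝ) ^ 2) ^ T ^ 2)) * ((Y : ℝ) ^ (40 * Y ^ 2 * T)) ^ (d - 1) := by
    refine hmain.trans ?_
    have := house_nonneg (ν T m n : K)
    gcongr
  exact schneider_numeric hY hd1 hYd hT h1

/-- A special case of the Gelfond–Schneider theorem: if `γ` and `exp (π i γ)` are algebraic then
`γ` is rational. -/
theorem not_irrational_of_isAlgebraic_exp {γ : ℝ} (hγ0 : 0 < γ) (hγ1 : γ < 1)
    (hγ : IsAlgebraic ℚ (γ : ℂ))
    (hζ : IsAlgebraic ℚ (Complex.exp (Real.pi * Complex.I * γ))) : ¬ Irrational γ := by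
  intro hirr
  set ζ := Complex.exp (Real.pi * Complex.I * γ) with hζdef
  let K := IntermediateField.adjoin ℚ ({(γ : ℂ), ζ} : Set ℂ)
  have hfin : FiniteDimensional ℚ K := by
    refine IntermediateField.finiteDimensional_adjoin fun x hx => ?_
    rcases hx with rfl | rfl
    · exact hγ.isIntegral
    · exact hζ.isIntegral
  have : NumberField K := { to_charZero := inferInstance, to_finiteDimensional := hfin }
  let g₀ : K := ⟨(γ : ℂ), IntermediateField.subset_adjoin _ _ (by simp)⟩
  let z₀ : K := ⟨ζ, IntermediateField.subset_adjoin _ _ (by simp)⟩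
  classical
  obtain ⟨D, hD0, hD⟩ := exists_integral_multiples ℤ ℚ (L := K) {g₀, z₀}
  refine schneider_contradiction (algebraMap K ℂ) hγ0 hγ1 hirr hD0
    ⟨D • g₀, hD g₀ (by simp)⟩ ⟨D • z₀, hD z₀ (by simp)⟩ ?_ ?_
  · change algebraMap K ℂ (D • g₀) = _
    rw [zsmul_eq_mul, map_mul, map_intCast]
    rfl
  · change algebraMap K ℂ (D • z₀) = _
    rw [zsmul_eq_mul, map_mul, map_intCast]
    rfl

open Polynomial in
theorem irreducible_X_pow_three_add_sq_sub_one :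
    Irreducible (X ^ 3 + X ^ 2 - 1 : ℚ[X]) := by
  have hdeg : (X ^ 3 + X ^ 2 - 1 : ℚ[X]).natDegree = 3 := by compute_degree!
  have hm : (X ^ 3 + X ^ 2 - 1 : ℚ[X]).Monic := by monicity!
  rw [hm.irreducible_iff_roots_eq_zero_of_degree_le_three (by omega) (by omega)]
  refine Multiset.eq_zero_of_forall_notMem fun q hq => ?_
  have hq0 : q ^ 3 + q ^ 2 - 1 = 0 := by simpa using isRoot_of_mem_roots hq
  have hm' : (X ^ 3 + X ^ 2 - 1 : ℤ[X]).Monic := by monicity!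
  obtain ⟨n, hn⟩ := isInteger_of_is_root_of_monic hm' (r := q) (by simpa using hq0)
  have hn' : (n : ℚ) = q := by simpa using hn
  have h : n ^ 3 + n ^ 2 - 1 = 0 := by
    rw [← hn'] at hq0
    exact_mod_cast hq0
  have h1 : n ∣ 1 := ⟨n ^ 2 + n, by linarith⟩
  rcases Int.isUnit_iff.1 (isUnit_of_dvd_one h1) with rfl | rfl <;> norm_num at h

/-- The step-set angle is not a rational multiple of `π`. -/
theorem irrational_angle_div_pi {c θ : ℝ} (hc0 : 0 < c) (hc : c ^ 3 + c ^ 2 = 1)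
    (hθ : Real.cos θ = c ^ 3 / 2) : Irrational (θ / Real.pi) := by
  rintro ⟨q, hq⟩
  open Polynomial in
  set N : ℤ := 2 * q.den with hN
  have hN0 : (N : ℂ) ≠ 0 := by
    rw [hN]
    push_cast
    exact mul_ne_zero two_ne_zero (by exact_mod_cast q.den_ne_zero)
  have hθN : N * θ = q.num * (2 * Real.pi) := by
    have h1 : θ = q * Real.pi := by rw [hq, div_mul_cancel₀ _ Real.pi_ne_zero]
    have h2 : (q : ℝ) * q.den = q.num := by exact_mod_cast Rat.mul_den_eq_num q
    rw [hN, h1]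
    push_cast
    linear_combination (2 * Real.pi) * h2
  have hcos : (Polynomial.Chebyshev.T ℝ N).eval (c ^ 3 / 2) = 1 := by
    rw [← hθ, Polynomial.Chebyshev.T_real_cos, hθN]
    exact (Real.cos_eq_one_iff _).2 ⟨q.num, rfl⟩
  have hc3 : 1 / 3 < c := by
    by_contra! h
    have : c ^ 2 ≤ 1 / 9 := by nlinarith
    nlinarith
  set P : Polynomial ℚ := (Polynomial.Chebyshev.T ℚ N).comp
    (Polynomial.C (1 / 2) * Polynomial.X ^ 3) - 1 with hP
  have hPa : ∀ {A : Type} [Field A] [Algebra ℚ A] (x : A), Polynomial.aeval x P =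
      (Polynomial.Chebyshev.T A N).eval (x ^ 3 / 2) - 1 := by
    intro A _ _ x
    rw [hP, map_sub, map_one, Polynomial.aeval_comp, Polynomial.aeval_def, Polynomial.eval₂_eq_eval_map,
      Polynomial.Chebyshev.map_T]
    congr 2
    simp
    ring
  have hmin := minpoly.eq_of_irreducible_of_monic irreducible_X_pow_three_add_sq_sub_one
    (x := c) (by simp [hc]) (by monicity!)
  have hdvd : (Polynomial.X ^ 3 + Polynomial.X ^ 2 - 1 : Polynomial ℚ) ∣ P := by
    rw [hmin]
    exact minpoly.dvd _ _ (by rw [hPa, hcos, sub_self])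
  set δ := Real.sqrt ((1 + c) * (3 * c - 1)) with hδ
  have hδ0 : 0 < δ := Real.sqrt_pos.2 (mul_pos (by linarith) (by linarith))
  have hδ2 : δ ^ 2 = (1 + c) * (3 * c - 1) :=
    Real.sq_sqrt (mul_pos (by linarith) (by linarith)).le
  set x : ℂ := (-(1 + c) + δ * Complex.I) / 2 with hx
  have hx0 : x ^ 3 + x ^ 2 = 1 := by
    have e1 : (c : ℂ) ^ 3 + (c : ℂ) ^ 2 = 1 := by exact_mod_cast hc
    have e2 : (δ : ℂ) ^ 2 = (1 + c) * (3 * c - 1) := by exact_mod_cast hδ2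
    have e3 : x ^ 2 + (1 + c) * x + (c ^ 2 + c) = 0 := by
      rw [hx]
      linear_combination (δ : ℂ) ^ 2 / 4 * Complex.I_sq - 1 / 4 * e2
    linear_combination (x - c) * e3 + e1
  have hPx : Polynomial.aeval x P = 0 := by
    obtain ⟨R, hR⟩ := hdvd
    rw [hR, map_mul]
    simp [hx0]
  obtain ⟨w, hw⟩ := Complex.cos_surjective (x ^ 3 / 2)
  rw [hPa, ← hw, Polynomial.Chebyshev.T_complex_cos, sub_eq_zero, Complex.cos_eq_one_iff] at hPx
  obtain ⟨k, hk⟩ := hPx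
  have hwr : w = ((k * (2 * Real.pi) / N : ℝ) : ℂ) := by
    push_cast
    rw [hk]
    field_simp
  rw [hwr, ← Complex.ofReal_cos] at hw
  set r := Real.cos (k * (2 * Real.pi) / N)
  have h3 : x ^ 3 = ((2 * r : ℝ) : ℂ) := by
    push_cast
    linear_combination -2 * hw
  have h2 : x ^ 2 = ((1 - 2 * r : ℝ) : ℂ) := by
    push_cast
    push_cast at h3
    linear_combination hx0 - h3
  have him : (x ^ 2).im = -(1 + c) * δ / 2 := by
    rw [hx, sq]
    simp
    ring
  rw [h2, Complex.ofReal_im] at him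
  have : 0 < (1 + c) * δ := by positivity
  linarith

open scoped ComplexOrder in
/-- All iterated derivatives of `f` at `c` are real with alternating signs. -/
structure AlternatingAt (f : ℂ → ℂ) (c : ℂ) : Prop where
  analyticAt : AnalyticAt ℂ f c
  alternating : ∀ k, 0 ≤ (-1) ^ k * iteratedDeriv k f c

namespace AlternatingAt
open scoped ComplexOrder
open Filter Topology

theorem const {a : ℂ} (ha : 0 ≤ a) (c : ℂ) : AlternatingAt (fun _ => a) c :=
  ⟨analyticAt_const, fun k => by
    rcases k with _ | k
    · simpa using ha
    · simp [iteratedDeriv_const]⟩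

theorem mul {f g : ℂ → ℂ} {c : ℂ} (hf : AlternatingAt f c) (hg : AlternatingAt g c) :
    AlternatingAt (fun s => f s * g s) c := by
  refine ⟨hf.1.mul hg.1, fun k => ?_⟩
  rw [iteratedDeriv_fun_mul hf.1.contDiffAt hg.1.contDiffAt, Finset.mul_sum]
  refine Finset.sum_nonneg fun i hi => ?_
  have hi' : i ≤ k := by simpa [Nat.lt_succ_iff] using hi
  have e : ((-1 : ℂ)) ^ k * (k.choose i * iteratedDeriv i f c * iteratedDeriv (k - i) g c) =
      k.choose i * ((-1) ^ i * iteratedDeriv i f c) * ((-1) ^ (k - i) * iteratedDeriv (k - i) g c) := by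
    have : (-1 : ℂ) ^ k = (-1) ^ i * (-1) ^ (k - i) := by rw [← pow_add, Nat.add_sub_cancel' hi']
    rw [this]
    ring
  rw [e]
  have h1 : (0 : ℂ) ≤ (k.choose i : ℂ) := by exact_mod_cast Nat.zero_le _
  exact mul_nonneg (mul_nonneg h1 (hf.2 i)) (hg.2 _)

theorem add {f g : ℂ → ℂ} {c : ℂ} (hf : AlternatingAt f c) (hg : AlternatingAt g c) :
    AlternatingAt (fun s => f s + g s) c := by
  refine ⟨hf.1.add hg.1, fun k => ?_⟩
  rw [iteratedDeriv_fun_add hf.1.contDiffAt hg.1.contDiffAt, mul_add]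
  exact add_nonneg (hf.2 k) (hg.2 k)

theorem sum {ι : Type*} {f : ι → ℂ → ℂ} {c : ℂ} (s : Finset ι)
    (hf : ∀ i ∈ s, AlternatingAt (f i) c) : AlternatingAt (fun z => ∑ i ∈ s, f i z) c := by
  classical
  induction s using Finset.induction_on with
  | empty => simpa using const le_rfl c
  | insert a s ha ih =>
    simp only [Finset.sum_insert ha]
    exact (hf a (by simp)).add (ih fun i hi => hf i (Finset.mem_insert_of_mem hi))

theorem prod {ι : Type*} {f : ι → ℂ → ℂ} {c : ℂ} (s : Finset ι)
    (hf : ∀ i ∈ s, AlternatingAt (f i) c) : AlternatingAt (fun z => ∏ i ∈ s, f i z) c := by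
  classical
  induction s using Finset.induction_on with
  | empty => simpa using const zero_le_one c
  | insert a s ha ih =>
    simp only [Finset.prod_insert ha]
    exact (hf a (by simp)).mul (ih fun i hi => hf i (Finset.mem_insert_of_mem hi))

theorem inv_add {a c : ℝ} (h : 0 < c + a) : AlternatingAt (fun s => (s + (a : ℂ))⁻¹) (c : ℂ) := by
  have h' : (c : ℂ) + a ≠ 0 := by exact_mod_cast h.ne'
  refine ⟨by fun_prop (disch := assumption), fun k => ?_⟩
  have := congrFun (iter_deriv_inv_linear k (1 : ℂ) (a : ℂ)) c
  simp only [one_mul, one_pow, mul_one] at this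
  rw [iteratedDeriv_eq_iterate, this, ← mul_assoc, ← mul_assoc, ← mul_pow]
  simp only [mul_neg, mul_one, neg_neg, one_pow, one_mul]
  have : (0 : ℝ) ≤ k.factorial * (c + a) ^ (-1 - k : ℤ) := by positivity
  exact_mod_cast this

end AlternatingAt

open Filter Topology in
theorem TendstoLocallyUniformlyOn.iteratedDeriv_of_isOpen {U : Set ℂ} (hU : IsOpen U)
    {F : ℕ → ℂ → ℂ} {g : ℂ → ℂ} (hF : ∀ n, DifferentiableOn ℂ (F n) U)
    (h : TendstoLocallyUniformlyOn F g atTop U) (k : ℕ) :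
    TendstoLocallyUniformlyOn (fun n => iteratedDeriv k (F n)) (iteratedDeriv k g) atTop U := by
  induction k with
  | zero => simpa using h
  | succ k ih =>
    simp only [iteratedDeriv_succ]
    refine ih.deriv (Eventually.of_forall fun n => ?_) hU
    have := ((hF n).analyticOnNhd hU).iterated_deriv k
    rw [iteratedDeriv_eq_iterate]
    exact this.differentiableOn

open scoped ComplexOrder in
open Filter Topology in
/-- Landau's lemma: if the sum of a series of functions with alternating derivatives extends
holomorphically across `σ`, then its partial sums stay bounded slightly to the left of `σ`. -/
theorem sum_le_of_holomorphic_extension {f : ℕ → ℂ → ℂ} {M H : ℂ → ℂ} {σ ε τ : ℝ} (hε : 0 < ε)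
    (hf : ∀ n (c : ℝ), τ < c → AlternatingAt (f n) c) (hτ : τ ≤ σ - ε)
    (hd : ∀ n, DifferentiableOn ℂ (f n) {z | τ < z.re})
    (hM : TendstoLocallyUniformlyOn (fun n z => ∑ i ∈ Finset.range n, f i z) M atTop
      {z | σ < z.re})
    (hH : DifferentiableOn ℂ H (Metric.ball σ ε))
    (hHM : ∀ z ∈ Metric.ball (σ : ℂ) ε, σ < z.re → H z = M z) (n : ℕ) :
    ∑ i ∈ Finset.range n, f i (σ - ε / 6 : ℝ) ≤ H (σ - ε / 6 : ℝ) := by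
  set U : Set ℂ := {z | σ < z.re} with hUdef
  have hU : IsOpen U := isOpen_lt continuous_const Complex.continuous_re
  set c : ℝ := σ + ε / 3 with hc
  set g : ℂ → ℂ := fun z => H z - ∑ i ∈ Finset.range n, f i z with hg
  have hball : Metric.ball (c : ℂ) (2 * ε / 3) ⊆ Metric.ball (σ : ℂ) ε := by
    refine Metric.ball_subset_ball' ?_
    rw [Complex.dist_eq, ← Complex.ofReal_sub, Complex.norm_real, hc]
    simp only [add_sub_cancel_left, Real.norm_eq_abs]
    rw [abs_of_pos (by positivity)]
    linarith
  have hballre : ∀ z ∈ Metric.ball (σ : ℂ) ε, τ < z.re := by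
    intro z hz
    rw [Metric.mem_ball, Complex.dist_eq] at hz
    have := (abs_le.1 (Complex.abs_re_le_norm (z - σ))).1
    simp only [Complex.sub_re, Complex.ofReal_re] at this
    linarith
  have hgd : DifferentiableOn ℂ g (Metric.ball (c : ℂ) (2 * ε / 3)) := by
    refine (hH.mono hball).sub (DifferentiableOn.fun_sum fun i _ => (hd i).mono ?_)
    exact fun z hz => hballre z (hball hz)
  have hcU : (c : ℂ) ∈ U := by simp [hUdef, hc, hε]
  have hsubU : ∀ i, DifferentiableOn ℂ (f i) U := fun i => (hd i).mono fun z (hz : σ < z.re) => by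
    change τ < z.re
    linarith
  have halt : ∀ k, 0 ≤ (-1) ^ k * iteratedDeriv k g c := by
    intro k
    have hlim : TendstoLocallyUniformlyOn (fun N z => ∑ i ∈ Finset.Ico n N, f i z)
        (fun z => M z - ∑ i ∈ Finset.range n, f i z) atTop U := by
      rw [Metric.tendstoLocallyUniformlyOn_iff] at hM ⊢
      intro δ hδ z hz
      obtain ⟨t, ht, h⟩ := hM δ hδ z hz
      refine ⟨t, ht, ?_⟩
      filter_upwards [h, eventually_ge_atTop n] with N hN hn y hy
      rw [Finset.sum_Ico_eq_sub _ hn, dist_sub_right]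
      exact hN y hy
    have h1 := ((hlim.iteratedDeriv_of_isOpen hU
      (fun N => DifferentiableOn.fun_sum fun i _ => hsubU i) k).tendsto_at hcU)
    have h2 : iteratedDeriv k (fun z => M z - ∑ i ∈ Finset.range n, f i z) c =
        iteratedDeriv k g c := by
      refine Filter.EventuallyEq.iteratedDeriv_eq k ?_
      filter_upwards [hU.mem_nhds hcU, Metric.isOpen_ball.mem_nhds (hball (Metric.mem_ball_self
        (by positivity)))] with z hz hz'
      rw [hg]
      simp only
      rw [hHM z hz' hz]
    rw [h2] at h1
    refine ge_of_tendsto' (h1.const_mul ((-1) ^ k)) fun N => ?_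
    exact (AlternatingAt.sum _ fun i _ => hf i c (by rw [hc]; linarith)).2 k
  have hd' : DifferentiableOn ℂ (fun z => g (2 * c - z)) (Metric.ball (c : ℂ) (2 * ε / 3)) := by
    refine hgd.comp (by fun_prop) fun z hz => ?_
    rw [Metric.mem_ball, Complex.dist_eq] at hz ⊢
    rw [show 2 * (c : ℂ) - z - c = -(z - c) by ring, norm_neg]
    exact hz
  have hit : ∀ k, 0 ≤ iteratedDeriv k (fun z => g (2 * c - z)) c := by
    intro k
    have := congrFun (iteratedDeriv_comp_const_sub k g (2 * (c : ℂ))) c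
    rw [this, show 2 * (c : ℂ) - c = c by ring]
    simpa using halt k
  have hx : (c : ℂ) ≤ ((2 * c - (σ - ε / 6) : ℝ) : ℂ) := by
    have : c ≤ 2 * c - (σ - ε / 6) := by rw [hc]; linarith
    exact_mod_cast this
  have := hd'.nonneg_of_iteratedDeriv_nonneg hit hx (by
    rw [Metric.mem_ball, Complex.dist_eq, ← Complex.ofReal_sub, Complex.norm_real, hc,
      Real.norm_eq_abs, abs_lt]
    constructor <;> linarith)
  rw [show 2 * (c : ℂ) - ((2 * c - (σ - ε / 6) : ℝ) : ℂ) = ((σ - ε / 6 : ℝ) : ℂ) by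
    push_cast; ring] at this
  exact sub_nonneg.1 this

/-- The coefficient `n! / Γ(n + 1 + s)` of the fractional integral of order `s` at `1` of `t ^ n`. -/
noncomputable def fracCoeff (n : ℕ) (s : ℂ) : ℂ := n.factorial * (Complex.Gamma (n + 1 + s))⁻¹

theorem differentiable_fracCoeff (n : ℕ) : Differentiable ℂ (fracCoeff n) := by
  have h : Differentiable ℂ fun s : ℂ => (Complex.Gamma (n + 1 + s))⁻¹ :=
    Complex.differentiable_one_div_Gamma.comp (by fun_prop)
  exact h.const_mul _

theorem fracCoeff_sub (n : ℕ) (s : ℂ) :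
    fracCoeff n s - fracCoeff (n + 1) s = s * fracCoeff n (s + 1) := by
  have h := Complex.one_div_Gamma_eq_self_mul_one_div_Gamma_add_one (n + 1 + s)
  rw [fracCoeff, fracCoeff, fracCoeff, h, Nat.factorial_succ,
    show (n : ℂ) + 1 + (s + 1) = n + 1 + s + 1 by ring]
  push_cast
  rw [show (n : ℂ) + 1 + 1 + s = n + 1 + s + 1 by ring]
  ring

theorem succ_mul_fracCoeff (n : ℕ) (s : ℂ) :
    (n + 1) * fracCoeff n s = fracCoeff (n + 1) (s - 1) := by
  rw [fracCoeff, fracCoeff, Nat.factorial_succ]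
  push_cast
  rw [show (n : ℂ) + 1 + 1 + (s - 1) = n + 1 + s by ring]
  ring

open PowerSeries in
/-- `v` is the value of the fractional integral of order `s` at `1` of the power series `G`. -/
def HasFracIntegral (s : ℂ) (G : PowerSeries ℂ) (v : ℂ) : Prop :=
  HasSum (fun n => coeff n G * fracCoeff n s) v

namespace HasFracIntegral
open PowerSeries

variable {s : ℂ} {G : PowerSeries ℂ} {v : ℂ}

theorem sum {ι : Type*} (t : Finset ι) {G : ι → PowerSeries ℂ} {v : ι → ℂ}
    (h : ∀ i ∈ t, HasFracIntegral s (G i) (v i)) :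
    HasFracIntegral s (∑ i ∈ t, G i) (∑ i ∈ t, v i) := by
  have := hasSum_sum h
  unfold HasFracIntegral
  simpa only [map_sum, Finset.sum_mul] using this

theorem smul {K : Type*} [Field K] [Algebra K ℂ] (h : HasFracIntegral s G v) (a : K) :
    HasFracIntegral s (a • G) (algebraMap K ℂ a * v) := by
  have h1 := HasSum.mul_left (algebraMap K ℂ a) h
  have h2 : (fun n => coeff n (a • G) * fracCoeff n s) =
      fun n => algebraMap K ℂ a * (coeff n G * fracCoeff n s) := by
    funext n
    rw [← algebraMap_smul ℂ a G, map_smul, smul_eq_mul, mul_assoc]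
  unfold HasFracIntegral
  rwa [h2]

theorem one_sub_X_mul {v' : ℂ} (h' : HasFracIntegral s G v') (h : HasFracIntegral (s + 1) G v) :
    HasFracIntegral s ((1 - X) * G) (s * v) := by
  have h1 : HasSum (fun n => coeff n G * fracCoeff (n + 1) s) (v' - s * v) := by
    have e : (fun n => coeff n G * fracCoeff (n + 1) s) =
        fun n => coeff n G * fracCoeff n s - s * (coeff n G * fracCoeff n (s + 1)) := by
      funext n
      linear_combination (-coeff n G) * fracCoeff_sub n s
    rw [e]
    exact HasSum.sub h' (HasSum.mul_left s h)
  have h2 : HasSum (fun n => coeff n (X * G) * fracCoeff n s) (v' - s * v) := by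
    rw [← hasSum_nat_add_iff' 1]
    simpa [coeff_succ_X_mul] using h1
  have h3 := HasSum.sub h' h2
  rw [sub_sub_cancel] at h3
  have e : (fun n => coeff n ((1 - X) * G) * fracCoeff n s) =
      fun n => coeff n G * fracCoeff n s - coeff n (X * G) * fracCoeff n s := by
    funext n
    rw [sub_mul, one_mul, map_sub, sub_mul]
  unfold HasFracIntegral
  rwa [e]

theorem derivative (h : HasFracIntegral (s - 1) G v) :
    HasFracIntegral s (PowerSeries.derivative ℂ G) (v - coeff 0 G * fracCoeff 0 (s - 1)) := by
  have h1 : HasSum (fun n => coeff (n + 1) G * fracCoeff (n + 1) (s - 1))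
      (v - coeff 0 G * fracCoeff 0 (s - 1)) := by
    have := (hasSum_nat_add_iff' 1).2 h
    simpa using this
  unfold HasFracIntegral
  convert h1 using 2 with n
  rw [← succ_mul_fracCoeff, PowerSeries.coeff_derivative]
  ring

theorem polynomial (Q : Polynomial ℂ) (s : ℂ) :
    HasFracIntegral s (Q : PowerSeries ℂ) (∑ n ∈ Q.support, Q.coeff n * fracCoeff n s) := by
  unfold HasFracIntegral
  simp only [Polynomial.coeff_coe]
  refine hasSum_sum_of_ne_finset_zero fun n hn => ?_
  rw [Polynomial.notMem_support_iff.1 hn, zero_mul]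

theorem one_sub_X_pow_mul {g : ℂ → ℂ} {r : ℝ} (h : ∀ s : ℂ, r < s.re → HasFracIntegral s G (g s))
    (j : ℕ) : ∀ s : ℂ, r < s.re →
      HasFracIntegral s ((1 - X) ^ j * G) ((ascPochhammer ℂ j).eval s * g (s + j)) := by
  induction j with
  | zero => simpa using h
  | succ j ih =>
    intro s hs
    have h2 := (ih s hs).one_sub_X_mul (ih (s + 1) (by simp; linarith))
    rw [pow_succ', mul_assoc]
    convert h2 using 1
    rw [ascPochhammer_succ_left]
    simp only [Polynomial.eval_mul, Polynomial.eval_X, Polynomial.eval_comp, Polynomial.eval_add,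
      Polynomial.eval_one]
    push_cast
    ring_nf

theorem iterate_derivative {g : ℂ → ℂ} {r : ℝ}
    (h : ∀ s : ℂ, r < s.re → HasFracIntegral s G (g s)) (i : ℕ) :
    ∃ E : ℂ → ℂ, Differentiable ℂ E ∧ ∀ s : ℂ, r + i < s.re →
      HasFracIntegral s ((⇑(PowerSeries.derivative ℂ))^[i] G) (g (s - i) - E s) := by
  induction i with
  | zero => exact ⟨0, differentiable_const 0, by simpa using h⟩
  | succ i ih =>
    obtain ⟨E, hE, ih⟩ := ih
    refine ⟨fun s => E (s - 1) + coeff 0 ((⇑(PowerSeries.derivative ℂ))^[i] G) *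
      fracCoeff 0 (s - 1), ?_, fun s hs => ?_⟩
    · have := differentiable_fracCoeff 0
      fun_prop
    · rw [Function.iterate_succ_apply']
      have := (ih (s - 1) (by push_cast at hs; simp; linarith)).derivative
      convert this using 1
      push_cast
      ring_nf

end HasFracIntegral

open Polynomial in
theorem exists_sum_ascPochhammer_ne_zero {K : Type*} [Field K] [CharZero K] (J : ℕ) (q : ℕ → K)
    (j₀ : ℕ) (hj₀ : j₀ < J) (hq : q j₀ ≠ 0) :
    ∑ j ∈ Finset.range J, C (q j) * ascPochhammer K j ≠ 0 := by
  let S : Polynomial.Sequence K := ⟨fun j => ascPochhammer K j, fun j => by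
    rw [degree_eq_natDegree (monic_ascPochhammer K j).ne_zero, ascPochhammer_natDegree]⟩
  intro h
  have := linearIndependent_iff'.1 S.linearIndependent (Finset.range J) q (by
    rw [← h]
    refine Finset.sum_congr rfl fun j _ => ?_
    rw [smul_eq_C_mul]) j₀ (Finset.mem_range.2 hj₀)
  exact hq this

open Polynomial in
theorem sum_reindex_shift {A : Type*} [AddCommMonoid A] (k J : ℕ) (G : ℕ → ℕ → ℕ → A) :
    ∑ i ∈ Finset.range (k + 1), ∑ j ∈ Finset.range J, G i j (j + k - i) =
      ∑ d ∈ Finset.range (J + k), ∑ j ∈ Finset.range J,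
        if d ≤ j + k ∧ j ≤ d then G (j + k - d) j d else 0 := by
  rw [Finset.sum_comm, Finset.sum_comm (s := Finset.range (J + k))]
  refine Finset.sum_congr rfl fun j hj => ?_
  rw [← Finset.sum_filter]
  refine Finset.sum_nbij' (fun i => j + k - i) (fun d => j + k - d) ?_ ?_ ?_ ?_ ?_
  all_goals intro i hi; simp only [Finset.mem_range, Finset.mem_filter] at hi hj ⊢
  · omega
  · omega
  · omega
  · omega
  · rw [show j + k - (j + k - i) = i by omega]

open Polynomial in
theorem exists_functional_equation {K : Type*} [Field K] [Algebra K ℂ] (k : ℕ)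
    (b : ℕ → K[X]) (hb : b k ≠ 0) (Q : ℂ[X]) (y : PowerSeries ℂ)
    (hode : ∑ i ∈ Finset.range (k + 1), aeval (1 - PowerSeries.X : PowerSeries ℂ) (b i) *
      (⇑(PowerSeries.derivative ℂ))^[i] y = (Q : PowerSeries ℂ)) {μ : ℝ} {M : ℂ → ℂ}
    (hM : ∀ s : ℂ, μ < s.re → HasFracIntegral s y (M s))
    (hMd : DifferentiableOn ℂ M {s | μ < s.re}) :
    ∃ P : K[X], P ≠ 0 ∧ ∃ S : ℂ → ℂ, DifferentiableOn ℂ S {s | μ - 1 < s.re} ∧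
      ∀ s : ℂ, μ < s.re → aeval s P * M s = S s := by
  have : CharZero K := (algebraMap K ℂ).charZero
  set J := (Finset.range (k + 1)).sup (fun i => (b i).natDegree) + 1 with hJ
  have hdeg : ∀ i ∈ Finset.range (k + 1), (b i).natDegree < J := fun i hi =>
    Nat.lt_succ_of_le (Finset.le_sup (f := fun i => (b i).natDegree) hi)
  have hE := fun i => HasFracIntegral.iterate_derivative hM i
  choose E hEd hE using hE
  set χ : ℕ → K[X] := fun d => ∑ j ∈ Finset.range J,
    C (if d ≤ j + k ∧ j ≤ d then (b (j + k - d)).coeff j else 0) * ascPochhammer K j with hχ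
  set R : ℂ → ℂ := fun s => ∑ n ∈ Q.support, Q.coeff n * fracCoeff n s +
    ∑ i ∈ Finset.range (k + 1), ∑ j ∈ Finset.range J, algebraMap K ℂ ((b i).coeff j) *
      ((ascPochhammer ℂ j).eval s * E i (s + j)) with hR
  have hRd : Differentiable ℂ R := by
    have h1 := differentiable_fracCoeff
    refine Differentiable.add (Differentiable.fun_sum fun n _ => (h1 n).const_mul _)
      (Differentiable.fun_sum fun i _ => Differentiable.fun_sum fun j _ => ?_)
    have h2 : Differentiable ℂ fun s => (ascPochhammer ℂ j).eval s := Polynomial.differentiable _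
    have h3 := hEd i
    fun_prop
  have hfe : ∀ s : ℂ, μ + k < s.re →
      ∑ d ∈ Finset.range (J + k), aeval s (χ d) * M (s + d - k) = R s := by
    intro s hs
    have h1 : HasFracIntegral s (Q : PowerSeries ℂ) (∑ i ∈ Finset.range (k + 1),
        ∑ j ∈ Finset.range J, algebraMap K ℂ ((b i).coeff j) *
          ((ascPochhammer ℂ j).eval s * (M (s + j - i) - E i (s + j)))) := by
      rw [← hode]
      refine HasFracIntegral.sum _ fun i hi => ?_
      rw [aeval_eq_sum_range' (hdeg i hi), Finset.sum_mul]
      refine HasFracIntegral.sum _ fun j hj => ?_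
      rw [smul_mul_assoc]
      refine HasFracIntegral.smul ?_ _
      have hik : (i : ℝ) ≤ k := by exact_mod_cast Nat.lt_succ_iff.1 (Finset.mem_range.1 hi)
      exact HasFracIntegral.one_sub_X_pow_mul (hE i) j s (by linarith)
    have h2 := HasSum.unique h1 (HasFracIntegral.polynomial Q s)
    have h3 : ∑ i ∈ Finset.range (k + 1), ∑ j ∈ Finset.range J,
        algebraMap K ℂ ((b i).coeff j) * ((ascPochhammer ℂ j).eval s * M (s + j - i)) = R s := by
      rw [hR]
      simp only
      rw [← h2, ← Finset.sum_add_distrib]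
      refine Finset.sum_congr rfl fun i _ => ?_
      rw [← Finset.sum_add_distrib]
      exact Finset.sum_congr rfl fun j _ => by ring
    rw [← h3]
    have h4 := sum_reindex_shift k J (fun i j d => algebraMap K ℂ ((b i).coeff j) *
      ((ascPochhammer ℂ j).eval s * M (s + d - k)))
    have h5 : ∑ i ∈ Finset.range (k + 1), ∑ j ∈ Finset.range J,
        algebraMap K ℂ ((b i).coeff j) * ((ascPochhammer ℂ j).eval s * M (s + j - i)) =
        ∑ i ∈ Finset.range (k + 1), ∑ j ∈ Finset.range J,
        algebraMap K ℂ ((b i).coeff j) *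
          ((ascPochhammer ℂ j).eval s * M (s + ((j + k - i : ℕ) : ℂ) - k)) := by
      refine Finset.sum_congr rfl fun i hi => Finset.sum_congr rfl fun j _ => ?_
      have : i ≤ j + k := by have := Finset.mem_range.1 hi; omega
      rw [Nat.cast_sub this]
      push_cast
      congr 3
      ring
    rw [h5, h4]
    refine Finset.sum_congr rfl fun d _ => ?_
    rw [hχ]
    simp only [map_sum, map_mul, aeval_C, Finset.sum_mul]
    refine Finset.sum_congr rfl fun j _ => ?_
    have : aeval s (ascPochhammer K j) = (ascPochhammer ℂ j).eval s := by
      rw [← ascPochhammer_map (algebraMap K ℂ), eval_map_algebraMap]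
    rw [this]
    split_ifs <;> simp [mul_assoc]
  obtain ⟨j₀, hj₀⟩ : ∃ j, (b k).coeff j ≠ 0 := by
    by_contra! h
    exact hb (Polynomial.ext fun j => by simpa using h j)
  have hj₀J : j₀ < J := lt_of_le_of_lt (le_natDegree_of_ne_zero hj₀) (hdeg k (by simp))
  have hex : ∃ d, d < J + k ∧ χ d ≠ 0 := ⟨j₀, by omega,
    exists_sum_ascPochhammer_ne_zero J _ j₀ hj₀J (by simpa using hj₀)⟩
  classical
  set d₀ := Nat.find hex with hd₀
  obtain ⟨hd₀lt, hχd₀⟩ := Nat.find_spec hex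
  have hmin : ∀ d < d₀, χ d = 0 := fun d hd => by
    by_contra h
    exact Nat.find_min hex hd ⟨by omega, h⟩
  set S : ℂ → ℂ := fun s => R (s + k - d₀) - ∑ d ∈ Finset.Ico (d₀ + 1) (J + k),
    aeval (s + k - d₀) (χ d) * M (s + d - d₀) with hS
  have haev : ∀ P : K[X], Differentiable ℂ fun s : ℂ => aeval s P := fun P => by
    exact Polynomial.differentiable_aeval P
  have hSd : DifferentiableOn ℂ S {s | μ - 1 < s.re} := by
    refine DifferentiableOn.sub (hRd.comp (by fun_prop)).differentiableOn
      (DifferentiableOn.fun_sum fun d hd => ?_)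
    refine DifferentiableOn.mul ((haev (χ d)).comp (g := fun s => aeval s (χ d))
      (f := fun s : ℂ => s + k - d₀) (by fun_prop)).differentiableOn ?_
    refine hMd.comp (f := fun s : ℂ => s + d - d₀) (by fun_prop) fun s (hs : μ - 1 < s.re) => ?_
    have : (d₀ : ℝ) + 1 ≤ d := by exact_mod_cast (Finset.mem_Ico.1 hd).1
    simp
    linarith
  refine ⟨(χ d₀).comp (X + C ((k : K) - d₀)), ?_, S, hSd, ?_⟩
  · intro h
    rcases comp_eq_zero_iff.1 h with h | h
    · exact hχd₀ h
    · have := congrArg (fun p => coeff p 1) h.2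
      simp at this
  have key : ∀ s : ℂ, μ + d₀ < s.re → aeval (s + k - d₀) (χ d₀) * M s = S s := by
    intro s hs
    have h := hfe (s + k - d₀) (by simp; linarith)
    rw [Finset.range_eq_Ico, ← Finset.sum_Ico_consecutive _ (Nat.zero_le d₀) hd₀lt.le,
      Finset.sum_eq_zero, zero_add, Finset.sum_eq_sum_Ico_succ_bot hd₀lt] at h
    · rw [hS]
      simp only
      rw [← h, show s + k - d₀ + d₀ - k = s by ring]
      have : ∀ d : ℕ, s + k - d₀ + d - k = s + d - d₀ := fun d => by ring
      simp only [this]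
      ring
    · intro d hd
      rw [hmin d (Finset.mem_Ico.1 hd).2]
      simp
  have hcomp : ∀ s : ℂ, aeval s ((χ d₀).comp (X + C ((k : K) - d₀))) =
      aeval (s + k - d₀) (χ d₀) := fun s => by
    rw [aeval_comp]
    simp [add_sub_assoc]
  have hopen : IsOpen {s : ℂ | μ < s.re} := isOpen_lt continuous_const Complex.continuous_re
  have hA : AnalyticOnNhd ℂ (fun s => aeval s ((χ d₀).comp (X + C ((k : K) - d₀))) * M s)
      {s : ℂ | μ < s.re} := ((haev _).differentiableOn.mul hMd).analyticOnNhd hopen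
  have hB : AnalyticOnNhd ℂ S {s : ℂ | μ < s.re} :=
    (hSd.mono fun s (hs : μ < s.re) => by change μ - 1 < s.re; linarith).analyticOnNhd hopen
  have hconv : IsPreconnected {s : ℂ | μ < s.re} :=
    (convex_halfSpace_re_gt μ).isPreconnected
  have hz : ((μ + d₀ + 1 : ℝ) : ℂ) ∈ {s : ℂ | μ < s.re} := by
    simp only [Set.mem_ofPred_eq, Complex.ofReal_re]
    have : (0 : ℝ) ≤ d₀ := Nat.cast_nonneg _
    linarith
  refine hA.eqOn_of_preconnected_of_eventuallyEq hB hconv hz ?_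
  have : {s : ℂ | μ + d₀ < s.re} ∈ nhds ((μ + d₀ + 1 : ℝ) : ℂ) :=
    (isOpen_lt continuous_const Complex.continuous_re).mem_nhds (by
      simp only [Set.mem_ofPred_eq, Complex.ofReal_re]; linarith)
  filter_upwards [this] with s hs
  rw [hcomp, key s hs]

/-- The normalised coefficient `(m + 2)! Γ(s + 3) / Γ(m + 3 + s)`. -/
noncomputable def normFracCoeff (m : ℕ) (s : ℂ) : ℂ :=
  (m + 2).factorial * ∏ k ∈ Finset.range m, (s + ((3 + k : ℝ) : ℂ))⁻¹

/-- The restriction of `normFracCoeff` to the real axis. -/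
noncomputable def realFracCoeff (m : ℕ) (σ : ℝ) : ℝ :=
  (m + 2).factorial * ∏ k ∈ Finset.range m, (σ + (3 + k))⁻¹

theorem normFracCoeff_ofReal (m : ℕ) (σ : ℝ) : normFracCoeff m σ = realFracCoeff m σ := by
  simp [normFracCoeff, realFracCoeff]

theorem realFracCoeff_nonneg (m : ℕ) {σ : ℝ} (hσ : -3 < σ) : 0 ≤ realFracCoeff m σ := by
  refine mul_nonneg (Nat.cast_nonneg _) (Finset.prod_nonneg fun k _ => ?_)
  have : (0 : ℝ) ≤ k := k.cast_nonneg
  exact inv_nonneg.2 (by linarith)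

theorem norm_normFracCoeff_le (m : ℕ) {σ : ℝ} (hσ : -3 < σ) {s : ℂ} (hs : σ ≤ s.re) :
    ‖normFracCoeff m s‖ ≤ realFracCoeff m σ := by
  rw [normFracCoeff, realFracCoeff, norm_mul, norm_prod, Complex.norm_natCast]
  gcongr with k hk
  rw [norm_inv]
  have : (0 : ℝ) ≤ k := k.cast_nonneg
  gcongr
  · linarith
  · refine le_trans ?_ (Complex.re_le_norm _)
    simpa using hs

theorem add_ofReal_ne_zero {s : ℂ} {a : ℝ} (h : 0 < s.re + a) : s + (a : ℂ) ≠ 0 := fun h' => by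
  have := congrArg Complex.re h'
  simp at this
  linarith

theorem differentiableOn_normFracCoeff (m : ℕ) :
    DifferentiableOn ℂ (normFracCoeff m) {s | -3 < s.re} := by
  refine DifferentiableOn.const_mul (DifferentiableOn.fun_finsetProd fun k _ => ?_) _
  refine DifferentiableOn.inv (by fun_prop) fun s (hs : -3 < s.re) => ?_
  have : (0 : ℝ) ≤ k := k.cast_nonneg
  exact add_ofReal_ne_zero (by linarith)

theorem fracCoeff_add_two (m : ℕ) {s : ℂ} (hs : -3 < s.re) :
    fracCoeff (m + 2) s = normFracCoeff m s * (Complex.Gamma (s + 3))⁻¹ := by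
  have h : Complex.Gamma (s + 3 + m) =
      (∏ k ∈ Finset.range m, (s + ((3 + k : ℝ) : ℂ))) * Complex.Gamma (s + 3) := by
    induction m with
    | zero => simp
    | succ m ih =>
      have h0 : s + 3 + m ≠ 0 := by
        have := add_ofReal_ne_zero (s := s) (a := 3 + m) (by
          have : (0 : ℝ) ≤ m := m.cast_nonneg
          linarith)
        push_cast at this
        rwa [add_assoc]
      push_cast
      rw [← add_assoc, Complex.Gamma_add_one _ h0, ih, Finset.prod_range_succ]
      push_cast
      ring
  rw [fracCoeff, normFracCoeff, Finset.prod_inv_distrib, mul_assoc, ← mul_inv, ← h]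
  congr 3
  push_cast
  ring

open scoped ComplexOrder in
theorem alternatingAt_normFracCoeff (m : ℕ) {c : ℝ} (hc : -3 < c) :
    AlternatingAt (normFracCoeff m) c := by
  refine AlternatingAt.mul (AlternatingAt.const (by exact_mod_cast Nat.zero_le _) _)
    (AlternatingAt.prod _ fun k _ => AlternatingAt.inv_add ?_)
  have : (0 : ℝ) ≤ k := k.cast_nonneg
  linarith

open Filter Topology Asymptotics in
theorem realFracCoeff_isTheta {σ : ℝ} (hσ : -3 < σ) :
    (fun n => realFracCoeff (n + 1) σ) =Θ[atTop] fun n => ((n + 3 : ℕ) : ℝ) ^ (-σ) := by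
  refine IsTheta.symm (isTheta_of_div_tendsto_nhds_ne_zero (c := Real.Gamma (σ + 3)) ?_
    (Real.Gamma_pos_of_pos (by linarith)).ne')
  have h1 := Real.GammaSeq_tendsto_Gamma (σ + 3)
  have h2 : Tendsto (fun n : ℕ => (1 : ℝ) / n) atTop (𝓝 0) := tendsto_one_div_atTop_nhds_zero_nat
  have h3 : Tendsto (fun n : ℕ => (1 + 1 * (1 / (n : ℝ))) * (1 + 2 * (1 / (n : ℝ))) *
      (1 + 3 * (1 / (n : ℝ))) * (1 + 3 * (1 / (n : ℝ))) ^ σ) atTop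
      (𝓝 ((1 + 1 * 0) * (1 + 2 * 0) * (1 + 3 * 0) * (1 + 3 * 0) ^ σ)) := by
    have h4 := fun a : ℝ => (h2.const_mul a).const_add 1
    exact (((h4 1).mul (h4 2)).mul (h4 3)).mul
      ((h4 3).rpow_const (Or.inl (by norm_num)))
  have h5 := h1.mul h3
  simp only [mul_zero, add_zero, Real.one_rpow, mul_one] at h5
  refine h5.congr' ?_
  filter_upwards [eventually_gt_atTop 0] with n hn
  have hn' : (0 : ℝ) < n := by exact_mod_cast hn
  have e1 : 1 + 3 * (1 / (n : ℝ)) = (n + 3) / n := by field_simp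
  have e2 : 1 + 2 * (1 / (n : ℝ)) = (n + 2) / n := by field_simp
  have e3 : 1 + 1 * (1 / (n : ℝ)) = (n + 1) / n := by field_simp
  rw [Real.GammaSeq, realFracCoeff, Finset.prod_inv_distrib]
  simp only [one_mul] at e3
  rw [e1, e2, one_mul, e3, Real.div_rpow (by positivity) (by positivity), Real.rpow_add hn',
    Nat.cast_add, Real.rpow_neg (by positivity)]
  have hp : ∏ k ∈ Finset.range (n + 1), (σ + (3 + (k : ℝ))) =
      ∏ k ∈ Finset.range (n + 1), (σ + 3 + (k : ℝ)) := by simp only [add_assoc]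
  rw [hp]
  have hp0 : ∏ k ∈ Finset.range (n + 1), (σ + 3 + (k : ℝ)) ≠ 0 :=
    Finset.prod_ne_zero_iff.2 fun k _ => by
      have : (0 : ℝ) ≤ k := k.cast_nonneg
      linarith
  have hnσ : (n : ℝ) ^ σ ≠ 0 := (Real.rpow_pos_of_pos hn' _).ne'
  have h3n : (n : ℝ) ^ (3 : ℝ) = (n : ℝ) ^ 3 := by norm_cast
  rw [h3n, show (n + 1 + 2).factorial = (n + 3) * ((n + 2) * ((n + 1) * n.factorial)) from rfl]
  push_cast
  field_simp

open Filter Topology Asymptotics in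
theorem summable_mul_realFracCoeff_iff (a : ℕ → ℝ) {σ : ℝ} (hσ : -3 < σ) :
    Summable (fun m => a (m + 2) * realFracCoeff m σ) ↔ Summable fun n => a n * (n : ℝ) ^ (-σ) := by
  rw [← summable_nat_add_iff 1, ← summable_nat_add_iff (f := fun n => a n * (n : ℝ) ^ (-σ)) 3]
  exact ((isTheta_refl (fun n => a (n + 3)) atTop).mul (realFracCoeff_isTheta hσ)).summable_iff_nat

open Polynomial Filter Topology in
theorem exists_polynomial_root_of_ode {K : Type*} [Field K] [Algebra K ℂ] (k : ℕ)
    (b : ℕ → K[X]) (hb : b k ≠ 0) (Q : ℂ[X]) (a : ℕ → ℝ) (ha : ∀ n, 0 ≤ a n)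
    (hode : ∑ i ∈ Finset.range (k + 1), aeval (1 - PowerSeries.X : PowerSeries ℂ) (b i) *
      (⇑(PowerSeries.derivative ℂ))^[i] (PowerSeries.mk fun n => (a n : ℂ)) =
        (Q : PowerSeries ℂ)) {l : ℝ} (hl : l < 3)
    (hs : ∀ s < l, Summable fun n => a n * (n : ℝ) ^ s)
    (hns : ∀ s > l, ¬ Summable fun n => a n * (n : ℝ) ^ s) :
    ∃ P : K[X], P ≠ 0 ∧ aeval (-l : ℂ) P = 0 := by
  have hsum : ∀ σ : ℝ, -l < σ → Summable fun m => a (m + 2) * realFracCoeff m σ := fun σ hσ =>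
    (summable_mul_realFracCoeff_iff a (by linarith)).2 (hs (-σ) (by linarith))
  set f : ℕ → ℂ → ℂ := fun m s => a (m + 2) * normFracCoeff m s with hf
  set M : ℂ → ℂ := fun s => ∑' m, f m s with hMdef
  have hfd : ∀ m, DifferentiableOn ℂ (f m) {s | -3 < s.re} := fun m =>
    (differentiableOn_normFracCoeff m).const_mul _
  have hbound : ∀ σ : ℝ, -l < σ → ∀ m, ∀ s ∈ {s : ℂ | σ < s.re},
      ‖f m s‖ ≤ a (m + 2) * realFracCoeff m σ := by
    intro σ hσ m s hs
    rw [hf, norm_mul, Complex.norm_real, Real.norm_of_nonneg (ha _)]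
    exact mul_le_mul_of_nonneg_left (norm_normFracCoeff_le m (by linarith) (le_of_lt hs)) (ha _)
  have hopen : ∀ σ : ℝ, IsOpen {s : ℂ | σ < s.re} := fun σ =>
    isOpen_lt continuous_const Complex.continuous_re
  have hMd : DifferentiableOn ℂ M {s | -l < s.re} := by
    intro s (hs : -l < s.re)
    obtain ⟨σ, h1, h2⟩ := exists_between hs
    have := Complex.differentiableOn_tsum_of_summable_norm (hsum σ h1)
      (fun m => (hfd m).mono fun z (hz : σ < z.re) => by change -3 < z.re; linarith)
      (hopen σ) (hbound σ h1)
    exact ((this s h2).differentiableAt ((hopen σ).mem_nhds h2)).differentiableWithinAt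
  have hMtend : TendstoLocallyUniformlyOn (fun n z => ∑ i ∈ Finset.range n, f i z) M atTop
      {z | -l < z.re} := by
    rw [Metric.tendstoLocallyUniformlyOn_iff]
    intro δ hδ s (hs : -l < s.re)
    obtain ⟨σ, h1, h2⟩ := exists_between hs
    have := tendstoUniformlyOn_tsum_nat (hsum σ h1) (hbound σ h1)
    exact ⟨_, mem_nhdsWithin_of_mem_nhds ((hopen σ).mem_nhds h2),
      Metric.tendstoUniformlyOn_iff.1 this δ hδ⟩
  set E : ℂ → ℂ := fun s => a 0 * fracCoeff 0 s + a 1 * fracCoeff 1 s with hE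
  have hEd : Differentiable ℂ E := by
    have := differentiable_fracCoeff
    exact ((this 0).const_mul _).add ((this 1).const_mul _)
  have hΓd : DifferentiableOn ℂ (fun s => (Complex.Gamma (s + 3))⁻¹) {s | -l < s.re} :=
    (Complex.differentiable_one_div_Gamma.comp (by fun_prop)).differentiableOn
  have hfrac : ∀ s : ℂ, -l < s.re → HasFracIntegral s (PowerSeries.mk fun n => (a n : ℂ))
      (M s * (Complex.Gamma (s + 3))⁻¹ + E s) := by
    intro s hs
    unfold HasFracIntegral
    rw [← hasSum_nat_add_iff' 2]
    obtain ⟨σ, h1, h2⟩ := exists_between hs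
    have h3 : Summable fun m => f m s := Summable.of_norm_bounded (hsum σ h1)
      fun m => hbound σ h1 m s h2
    have e1 : (fun m => PowerSeries.coeff (m + 2) (PowerSeries.mk fun n => (a n : ℂ)) *
        fracCoeff (m + 2) s) = fun m => f m s * (Complex.Gamma (s + 3))⁻¹ := by
      funext m
      rw [PowerSeries.coeff_mk, fracCoeff_add_two m (by linarith), ← mul_assoc]
    have e2 : ∑ i ∈ Finset.range 2, PowerSeries.coeff i (PowerSeries.mk fun n => (a n : ℂ)) *
        fracCoeff i s = E s := by
      simp [Finset.sum_range_succ, hE]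
    rw [e1, e2, add_sub_cancel_right]
    exact h3.hasSum.mul_right _
  obtain ⟨P, hP0, S, hSd, hPS⟩ := exists_functional_equation k b hb Q _ hode hfrac
    ((hMd.mul hΓd).add hEd.differentiableOn)
  refine ⟨P, hP0, ?_⟩
  by_contra hne
  have hPd : Differentiable ℂ fun s : ℂ => aeval s P := Polynomial.differentiable_aeval P
  obtain ⟨ε₀, hε₀, hPne⟩ := Metric.eventually_nhds_iff_ball.1
    (hPd.continuous.continuousAt.eventually_ne hne)
  obtain ⟨ε, hε, hεlt⟩ : ∃ ε, 0 < ε ∧ ε < min ε₀ (min 1 (3 - l)) := exists_between (by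
    simp only [lt_min_iff]
    exact ⟨hε₀, one_pos, by linarith⟩)
  simp only [lt_min_iff] at hεlt
  obtain ⟨hε1, hε2, hε3⟩ := hεlt
  have hre : ∀ z ∈ Metric.ball ((-l : ℝ) : ℂ) ε, -l - ε < z.re := by
    intro z hz
    rw [Metric.mem_ball, Complex.dist_eq] at hz
    have := (abs_le.1 (Complex.abs_re_le_norm (z - (-l : ℝ)))).1
    simp only [Complex.sub_re, Complex.ofReal_re] at this
    linarith
  have hPne' : ∀ z ∈ Metric.ball ((-l : ℝ) : ℂ) ε, aeval z P ≠ 0 := fun z hz =>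
    hPne z (by
      push_cast at hz
      exact Metric.ball_subset_ball hε1.le hz)
  set H : ℂ → ℂ := fun s => Complex.Gamma (s + 3) * (S s / aeval s P - E s) with hH
  have hHd : DifferentiableOn ℂ H (Metric.ball ((-l : ℝ) : ℂ) ε) := by
    refine DifferentiableOn.mul (fun z hz => ?_) (DifferentiableOn.sub (DifferentiableOn.div
      (hSd.mono fun z hz => ?_) hPd.differentiableOn hPne') hEd.differentiableOn)
    · have h1 : DifferentiableAt ℂ Complex.Gamma (z + 3) :=
        Complex.differentiableAt_Gamma _ fun m h => by
          have h2 := congrArg Complex.re h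
          have h3 := hre z hz
          have h4 : (0 : ℝ) ≤ m := m.cast_nonneg
          simp at h2
          linarith
      exact (DifferentiableAt.comp z (f := fun z : ℂ => z + 3) h1 (by fun_prop)).differentiableWithinAt
    · have := hre z hz
      change -l - 1 < z.re
      linarith
  have hHM : ∀ z ∈ Metric.ball ((-l : ℝ) : ℂ) ε, -l < z.re → H z = M z := by
    intro z hz hz'
    have h1 := hPS z hz'
    have h2 := hPne' z hz
    have h3 : Complex.Gamma (z + 3) ≠ 0 := Complex.Gamma_ne_zero_of_re_pos (by
      simp
      linarith)
    rw [hH]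
    simp only
    rw [← h1]
    field_simp
    ring
  have key := sum_le_of_holomorphic_extension hε (τ := -3) (σ := -l) (f := f) (M := M) (H := H)
    (fun n c hc => AlternatingAt.mul (AlternatingAt.const (by exact_mod_cast ha _) _)
      (alternatingAt_normFracCoeff n hc)) (by linarith) hfd hMtend hHd hHM
  refine hns (l + ε / 6) (by linarith) ?_
  have h6 := summable_mul_realFracCoeff_iff a (σ := -l - ε / 6) (by linarith)
  rw [show -(-l - ε / 6) = l + ε / 6 by ring] at h6
  rw [← h6]
  refine summable_of_sum_range_le (c := (H (-l - ε / 6 : ℝ)).re) (fun n =>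
    mul_nonneg (ha _) (realFracCoeff_nonneg n (by linarith))) fun n => ?_
  have h7 := (Complex.le_def.1 (key n)).1
  simp only [hf, normFracCoeff_ofReal] at h7
  exact_mod_cast h7

/-- The substitution of `t / ρ` into a power series with rational coefficients. -/
noncomputable def rescaleRat (ρ : ℂ) : PowerSeries ℚ →+* PowerSeries ℂ :=
  (PowerSeries.rescale ρ⁻¹).comp (PowerSeries.map (algebraMap ℚ ℂ))

theorem coeff_rescaleRat (ρ : ℂ) (G : PowerSeries ℚ) (n : ℕ) :
    PowerSeries.coeff n (rescaleRat ρ G) = ρ⁻¹ ^ n * (PowerSeries.coeff n G : ℚ) := by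
  simp [rescaleRat, PowerSeries.coeff_rescale]

theorem rescaleRat_derivative {ρ : ℂ} (hρ : ρ ≠ 0) (G : PowerSeries ℚ) :
    rescaleRat ρ (PowerSeries.derivative ℚ G) = ρ • PowerSeries.derivative ℂ (rescaleRat ρ G) := by
  ext n
  rw [coeff_rescaleRat, map_smul, PowerSeries.coeff_derivative, PowerSeries.coeff_derivative,
    coeff_rescaleRat]
  push_cast
  rw [smul_eq_mul, pow_succ]
  field_simp

theorem rescaleRat_iterate_derivative {ρ : ℂ} (hρ : ρ ≠ 0) (G : PowerSeries ℚ) (i : ℕ) :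
    rescaleRat ρ ((⇑(PowerSeries.derivative ℚ))^[i] G) =
      ρ ^ i • (⇑(PowerSeries.derivative ℂ))^[i] (rescaleRat ρ G) := by
  induction i with
  | zero => simp
  | succ i ih =>
    rw [Function.iterate_succ_apply', Function.iterate_succ_apply', rescaleRat_derivative hρ, ih,
      Derivation.map_smul, smul_smul, pow_succ']

theorem rescaleRat_X (ρ : ℂ) : rescaleRat ρ PowerSeries.X = ρ⁻¹ • PowerSeries.X := by
  ext n
  rw [coeff_rescaleRat, map_smul, PowerSeries.coeff_X, PowerSeries.coeff_X]
  split_ifs with h <;> simp [h]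

open Polynomial in
theorem rescaleRat_coe (ρ : ℂ) (q : ℚ[X]) : rescaleRat ρ (q : PowerSeries ℚ) =
    (((q.map (algebraMap ℚ ℂ)).comp (C ρ⁻¹ * X) : ℂ[X]) : PowerSeries ℂ) := by
  have h : (rescaleRat ρ).comp Polynomial.coeToPowerSeries.ringHom =
      Polynomial.coeToPowerSeries.ringHom.comp
        ((Polynomial.compRingHom (C ρ⁻¹ * X)).comp (Polynomial.mapRingHom (algebraMap ℚ ℂ))) := by
    refine Polynomial.ringHom_ext' (Subsingleton.elim _ _) ?_
    simp [rescaleRat_X, PowerSeries.smul_eq_C_mul]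
  exact RingHom.congr_fun h q

open Polynomial in
theorem aeval_one_sub_X_eq_rescaleRat {K : Type*} [Field K] [Algebra K ℂ] [Algebra ℚ K] (r : K)
    (q : ℚ[X]) : aeval (1 - PowerSeries.X : PowerSeries ℂ)
      ((q.map (algebraMap ℚ K)).comp (C r⁻¹ * (1 - X))) =
        rescaleRat (algebraMap K ℂ r) (q : PowerSeries ℚ) := by
  have h : ((aeval (1 - PowerSeries.X : PowerSeries ℂ) : K[X] →ₐ[K] _) : K[X] →+* _).comp
      ((Polynomial.compRingHom (C r⁻¹ * (1 - X))).comp (Polynomial.mapRingHom (algebraMap ℚ K))) =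
      (rescaleRat (algebraMap K ℂ r)).comp Polynomial.coeToPowerSeries.ringHom := by
    refine Polynomial.ringHom_ext' (Subsingleton.elim _ _) ?_
    have h1 : algebraMap K (PowerSeries ℂ) r⁻¹ = PowerSeries.C (algebraMap K ℂ r)⁻¹ := by
      rw [IsScalarTower.algebraMap_apply K ℂ (PowerSeries ℂ), map_inv₀]
      rfl
    simp [rescaleRat_X, PowerSeries.smul_eq_C_mul, h1]
  exact RingHom.congr_fun h q

open Polynomial in
theorem exists_polynomial_root_of_rational_ode {K : Type*} [Field K] [Algebra K ℂ] [Algebra ℚ K]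
    (F : PowerSeries ℚ) (hF : ∀ n, 0 ≤ PowerSeries.coeff n F)
    (k : ℕ) (Q : ℚ[X]) (c : ℕ → ℚ[X]) (hc : c k ≠ 0)
    (hode : ∑ i ∈ Finset.range (k + 1), (c i : PowerSeries ℚ) *
      (⇑(PowerSeries.derivative ℚ))^[i] F = (Q : PowerSeries ℚ))
    {ρ : ℝ} (hρ : 0 < ρ) (r : K) (hr : algebraMap K ℂ r = ρ)
    {l : ℝ} (hl : l < 3)
    (hs : ∀ s < l, Summable fun n : ℕ =>
      ((PowerSeries.coeff n F : ℚ) : ℝ) / ρ ^ n * (n : ℝ) ^ s)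
    (hns : ∀ s > l, ¬ Summable fun n : ℕ =>
      ((PowerSeries.coeff n F : ℚ) : ℝ) / ρ ^ n * (n : ℝ) ^ s) :
    ∃ P : K[X], P ≠ 0 ∧ aeval (-l : ℂ) P = 0 := by
  have hρ0 : (ρ : ℂ) ≠ 0 := by exact_mod_cast hρ.ne'
  have hr0 : r ≠ 0 := fun h => hρ0 (by rw [← hr, h, map_zero])
  set b : ℕ → K[X] := fun i =>
    C (r ^ i) * ((c i).map (algebraMap ℚ K)).comp (C r⁻¹ * (1 - X)) with hb
  have hbk : b k ≠ 0 := by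
    refine mul_ne_zero (C_ne_zero.2 (pow_ne_zero _ hr0)) fun h => ?_
    rcases comp_eq_zero_iff.1 h with h | h
    · exact hc ((Polynomial.map_eq_zero _).1 h)
    · have := congrArg (fun p => coeff p 1) h.2
      simp [hr0, coeff_one] at this
  have hbΨ : ∀ i, aeval (1 - PowerSeries.X : PowerSeries ℂ) (b i) =
      (ρ : ℂ) ^ i • rescaleRat ρ (c i : PowerSeries ℚ) := by
    intro i
    rw [hb, map_mul, aeval_one_sub_X_eq_rescaleRat, aeval_C, ← Algebra.smul_def,
      ← algebraMap_smul ℂ (r ^ i), map_pow, hr]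
  set a : ℕ → ℝ := fun n => ((PowerSeries.coeff n F : ℚ) : ℝ) / ρ ^ n with ha
  have hy : PowerSeries.mk (fun n => (a n : ℂ)) = rescaleRat ρ F := by
    ext n
    rw [PowerSeries.coeff_mk, coeff_rescaleRat, ha]
    push_cast
    rw [div_eq_mul_inv, inv_pow, mul_comm]
  have hode' : ∑ i ∈ Finset.range (k + 1), aeval (1 - PowerSeries.X : PowerSeries ℂ) (b i) *
      (⇑(PowerSeries.derivative ℂ))^[i] (PowerSeries.mk fun n => (a n : ℂ)) =
      (((Q.map (algebraMap ℚ ℂ)).comp (C (ρ : ℂ)⁻¹ * X) : ℂ[X]) : PowerSeries ℂ) := by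
    have h := congrArg (rescaleRat ρ) hode
    rw [map_sum] at h
    rw [← rescaleRat_coe, ← h]
    refine Finset.sum_congr rfl fun i _ => ?_
    rw [hy, hbΨ, map_mul, rescaleRat_iterate_derivative hρ0, smul_mul_assoc, mul_smul_comm]
  exact exists_polynomial_root_of_ode k b hbk _ a
    (fun n => div_nonneg (by exact_mod_cast hF n) (by positivity)) hode' hl hs hns

open Polynomial in
theorem isAlgebraic_exponent_of_ode (F : PowerSeries ℚ) (hF : ∀ n, 0 ≤ PowerSeries.coeff n F)
    (k : ℕ) (Q : ℚ[X]) (c : ℕ → ℚ[X]) (hc : c k ≠ 0)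
    (hode : ∑ i ∈ Finset.range (k + 1), (c i : PowerSeries ℚ) *
      (⇑(PowerSeries.derivative ℚ))^[i] F = (Q : PowerSeries ℚ))
    {ρ : ℝ} (hρ : 0 < ρ) (hρa : IsAlgebraic ℚ (ρ : ℂ)) {l : ℝ} (hl : l < 3)
    (hs : ∀ s < l, Summable fun n : ℕ =>
      ((PowerSeries.coeff n F : ℚ) : ℝ) / ρ ^ n * (n : ℝ) ^ s)
    (hns : ∀ s > l, ¬ Summable fun n : ℕ =>
      ((PowerSeries.coeff n F : ℚ) : ℝ) / ρ ^ n * (n : ℝ) ^ s) :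
    IsAlgebraic ℚ (l : ℂ) := by
  obtain ⟨P, hP0, hP⟩ := exists_polynomial_root_of_rational_ode (K := algebraicClosure ℚ ℂ) F hF k Q
    c hc hode hρ ⟨(ρ : ℂ), mem_algebraicClosure_iff.2 hρa⟩ rfl hl hs hns
  have h1 : IsAlgebraic (algebraicClosure ℚ ℂ) (-l : ℂ) := ⟨P, hP0, hP⟩
  have : Algebra.IsAlgebraic ℚ (algebraicClosure ℚ ℂ) :=
    ⟨fun x => (isAlgebraic_algebraMap_iff (algebraMap (algebraicClosure ℚ ℂ) ℂ).injective).1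
      (mem_algebraicClosure_iff.1 x.2)⟩
  have h2 : IsAlgebraic ℚ (-l : ℂ) := h1.restrictScalars ℚ
  simpa using h2.neg

open scoped NNReal ENNReal

section Walk

variable {ι : Type*} [Fintype ι] (wt : ι → ℝ≥0) (st : ι → ℤ × ℤ)

open Classical in
/-- The total weight of walks of length `n` from `z` to `w` that stay in the quadrant. -/
noncomputable def quadrantWalk : ℕ → ℤ × ℤ → ℤ × ℤ → ℝ≥0
  | 0, z, w => if 0 ≤ z ∧ z = w then 1 else 0
  | n + 1, z, w => if 0 ≤ z then ∑ i, wt i * quadrantWalk n (z + st i) w else 0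

theorem quadrantWalk_eq_zero_left (n : ℕ) {z : ℤ × ℤ} (hz : ¬ 0 ≤ z) (w : ℤ × ℤ) :
    quadrantWalk wt st n z w = 0 := by
  cases n <;> simp [quadrantWalk, hz]

theorem quadrantWalk_succ {z : ℤ × ℤ} (hz : 0 ≤ z) (n : ℕ) (w : ℤ × ℤ) :
    quadrantWalk wt st (n + 1) z w = ∑ i, wt i * quadrantWalk wt st n (z + st i) w := by
  simp [quadrantWalk, hz]

theorem quadrantWalk_add (m n : ℕ) (z w : ℤ × ℤ) :
    (quadrantWalk wt st (m + n) z w : ℝ≥0∞) =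
      ∑' v, (quadrantWalk wt st m z v : ℝ≥0∞) * quadrantWalk wt st n v w := by
  induction m generalizing z with
  | zero =>
    rw [zero_add, tsum_eq_single z]
    · by_cases hz : 0 ≤ z
      · simp [quadrantWalk, hz]
      · simp [quadrantWalk_eq_zero_left, hz]
    · intro v hv
      simp [quadrantWalk, hv.symm]
  | succ m ih =>
    by_cases hz : 0 ≤ z
    · rw [add_right_comm]
      simp only [quadrantWalk_succ wt st hz, ENNReal.ofNNReal_finsetSum, ENNReal.coe_mul, ih,
        Finset.sum_mul, mul_assoc]
      rw [Summable.tsum_finsetSum fun _ _ => ENNReal.summable]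
      simp only [ENNReal.tsum_mul_left]
    · simp [quadrantWalk_eq_zero_left, hz]

theorem tsum_quadrantWalk_mul_le {h : ℤ × ℤ → ℝ≥0∞}
    (hh : ∀ z, 0 ≤ z → ∑ i, wt i * h (z + st i) ≤ h z) (n : ℕ) (z : ℤ × ℤ) :
    ∑' w, quadrantWalk wt st n z w * h w ≤ h z := by
  induction n generalizing z with
  | zero =>
    rw [tsum_eq_single z]
    · by_cases hz : 0 ≤ z <;> simp [quadrantWalk, hz]
    · intro v hv
      simp [quadrantWalk, hv.symm]
  | succ n ih =>
    by_cases hz : 0 ≤ z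
    · refine le_trans ?_ (hh z hz)
      simp only [quadrantWalk_succ wt st hz, ENNReal.ofNNReal_finsetSum, ENNReal.coe_mul,
        Finset.sum_mul, mul_assoc]
      rw [Summable.tsum_finsetSum fun _ _ => ENNReal.summable]
      simp only [ENNReal.tsum_mul_left]
      exact Finset.sum_le_sum fun i _ => by gcongr; exact ih _
    · simp [quadrantWalk_eq_zero_left, hz]

theorem quadrantWalk_one (z w : ℤ × ℤ) [Decidable (0 ≤ z ∧ 0 ≤ w)] :
    quadrantWalk wt st 1 z w =
      if 0 ≤ z ∧ 0 ≤ w then ∑ i, if z + st i = w then wt i else 0 else 0 := by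
  by_cases hz : 0 ≤ z
  · rw [quadrantWalk_succ wt st hz]
    by_cases hw : 0 ≤ w
    · rw [if_pos ⟨hz, hw⟩]
      refine Finset.sum_congr rfl fun i _ => ?_
      by_cases h : z + st i = w
      · simp [quadrantWalk, h, hw]
      · simp [quadrantWalk, h]
    · rw [if_neg fun h => hw h.2]
      refine Finset.sum_eq_zero fun i _ => ?_
      have : ¬ (0 ≤ z + st i ∧ z + st i = w) := fun h => hw (h.2 ▸ h.1)
      simp [quadrantWalk, this]
  · rw [quadrantWalk_eq_zero_left wt st 1 hz, if_neg fun h => hz h.1]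

variable {wt st}

/-- If reversing and reflecting the steps permutes them, then reversing and reflecting walks is a
weight-preserving symmetry. -/
theorem quadrantWalk_swap {τ : Equiv.Perm ι} (hst : ∀ i, st (τ i) = -(st i).swap)
    (hwt : ∀ i, wt (τ i) = wt i) (n : ℕ) (z w : ℤ × ℤ) :
    quadrantWalk wt st n w.swap z.swap = quadrantWalk wt st n z w := by
  classical
  have hnn : ∀ v : ℤ × ℤ, 0 ≤ v.swap ↔ 0 ≤ v := fun v => by
    simp [Prod.le_def, and_comm]
  induction n generalizing z w with
  | zero =>
    by_cases h : z = w
    · subst h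
      simp [quadrantWalk, hnn]
    · have : w.swap ≠ z.swap := fun h' => h (Prod.swap_injective h').symm
      simp [quadrantWalk, h, this]
  | succ n ih =>
    have h1 : ∀ z w : ℤ × ℤ, quadrantWalk wt st 1 w.swap z.swap = quadrantWalk wt st 1 z w := by
      intro z w
      rw [quadrantWalk_one, quadrantWalk_one]
      simp only [hnn, and_comm]
      congr 1
      rw [← Equiv.sum_comp τ]
      refine Finset.sum_congr rfl fun i _ => ?_
      rw [hst, hwt]
      congr 1
      rw [eq_iff_iff, ← sub_eq_add_neg, sub_eq_iff_eq_add]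
      constructor
      · intro h
        exact Prod.swap_injective (by rw [Prod.swap_add]; exact h.symm)
      · rintro rfl
        simp
    have h2 := quadrantWalk_add wt st n 1 w.swap z.swap
    have h3 := quadrantWalk_add wt st 1 n z w
    rw [← (Equiv.prodComm ℤ ℤ).tsum_eq] at h2
    simp only [Equiv.prodComm_apply, h1, ih] at h2
    have h4 : (quadrantWalk wt st (n + 1) w.swap z.swap : ℝ≥0∞) =
        quadrantWalk wt st (1 + n) z w := by
      rw [h2, h3]
      exact tsum_congr fun v => mul_comm _ _
    rw [add_comm n 1]
    rw [add_comm n 1] at h4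
    exact_mod_cast h4

end Walk

section WalkDecay

variable {ι : Type*} [Fintype ι] {wt : ι → ℝ≥0} {st : ι → ℤ × ℤ}

theorem tsum_quadrantWalk_le_one (hwt : ∑ i, wt i ≤ 1) (n : ℕ) (z : ℤ × ℤ) :
    ∑' w, (quadrantWalk wt st n z w : ℝ≥0∞) ≤ 1 := by
  have h := tsum_quadrantWalk_mul_le wt st (h := fun _ => 1) (fun z _ => by
    simp only [mul_one]
    exact_mod_cast hwt) n z
  simpa using h

theorem tsum_quadrantWalk_antitone (hwt : ∑ i, wt i ≤ 1) (z : ℤ × ℤ) :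
    Antitone fun n => ∑' w, (quadrantWalk wt st n z w : ℝ≥0∞) := by
  refine antitone_nat_of_succ_le fun n => ?_
  simp only [quadrantWalk_add wt st n 1]
  rw [ENNReal.tsum_comm]
  simp only [ENNReal.tsum_mul_left]
  exact ENNReal.tsum_le_tsum fun v =>
    (mul_le_mul_right (tsum_quadrantWalk_le_one hwt 1 v) _).trans (by rw [mul_one])

theorem quadrantWalk_add_le {K : ℝ≥0∞} {n : ℕ}
    (hK : ∀ z w, (quadrantWalk wt st n z w : ℝ≥0∞) ≤ K) (m : ℕ) (z w : ℤ × ℤ) :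
    (quadrantWalk wt st (m + n) z w : ℝ≥0∞) ≤
      (∑' v, (quadrantWalk wt st m z v : ℝ≥0∞)) * K := by
  rw [quadrantWalk_add, ← ENNReal.tsum_mul_right]
  exact ENNReal.tsum_le_tsum fun v => by gcongr; exact hK v w

theorem quadrantWalk_eq_zero_right (n : ℕ) (z : ℤ × ℤ) {w : ℤ × ℤ} (hw : ¬ 0 ≤ w) :
    quadrantWalk wt st n z w = 0 := by
  induction n generalizing z with
  | zero =>
    have : ¬ (0 ≤ z ∧ z = w) := fun h => hw (h.2 ▸ h.1)
    simp [quadrantWalk, this]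
  | succ n ih => simp [quadrantWalk, ih]

/-- Mass of the walk after `m + m` steps, split according to the distance from the corner. -/
theorem tsum_quadrantWalk_double_le {K : ℝ≥0∞} {m : ℕ}
    (hK : ∀ z w, (quadrantWalk wt st m z w : ℝ≥0∞) ≤ K) {h : ℤ × ℤ → ℝ≥0∞}
    (hh : ∀ z, 0 ≤ z → ∑ i, wt i * h (z + st i) ≤ h z) (R : ℕ) {B : ℝ≥0∞} (hB0 : B ≠ 0)
    (hBt : B ≠ ⊤)
    (hB : ∀ w : ℤ × ℤ, 0 ≤ w → (R : ℤ) ≤ w.1 + w.2 → B ≤ h w) (z : ℤ × ℤ) :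
    ∑' w, (quadrantWalk wt st (m + m) z w : ℝ≥0∞) ≤
      (R * R : ℕ) * ((∑' w, (quadrantWalk wt st m z w : ℝ≥0∞)) * K) + h z / B := by
  classical
  set S : Finset (ℤ × ℤ) := Finset.Ico 0 (R : ℤ) ×ˢ Finset.Ico 0 (R : ℤ) with hS
  have hcard : S.card = R * R := by simp [hS]
  have hpt : ∀ w, (quadrantWalk wt st (m + m) z w : ℝ≥0∞) ≤
      (if w ∈ S then (quadrantWalk wt st (m + m) z w : ℝ≥0∞) else 0) +
        (quadrantWalk wt st (m + m) z w * h w) / B := by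
    intro w
    by_cases hw : 0 ≤ w
    · split_ifs with hwS
      · exact le_self_add
      · rw [zero_add, ENNReal.le_div_iff_mul_le (Or.inl hB0) (Or.inl hBt)]
        gcongr
        refine hB w hw ?_
        by_contra hcon
        refine hwS ?_
        have := hw.1
        have := hw.2
        simp only [hS, Finset.mem_product, Finset.mem_Ico]
        simp only [Prod.fst_zero, Prod.snd_zero] at *
        omega
    · simp [quadrantWalk_eq_zero_right _ _ hw]
  refine (ENNReal.tsum_le_tsum hpt).trans ?_
  rw [ENNReal.tsum_add]
  refine add_le_add ?_ ?_
  · rw [tsum_eq_sum (s := S) (fun w hw => by simp [hw])]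
    refine (Finset.sum_le_card_nsmul S _ ((∑' w, (quadrantWalk wt st m z w : ℝ≥0∞)) * K) ?_).trans ?_
    · intro w hw
      rw [if_pos hw]
      exact quadrantWalk_add_le hK m z w
    · rw [hcard, nsmul_eq_mul]
  · simp only [div_eq_mul_inv]
    rw [ENNReal.tsum_mul_right]
    gcongr
    exact tsum_quadrantWalk_mul_le wt st hh _ _

theorem tsum_quadrantWalk_le_rpow (hwt : ∑ i, wt i ≤ 1) {K : ℝ} (hK0 : 0 < K)
    (hK : ∀ n : ℕ, 0 < n → ∀ z w, (quadrantWalk wt st n z w : ℝ) ≤ K / n)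
    {h : ℤ × ℤ → ℝ≥0∞} (hh : ∀ z, 0 ≤ z → ∑ i, wt i * h (z + st i) ≤ h z)
    {μ c₀ : ℝ} (hμ : 0 < μ) (hc₀ : 0 < c₀)
    (hlow : ∀ z : ℤ × ℤ, 0 ≤ z → ENNReal.ofReal (c₀ * ((1 + z.1 + z.2 : ℤ) : ℝ) ^ μ) ≤ h z)
    (z : ℤ × ℤ) (hz : h z ≠ ⊤) :
    ∃ M : ℝ, 0 < M ∧ ∀ n : ℕ, 0 < n →
      ∑' w, (quadrantWalk wt st n z w : ℝ≥0∞) ≤ ENNReal.ofReal (M * (n : ℝ) ^ (-(μ / 2))) := by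
  set E : ℝ := (3 : ℝ) ^ (μ / 2) with hE
  have hE0 : 0 < E := by positivity
  set δ : ℝ := Real.sqrt (1 / (2 * E * K)) with hδ
  have hδ0 : 0 < δ := Real.sqrt_pos.2 (by positivity)
  have hδ2 : δ ^ 2 * K * E = 1 / 2 := by
    rw [hδ, Real.sq_sqrt (by positivity)]
    field_simp
  set H : ℝ := (h z).toReal with hH
  have hH0 : 0 ≤ H := ENNReal.toReal_nonneg
  set C : ℝ := H / (c₀ * δ ^ μ) with hC
  have hC0 : 0 ≤ C := by positivity
  refine ⟨2 * E * C + 1, by positivity, ?_⟩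
  intro n
  induction n using Nat.strong_induction_on with
  | _ n ih =>
  intro hn
  rcases Nat.lt_or_ge n 2 with hn2 | hn2
  · obtain rfl : n = 1 := by omega
    refine (tsum_quadrantWalk_le_one hwt 1 z).trans ?_
    rw [← ENNReal.ofReal_one]
    refine ENNReal.ofReal_le_ofReal ?_
    simp only [Nat.cast_one, Real.one_rpow, mul_one]
    nlinarith [mul_nonneg hE0.le hC0]
  set m := n / 2 with hm
  have hm0 : 0 < m := by omega
  have hmn : m + m ≤ n := by omega
  have hmR : (0 : ℝ) < m := by exact_mod_cast hm0
  have hnm : (n : ℝ) / 3 ≤ m := by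
    have : n ≤ 3 * m := by omega
    have : (n : ℝ) ≤ 3 * m := by exact_mod_cast this
    linarith
  set R : ℕ := ⌊δ * Real.sqrt m⌋₊ with hR
  have hRle : (R : ℝ) ≤ δ * Real.sqrt m := Nat.floor_le (by positivity)
  have hRlt : δ * Real.sqrt m < R + 1 := Nat.lt_floor_add_one _
  set B : ℝ := c₀ * (δ * Real.sqrt m) ^ μ with hB
  have hB0 : 0 < B := by positivity
  have hBe : B = c₀ * δ ^ μ * (m : ℝ) ^ (μ / 2) := by
    rw [hB, Real.mul_rpow hδ0.le (Real.sqrt_nonneg _), Real.sqrt_eq_rpow, ← Real.rpow_mul hmR.le]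
    ring_nf
  have key := tsum_quadrantWalk_double_le (wt := wt) (st := st) (K := ENNReal.ofReal (K / m))
    (m := m) (fun z w => by
      rw [← ENNReal.ofReal_coe_nnreal]
      exact ENNReal.ofReal_le_ofReal (hK m hm0 z w)) hh R (B := ENNReal.ofReal B)
    (by simpa using hB0) ENNReal.ofReal_ne_top (fun w hw hRw => by
      refine le_trans (ENNReal.ofReal_le_ofReal ?_) (hlow w hw)
      rw [hB]
      gcongr
      refine hRlt.le.trans ?_
      have : ((R : ℤ) : ℝ) ≤ ((w.1 + w.2 : ℤ) : ℝ) := by exact_mod_cast hRw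
      push_cast at this ⊢
      linarith) z
  refine (tsum_quadrantWalk_antitone hwt z hmn).trans (key.trans ?_)
  have ihm := ih m (by omega) hm0
  have hx0 : (0 : ℝ) ≤ (m : ℝ) ^ (-(μ / 2)) := by positivity
  calc _ ≤ ENNReal.ofReal (δ ^ 2 * m) * (ENNReal.ofReal ((2 * E * C + 1) * (m : ℝ) ^ (-(μ / 2))) *
        ENNReal.ofReal (K / m)) + ENNReal.ofReal H / ENNReal.ofReal B := by
        gcongr
        · rw [← ENNReal.ofReal_natCast]
          refine ENNReal.ofReal_le_ofReal ?_
          push_cast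
          calc (R : ℝ) * R ≤ (δ * Real.sqrt m) * (δ * Real.sqrt m) := by gcongr
            _ = δ ^ 2 * m := by
              rw [mul_mul_mul_comm, Real.mul_self_sqrt hmR.le]; ring
        · rw [hH, ENNReal.ofReal_toReal hz]
    _ = ENNReal.ofReal (δ ^ 2 * m * ((2 * E * C + 1) * (m : ℝ) ^ (-(μ / 2)) * (K / m)) + H / B) := by
        rw [← ENNReal.ofReal_mul (by positivity), ← ENNReal.ofReal_mul (by positivity),
          ← ENNReal.ofReal_div_of_pos hB0, ← ENNReal.ofReal_add (by positivity) (by positivity)]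
    _ ≤ _ := by
        refine ENNReal.ofReal_le_ofReal ?_
        have h1 : H / B = C * (m : ℝ) ^ (-(μ / 2)) := by
          rw [hBe, hC, Real.rpow_neg hmR.le]
          field_simp
        have h2 : δ ^ 2 * m * ((2 * E * C + 1) * (m : ℝ) ^ (-(μ / 2)) * (K / m)) =
            δ ^ 2 * K * (2 * E * C + 1) * (m : ℝ) ^ (-(μ / 2)) := by
          field_simp
        have h3 : (m : ℝ) ^ (-(μ / 2)) ≤ E * (n : ℝ) ^ (-(μ / 2)) := by
          have hn0 : (0 : ℝ) < n := by exact_mod_cast hn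
          calc (m : ℝ) ^ (-(μ / 2)) ≤ ((n : ℝ) / 3) ^ (-(μ / 2)) :=
                Real.rpow_le_rpow_of_nonpos (by positivity) hnm (by linarith)
            _ = E * (n : ℝ) ^ (-(μ / 2)) := by
                rw [Real.div_rpow hn0.le (by norm_num), hE, Real.rpow_neg (by norm_num : (0:ℝ) ≤ 3)]
                field_simp
        rw [h1, h2, ← add_mul]
        calc _ ≤ (δ ^ 2 * K * (2 * E * C + 1) + C) * (E * (n : ℝ) ^ (-(μ / 2))) := by gcongr
          _ = ((δ ^ 2 * K * E) * (2 * E * C + 1) + E * C) * (n : ℝ) ^ (-(μ / 2)) := by ring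
          _ = (1 / 2 * (2 * E * C + 1) + E * C) * (n : ℝ) ^ (-(μ / 2)) := by rw [hδ2]
          _ ≤ _ := mul_le_mul_of_nonneg_right (by linarith) (by positivity)

/-- Upper bound for the return probabilities. -/
theorem summable_quadrantWalk_mul_rpow (hwt : ∑ i, wt i ≤ 1) {K : ℝ} (hK0 : 0 < K)
    (hK : ∀ n : ℕ, 0 < n → ∀ z w, (quadrantWalk wt st n z w : ℝ) ≤ K / n)
    {τ : Equiv.Perm ι} (hst : ∀ i, st (τ i) = -(st i).swap) (hwτ : ∀ i, wt (τ i) = wt i)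
    {h : ℤ × ℤ → ℝ≥0∞} (hh : ∀ z, 0 ≤ z → ∑ i, wt i * h (z + st i) ≤ h z)
    {μ c₀ : ℝ} (hμ : 0 < μ) (hc₀ : 0 < c₀)
    (hlow : ∀ z : ℤ × ℤ, 0 ≤ z → ENNReal.ofReal (c₀ * ((1 + z.1 + z.2 : ℤ) : ℝ) ^ μ) ≤ h z)
    (hz : h 0 ≠ ⊤) {s : ℝ} (hs : s < μ) :
    Summable fun n : ℕ => (quadrantWalk wt st n 0 0 : ℝ) * (n : ℝ) ^ s := by
  obtain ⟨M, hM0, hM⟩ := tsum_quadrantWalk_le_rpow hwt hK0 hK hh hμ hc₀ hlow 0 hz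
  have hbound : ∀ n : ℕ, 3 ≤ n → (quadrantWalk wt st n 0 0 : ℝ) ≤
      K * M ^ 2 * ((n : ℝ) / 5) ^ (-1 - μ) := by
    intro n hn
    set m := n / 3 with hm
    have hm0 : 0 < m := by omega
    have hmR : (0 : ℝ) < m := by exact_mod_cast hm0
    have hnm : (n : ℝ) / 5 ≤ m := by
      have : n ≤ 5 * m := by omega
      have : (n : ℝ) ≤ 5 * m := by exact_mod_cast this
      linarith
    have hn0 : (0 : ℝ) < n := by exact_mod_cast (by omega : 0 < n)
    obtain ⟨b, hb⟩ : ∃ b, n = m + (b + m) := ⟨n - 2 * m, by omega⟩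
    have hbm : m ≤ b := by omega
    have hb0 : 0 < b := by omega
    have h1 : ∀ v, (quadrantWalk wt st (b + m) v 0 : ℝ≥0∞) ≤
        ENNReal.ofReal (K / m) * ENNReal.ofReal (M * (m : ℝ) ^ (-(μ / 2))) := by
      intro v
      rw [quadrantWalk_add]
      calc _ ≤ ∑' w, ENNReal.ofReal (K / m) * (quadrantWalk wt st m w 0 : ℝ≥0∞) := by
            refine ENNReal.tsum_le_tsum fun w => ?_
            gcongr
            rw [← ENNReal.ofReal_coe_nnreal]
            refine ENNReal.ofReal_le_ofReal ((hK b hb0 v w).trans ?_)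
            gcongr
        _ = ENNReal.ofReal (K / m) * ∑' w, (quadrantWalk wt st m 0 w : ℝ≥0∞) := by
            rw [ENNReal.tsum_mul_left, ← (Equiv.prodComm ℤ ℤ).tsum_eq]
            congr 1
            refine tsum_congr fun w => ?_
            have := quadrantWalk_swap hst hwτ m 0 w
            rw [← this]
            rfl
        _ ≤ _ := by gcongr; exact hM m hm0
    have h2 : (quadrantWalk wt st n 0 0 : ℝ≥0∞) ≤
        ENNReal.ofReal (M * (m : ℝ) ^ (-(μ / 2))) *
        (ENNReal.ofReal (K / m) * ENNReal.ofReal (M * (m : ℝ) ^ (-(μ / 2)))) := by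
      rw [hb, quadrantWalk_add]
      calc _ ≤ ∑' v, (quadrantWalk wt st m 0 v : ℝ≥0∞) *
            (ENNReal.ofReal (K / m) * ENNReal.ofReal (M * (m : ℝ) ^ (-(μ / 2)))) :=
            ENNReal.tsum_le_tsum fun v => by gcongr; exact h1 v
        _ ≤ _ := by
            rw [ENNReal.tsum_mul_right]
            gcongr
            exact hM m hm0
    rw [← ENNReal.ofReal_mul (by positivity), ← ENNReal.ofReal_mul (by positivity),
      ← ENNReal.ofReal_coe_nnreal, ENNReal.ofReal_le_ofReal_iff (by positivity)] at h2
    refine h2.trans ?_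
    have h3 : M * (m : ℝ) ^ (-(μ / 2)) * (K / m * (M * (m : ℝ) ^ (-(μ / 2)))) =
        K * M ^ 2 * (m : ℝ) ^ (-1 - μ) := by
      have : (m : ℝ) ^ (-1 - μ) = (m : ℝ) ^ (-(μ / 2)) * (m : ℝ) ^ (-(μ / 2)) / m := by
        rw [← Real.rpow_add hmR, ← Real.rpow_sub_one hmR.ne']
        ring_nf
      rw [this]
      ring
    rw [h3]
    exact mul_le_mul_of_nonneg_left
      (Real.rpow_le_rpow_of_nonpos (by positivity) hnm (by linarith)) (by positivity)
  have hsum : Summable fun n : ℕ => K * M ^ 2 * (5 : ℝ) ^ (1 + μ) * (n : ℝ) ^ (s - μ - 1) :=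
    (Real.summable_nat_rpow.2 (by linarith)).mul_left _
  refine Summable.of_norm_bounded_eventually_nat hsum ?_
  filter_upwards [Filter.eventually_ge_atTop 3] with n hn
  have hn0 : (0 : ℝ) < n := by exact_mod_cast (by omega : 0 < n)
  rw [Real.norm_of_nonneg (by positivity)]
  calc _ ≤ K * M ^ 2 * ((n : ℝ) / 5) ^ (-1 - μ) * (n : ℝ) ^ s := by
        gcongr
        exact hbound n hn
    _ = _ := by
        rw [Real.div_rpow hn0.le (by norm_num), show s - μ - 1 = (-1 - μ) + s by ring,
          Real.rpow_add hn0, show (-1 - μ) = -(1 + μ) by ring, Real.rpow_neg (by norm_num : (0:ℝ) ≤ 5)]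
        field_simp

end WalkDecay

open MeasureTheory

section WalkFourier

variable {ι : Type*} [Fintype ι] (wt : ι → ℝ≥0) (st : ι → ℤ × ℤ)

/-- The character of `ℤ × ℤ` given by a pair of angles. -/
noncomputable def latticeChar (v : ℤ × ℤ) (x : ℝ × ℝ) : ℂ :=
  Complex.exp ((v.1 * x.1 + v.2 * x.2 : ℝ) * Complex.I)

theorem latticeChar_add (v w : ℤ × ℤ) (x : ℝ × ℝ) :
    latticeChar (v + w) x = latticeChar v x * latticeChar w x := by
  rw [latticeChar, latticeChar, latticeChar, ← Complex.exp_add]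
  congr 1
  push_cast [Prod.fst_add, Prod.snd_add]
  ring

theorem continuous_latticeChar (v : ℤ × ℤ) : Continuous (latticeChar v) := by
  unfold latticeChar
  fun_prop

theorem norm_latticeChar (v : ℤ × ℤ) (x : ℝ × ℝ) : ‖latticeChar v x‖ = 1 :=
  Complex.norm_exp_ofReal_mul_I _

/-- The characteristic function of one step. -/
noncomputable def stepChar (x : ℝ × ℝ) : ℂ := ∑ i, (wt i : ℂ) * latticeChar (st i) x

theorem continuous_stepChar : Continuous (stepChar wt st) := by
  unfold stepChar
  exact continuous_finsetSum _ fun i _ => continuous_const.mul (continuous_latticeChar _)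

theorem integrableOn_square {f : ℝ × ℝ → ℂ} (hf : Continuous f) :
    IntegrableOn f (Set.Icc (-Real.pi) Real.pi ×ˢ Set.Icc (-Real.pi) Real.pi) :=
  hf.continuousOn.integrableOn_compact (isCompact_Icc.prod isCompact_Icc)

theorem integral_int_mul (k : ℤ) :
    ∫ x in Set.Icc (-Real.pi) Real.pi, Complex.exp ((k * x : ℝ) * Complex.I) =
      if k = 0 then 2 * (Real.pi : ℂ) else 0 := by
  rw [integral_Icc_eq_integral_Ioc,
    ← intervalIntegral.integral_of_le (by linarith [Real.pi_pos])]
  split_ifs with hk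
  · subst hk
    simp
    ring
  · have hk' : (k * Complex.I : ℂ) ≠ 0 := by simp [hk]
    have h1 : (fun x : ℝ => Complex.exp ((k * x : ℝ) * Complex.I)) =
        fun x : ℝ => Complex.exp ((k * Complex.I) * x) := by
      funext x
      congr 1
      push_cast
      ring
    rw [h1, integral_exp_mul_complex hk', div_eq_zero_iff]
    left
    rw [sub_eq_zero, Complex.exp_eq_exp_iff_exists_int]
    refine ⟨k, ?_⟩
    push_cast
    ring

theorem integral_latticeChar (v : ℤ × ℤ) :
    ∫ x in Set.Icc (-Real.pi) Real.pi ×ˢ Set.Icc (-Real.pi) Real.pi, latticeChar v x =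
      if v = 0 then 4 * (Real.pi : ℂ) ^ 2 else 0 := by
  have h1 : ∀ x : ℝ × ℝ, latticeChar v x = Complex.exp ((v.1 * x.1 : ℝ) * Complex.I) *
      Complex.exp ((v.2 * x.2 : ℝ) * Complex.I) := by
    intro x
    rw [latticeChar, ← Complex.exp_add]
    congr 1
    push_cast
    ring
  simp only [h1]
  rw [Measure.volume_eq_prod, setIntegral_prod_mul (fun x : ℝ => Complex.exp ((v.1 * x : ℝ) * Complex.I))
    (fun x : ℝ => Complex.exp ((v.2 * x : ℝ) * Complex.I)), integral_int_mul, integral_int_mul]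
  by_cases h1 : v.1 = 0 <;> by_cases h2 : v.2 = 0
  · rw [if_pos h1, if_pos h2, if_pos (Prod.ext h1 h2)]
    ring
  all_goals
    have : v ≠ 0 := fun h => by simp [h] at h1 h2
    simp [h1, h2, this]

theorem integral_stepChar_succ (n : ℕ) (v : ℤ × ℤ) :
    ∫ x in Set.Icc (-Real.pi) Real.pi ×ˢ Set.Icc (-Real.pi) Real.pi,
        stepChar wt st x ^ (n + 1) * latticeChar v x =
      ∑ i, (wt i : ℂ) * ∫ x in Set.Icc (-Real.pi) Real.pi ×ˢ Set.Icc (-Real.pi) Real.pi,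
        stepChar wt st x ^ n * latticeChar (v + st i) x := by
  simp only [← integral_const_mul]
  rw [← integral_finsetSum]
  · congr 1
    funext x
    simp only [latticeChar_add]
    rw [pow_succ, mul_assoc]
    nth_rw 2 [stepChar]
    rw [Finset.sum_mul, Finset.mul_sum]
    exact Finset.sum_congr rfl fun i _ => by ring
  · intro i _
    exact integrableOn_square (continuous_const.mul
      (((continuous_stepChar wt st).pow n).mul (continuous_latticeChar _)))

theorem quadrantWalk_le_integral (n : ℕ) (z w : ℤ × ℤ) :
    4 * Real.pi ^ 2 * (quadrantWalk wt st n z w : ℝ) ≤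
      (∫ x in Set.Icc (-Real.pi) Real.pi ×ˢ Set.Icc (-Real.pi) Real.pi,
        stepChar wt st x ^ n * latticeChar (z - w) x).re := by
  suffices H : ∀ v : ℤ × ℤ, 0 ≤ (∫ x in Set.Icc (-Real.pi) Real.pi ×ˢ Set.Icc (-Real.pi) Real.pi,
      stepChar wt st x ^ n * latticeChar v x).re ∧ ∀ z w, z - w = v →
      4 * Real.pi ^ 2 * (quadrantWalk wt st n z w : ℝ) ≤
      (∫ x in Set.Icc (-Real.pi) Real.pi ×ˢ Set.Icc (-Real.pi) Real.pi,
        stepChar wt st x ^ n * latticeChar v x).re from (H _).2 z w rfl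
  induction n with
  | zero =>
    intro v
    simp only [pow_zero, one_mul, integral_latticeChar]
    have h4 : (4 * (Real.pi : ℂ) ^ 2).re = 4 * Real.pi ^ 2 := by
      norm_cast
    refine ⟨by split_ifs <;> simp [h4]; positivity, ?_⟩
    rintro z w rfl
    by_cases hzw : z = w
    · subst hzw
      by_cases hz : 0 ≤ z <;> simp [quadrantWalk, hz, h4]
      positivity
    · have : ¬ (z - w = 0) := fun h => hzw (sub_eq_zero.1 h)
      simp [quadrantWalk, hzw, this]
  | succ n ih =>
    intro v
    rw [integral_stepChar_succ, Complex.re_sum]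
    have hre : ∀ i, ((wt i : ℂ) * ∫ x in Set.Icc (-Real.pi) Real.pi ×ˢ Set.Icc (-Real.pi) Real.pi,
        stepChar wt st x ^ n * latticeChar (v + st i) x).re =
        wt i * (∫ x in Set.Icc (-Real.pi) Real.pi ×ˢ Set.Icc (-Real.pi) Real.pi,
        stepChar wt st x ^ n * latticeChar (v + st i) x).re := fun i => by
      rw [show ((wt i : ℂ)) = (((wt i : ℝ)) : ℂ) from rfl, Complex.re_ofReal_mul]
    simp only [hre]
    have h0 : 0 ≤ ∑ i, (wt i : ℝ) * (∫ x in Set.Icc (-Real.pi) Real.pi ×ˢ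
        Set.Icc (-Real.pi) Real.pi, stepChar wt st x ^ n * latticeChar (v + st i) x).re :=
      Finset.sum_nonneg fun i _ => mul_nonneg (wt i).2 (ih _).1
    refine ⟨h0, ?_⟩
    rintro z w rfl
    by_cases hz : 0 ≤ z
    · rw [quadrantWalk_succ wt st hz]
      push_cast
      rw [Finset.mul_sum]
      refine Finset.sum_le_sum fun i _ => ?_
      have := (ih (z - w + st i)).2 (z + st i) w (by abel)
      calc _ = (wt i : ℝ) * (4 * Real.pi ^ 2 * (quadrantWalk wt st n (z + st i) w : ℝ)) := by ring
        _ ≤ _ := mul_le_mul_of_nonneg_left this (wt i).2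
    · rw [quadrantWalk_eq_zero_left wt st _ hz]
      simpa using h0

/-- Local bound from a Gaussian bound on the characteristic function. -/
theorem quadrantWalk_le_div {δ : ℝ} (hδ : 0 < δ)
    (h : ∀ x ∈ Set.Icc (-Real.pi) Real.pi ×ˢ Set.Icc (-Real.pi) Real.pi,
      ‖stepChar wt st x‖ ≤ Real.exp (-δ * (x.1 ^ 2 + x.2 ^ 2)))
    (n : ℕ) (hn : 0 < n) (z w : ℤ × ℤ) :
    (quadrantWalk wt st n z w : ℝ) ≤ 1 / (4 * Real.pi * δ) / n := by
  have hn' : (0 : ℝ) < n := by exact_mod_cast hn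
  have hb : 0 < δ * n := by positivity
  have h_int : Integrable fun x : ℝ × ℝ =>
      Real.exp (-(δ * n) * x.1 ^ 2) * Real.exp (-(δ * n) * x.2 ^ 2) :=
    (integrable_exp_neg_mul_sq hb).mul_prod (integrable_exp_neg_mul_sq hb)
  have h1 : (∫ x in Set.Icc (-Real.pi) Real.pi ×ˢ Set.Icc (-Real.pi) Real.pi,
        stepChar wt st x ^ n * latticeChar (z - w) x).re ≤ Real.pi / (δ * n) := by
    refine (Complex.re_le_norm _).trans ((norm_integral_le_integral_norm _).trans ?_)
    calc _ ≤ ∫ x in Set.Icc (-Real.pi) Real.pi ×ˢ Set.Icc (-Real.pi) Real.pi,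
          Real.exp (-(δ * n) * x.1 ^ 2) * Real.exp (-(δ * n) * x.2 ^ 2) := by
          refine setIntegral_mono_on (integrableOn_square (((continuous_stepChar wt st).pow n).mul
            (continuous_latticeChar _))).norm h_int.integrableOn
            (measurableSet_Icc.prod measurableSet_Icc) fun x hx => ?_
          rw [norm_mul, norm_latticeChar, mul_one, norm_pow]
          refine (pow_le_pow_left₀ (norm_nonneg _) (h x hx) n).trans (le_of_eq ?_)
          rw [← Real.exp_nat_mul, ← Real.exp_add]
          congr 1
          ring
      _ ≤ ∫ x : ℝ × ℝ, Real.exp (-(δ * n) * x.1 ^ 2) * Real.exp (-(δ * n) * x.2 ^ 2) :=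
          setIntegral_le_integral h_int (Filter.Eventually.of_forall fun x => by positivity)
      _ = Real.pi / (δ * n) := by
          rw [Measure.volume_eq_prod, integral_prod_mul (fun x : ℝ => Real.exp (-(δ * n) * x ^ 2))
            (fun x : ℝ => Real.exp (-(δ * n) * x ^ 2)), integral_gaussian,
            Real.mul_self_sqrt (by positivity)]
  have h2 := (quadrantWalk_le_integral wt st n z w).trans h1
  have hpi := Real.pi_pos
  rw [div_div, le_div_iff₀ (by positivity)]
  rw [le_div_iff₀ (by positivity)] at h2
  have h3 : Real.pi * (quadrantWalk wt st n z w * (4 * Real.pi * δ * n)) ≤ Real.pi * 1 := by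
    linarith
  exact le_of_mul_le_mul_left h3 hpi

end WalkFourier

section BaxterWalk

/-- Normalising constant of the step weights. -/
noncomputable def baxterTotal (c : ℝ≥0) : ℝ≥0 := 2 + 4 * c + 3 * c ^ 2

/-- Step weights. -/
noncomputable def baxterWt (c : ℝ≥0) : Fin 6 → ℝ≥0 :=
  fun i => ![2, c + c ^ 2, c, c + c ^ 2, c, c ^ 2] i / baxterTotal c

/-- Steps: stay, west, east, north, south, south-east. -/
def baxterStep : Fin 6 → ℤ × ℤ := ![(0, 0), (-1, 0), (1, 0), (0, 1), (0, -1), (1, -1)]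

/-- Exchanges west with north and east with south. -/
def baxterSwap : Equiv.Perm (Fin 6) := Equiv.swap 1 3 * Equiv.swap 2 4

theorem baxterStep_swap (i : Fin 6) : baxterStep (baxterSwap i) = -(baxterStep i).swap := by
  revert i
  decide

theorem baxterWt_swap (c : ℝ≥0) (i : Fin 6) : baxterWt c (baxterSwap i) = baxterWt c i := by
  have h : ∀ i, baxterSwap i = ![0, 3, 4, 1, 2, 5] i := by decide
  rw [h]
  fin_cases i <;> rfl

theorem baxterTotal_pos (c : ℝ≥0) : 0 < baxterTotal c := by
  unfold baxterTotal
  positivity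

theorem sum_baxterWt (c : ℝ≥0) : ∑ i, baxterWt c i = 1 := by
  unfold baxterWt
  rw [← Finset.sum_div, div_eq_one_iff_eq (baxterTotal_pos c).ne', Fin.sum_univ_six, baxterTotal]
  simp
  ring

theorem sum_baxterWt_mul_complex (c : ℝ≥0) (f : ℤ × ℤ → ℂ) :
    ∑ i, (baxterWt c i : ℂ) * f (baxterStep i) =
      (2 * f (0, 0) + (c + c ^ 2) * f (-1, 0) + c * f (1, 0) + (c + c ^ 2) * f (0, 1) +
        c * f (0, -1) + c ^ 2 * f (1, -1)) / baxterTotal c := by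
  simp only [baxterWt, baxterStep, Fin.sum_univ_six]
  simp
  ring

theorem sum_baxterWt_mul_real (c : ℝ≥0) (f : ℤ × ℤ → ℝ) :
    ∑ i, (baxterWt c i : ℝ) * f (baxterStep i) =
      (2 * f (0, 0) + (c + c ^ 2) * f (-1, 0) + c * f (1, 0) + (c + c ^ 2) * f (0, 1) +
        c * f (0, -1) + c ^ 2 * f (1, -1)) / baxterTotal c := by
  simp only [baxterWt, baxterStep, Fin.sum_univ_six]
  simp
  ring

theorem norm_one_add_mul_exp_le {p : ℝ} (hp : 0 < p) {x : ℝ} (hx : |x| ≤ Real.pi) :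
    ‖1 + p * Complex.exp (x * Complex.I)‖ ≤
      1 + p - p / (1 + p) * (2 / Real.pi ^ 2 * x ^ 2) := by
  have hcos := Real.cos_le_one_sub_mul_cos_sq hx
  have h1 : ‖1 + p * Complex.exp (x * Complex.I)‖ ^ 2 = (1 + p) ^ 2 - 2 * p * (1 - Real.cos x) := by
    rw [← Complex.normSq_eq_norm_sq, Complex.normSq_apply, Complex.exp_mul_I]
    simp [Complex.cos_ofReal_re, Complex.sin_ofReal_re]
    nlinarith [Real.sin_sq_add_cos_sq x]
  have h2 : ‖1 + p * Complex.exp (x * Complex.I)‖ ≤ 1 + p - p / (1 + p) * (1 - Real.cos x) := by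
    have hc2 : 1 - Real.cos x ≤ 2 := by linarith [Real.neg_one_le_cos x]
    have hpos : 0 ≤ 1 + p - p / (1 + p) * (1 - Real.cos x) := by
      have : p / (1 + p) * (1 - Real.cos x) ≤ p / (1 + p) * 2 := by gcongr
      have h3 : p / (1 + p) * 2 ≤ 1 + p := by
        rw [div_mul_eq_mul_div, div_le_iff₀ (by positivity)]
        nlinarith [sq_nonneg (p - 1)]
      linarith
    refine abs_le_of_sq_le_sq' ?_ hpos |>.2
    rw [h1]
    have h4 : (1 + p - p / (1 + p) * (1 - Real.cos x)) ^ 2 =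
        (1 + p) ^ 2 - 2 * p * (1 - Real.cos x) + (p / (1 + p) * (1 - Real.cos x)) ^ 2 := by
      field_simp
      ring
    rw [h4]
    nlinarith [sq_nonneg (p / (1 + p) * (1 - Real.cos x))]
  have h5 : 2 / Real.pi ^ 2 * x ^ 2 ≤ 1 - Real.cos x := by linarith
  have h6 : p / (1 + p) * (2 / Real.pi ^ 2 * x ^ 2) ≤ p / (1 + p) * (1 - Real.cos x) := by gcongr
  linarith

theorem norm_stepChar_baxter_le {c : ℝ≥0} (hc : 0 < c) :
    ∃ δ : ℝ, 0 < δ ∧ ∀ x ∈ Set.Icc (-Real.pi) Real.pi ×ˢ Set.Icc (-Real.pi) Real.pi,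
      ‖stepChar (baxterWt c) baxterStep x‖ ≤ Real.exp (-δ * (x.1 ^ 2 + x.2 ^ 2)) := by
  have hc' : (0 : ℝ) < c := hc
  set p : ℝ := c + c ^ 2 with hp
  have hp0 : 0 < p := by positivity
  set T : ℝ := ((baxterTotal c : ℝ≥0) : ℝ) with hT
  have hTe : T = 2 + 2 * p + 2 * c + c ^ 2 := by
    simp only [hT, baxterTotal, hp]
    push_cast
    ring
  have hT0 : 0 < T := baxterTotal_pos c
  set δ : ℝ := p / (1 + p) * (2 / Real.pi ^ 2) / T with hδ
  refine ⟨δ, by positivity, fun x hx => ?_⟩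
  have hx1 : |x.1| ≤ Real.pi := abs_le.2 hx.1
  have hx2 : |x.2| ≤ Real.pi := abs_le.2 hx.2
  have h1 := norm_one_add_mul_exp_le hp0 (x := -x.1) (by rwa [abs_neg])
  have h2 := norm_one_add_mul_exp_le hp0 hx2
  have hsum : stepChar (baxterWt c) baxterStep x =
      ((1 + p * Complex.exp ((-x.1 : ℝ) * Complex.I)) + (1 + p * Complex.exp (x.2 * Complex.I)) +
        c * latticeChar (1, 0) x + c * latticeChar (0, -1) x + c ^ 2 * latticeChar (1, -1) x) /
        T := by
    have e1 : latticeChar (-1, 0) x = Complex.exp ((-x.1 : ℝ) * Complex.I) := by simp [latticeChar]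
    have e2 : latticeChar (0, 1) x = Complex.exp (x.2 * Complex.I) := by simp [latticeChar]
    have e3 : latticeChar (0, 0) x = 1 := by simp [latticeChar]
    rw [stepChar, sum_baxterWt_mul_complex c fun v => latticeChar v x, e1, e2, e3, hp, hT]
    push_cast
    congr 1
    ring
  have hnT : ‖(T : ℂ)‖ = T := by rw [Complex.norm_real, Real.norm_of_nonneg hT0.le]
  have hnc : ‖((c : ℝ) : ℂ)‖ = c := by rw [Complex.norm_real, Real.norm_of_nonneg hc'.le]
  have h3 : ‖stepChar (baxterWt c) baxterStep x‖ ≤ 1 - δ * (x.1 ^ 2 + x.2 ^ 2) := by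
    rw [hsum, norm_div, hnT, div_le_iff₀ hT0]
    refine (norm_add_le _ _).trans ?_
    have e4 : ‖(c : ℂ) * latticeChar (1, 0) x‖ = c := by
      rw [norm_mul, norm_latticeChar, mul_one]; exact hnc
    have e5 : ‖(c : ℂ) * latticeChar (0, -1) x‖ = c := by
      rw [norm_mul, norm_latticeChar, mul_one]; exact hnc
    have e6 : ‖(c : ℂ) ^ 2 * latticeChar (1, -1) x‖ = c ^ 2 := by
      rw [norm_mul, norm_latticeChar, mul_one, norm_pow]
      exact congrArg (· ^ 2) hnc
    have e7 := norm_add₃_le (a := (1 + p * Complex.exp ((-x.1 : ℝ) * Complex.I)) +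
      (1 + p * Complex.exp (x.2 * Complex.I))) (b := (c : ℂ) * latticeChar (1, 0) x)
      (c := (c : ℂ) * latticeChar (0, -1) x)
    have e8 := norm_add_le (1 + p * Complex.exp ((-x.1 : ℝ) * Complex.I))
      (1 + p * Complex.exp (x.2 * Complex.I))
    have e9 : (1 - δ * (x.1 ^ 2 + x.2 ^ 2)) * T =
        T - p / (1 + p) * (2 / Real.pi ^ 2 * x.1 ^ 2) - p / (1 + p) * (2 / Real.pi ^ 2 * x.2 ^ 2) := by
      rw [hδ]
      field_simp
      ring
    rw [e9, hTe]
    rw [neg_sq] at h1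
    linarith
  refine h3.trans ?_
  have := Real.add_one_le_exp (-δ * (x.1 ^ 2 + x.2 ^ 2))
  linarith

theorem baxterWalk_le_div {c : ℝ≥0} (hc : 0 < c) :
    ∃ K : ℝ, 0 < K ∧ ∀ n : ℕ, 0 < n → ∀ z w,
      (quadrantWalk (baxterWt c) baxterStep n z w : ℝ) ≤ K / n := by
  obtain ⟨δ, hδ, h⟩ := norm_stepChar_baxter_le hc
  exact ⟨1 / (4 * Real.pi * δ), by positivity, fun n hn z w =>
    quadrantWalk_le_div _ _ hδ h n hn z w⟩

/-- Exponential bound for short walks to the corner. -/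
theorem baxterWalk_le_exp (c : ℝ≥0) (s : ℝ) (n : ℕ) (z : ℤ × ℤ) :
    (quadrantWalk (baxterWt c) baxterStep n z 0 : ℝ) ≤
      Real.exp (-s * ((z.1 + z.2 : ℤ) : ℝ) + s ^ 2 / 2 * n) := by
  induction n generalizing z with
  | zero =>
    by_cases hz : z = 0
    · subst hz
      simp [quadrantWalk]
    · simp [quadrantWalk, hz, Real.exp_nonneg]
  | succ n ih =>
    by_cases hz : 0 ≤ z
    · rw [quadrantWalk_succ _ _ hz]
      push_cast
      calc _ ≤ ∑ i, (baxterWt c i : ℝ) * Real.exp (-s *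
            (((z + baxterStep i).1 + (z + baxterStep i).2 : ℤ) : ℝ) + s ^ 2 / 2 * n) :=
            Finset.sum_le_sum fun i _ => mul_le_mul_of_nonneg_left (ih _) (baxterWt c i).2
        _ = Real.exp (-s * ((z.1 + z.2 : ℤ) : ℝ) + s ^ 2 / 2 * n) *
            ∑ i, (baxterWt c i : ℝ) *
              Real.exp (-s * (((baxterStep i).1 + (baxterStep i).2 : ℤ) : ℝ)) := by
            rw [Finset.mul_sum]
            refine Finset.sum_congr rfl fun i _ => ?_
            rw [mul_left_comm, ← Real.exp_add]
            congr 2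
            push_cast [Prod.fst_add, Prod.snd_add]
            ring
        _ ≤ Real.exp (-s * ((z.1 + z.2 : ℤ) : ℝ) + s ^ 2 / 2 * n) * Real.exp (s ^ 2 / 2) := by
            gcongr
            rw [sum_baxterWt_mul_real c fun v => Real.exp (-s * ((v.1 + v.2 : ℤ) : ℝ))]
            have hch := Real.cosh_le_exp_half_sq s
            have h1 : 1 ≤ Real.exp (s ^ 2 / 2) := Real.one_le_exp (by positivity)
            have hT0 : (0 : ℝ) < baxterTotal c := baxterTotal_pos c
            rw [div_le_iff₀ hT0]
            have hT : (baxterTotal c : ℝ) = 2 + 4 * c + 3 * c ^ 2 := by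
              simp [baxterTotal]
            rw [hT]
            have hc := c.2
            rw [Real.cosh_eq] at hch
            simp
            have h3 : (2 * (c : ℝ) + c ^ 2) * (Real.exp s + Real.exp (-s)) ≤
                (2 * (c : ℝ) + c ^ 2) * (2 * Real.exp (s ^ 2 / 2)) :=
              mul_le_mul_of_nonneg_left (by linarith) (by positivity)
            have h4 : (2 + (c : ℝ) ^ 2) * 1 ≤ (2 + (c : ℝ) ^ 2) * Real.exp (s ^ 2 / 2) :=
              mul_le_mul_of_nonneg_left h1 (by positivity)
            nlinarith
        _ = _ := by
            rw [← Real.exp_add]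
            congr 1
            push_cast
            ring
    · rw [quadrantWalk_eq_zero_left _ _ _ hz]
      simp [Real.exp_nonneg]

end BaxterWalk

section CpowTaylor

theorem exists_norm_one_add_cpow_sub_le (a : ℂ) :
    ∃ b : ℂ, ∃ C r : ℝ, 0 ≤ C ∧ 0 < r ∧ r < 1 ∧ ∀ η : ℂ, ‖η‖ ≤ r →
      ‖(1 + η) ^ a - (1 + a * η + b * η ^ 2)‖ ≤ C * ‖η‖ ^ 3 := by
  have h := (Complex.one_add_cpow_hasFPowerSeriesAt_zero (a := a)).isBigO_sub_partialSum_pow 3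
  refine ⟨Ring.choose a 2, ?_⟩
  obtain ⟨C, hC0, hC⟩ := h.exists_pos
  rw [Asymptotics.isBigOWith_iff] at hC
  obtain ⟨r, hr, hball⟩ := Metric.eventually_nhds_iff.1 hC
  refine ⟨C, min (r / 2) (1 / 2), hC0.le, by positivity, ?_, fun η hη => ?_⟩
  · exact (min_le_right _ _).trans_lt (by norm_num)
  · have hη' : dist η 0 < r := by
      rw [dist_zero_right]
      exact hη.trans_lt ((min_le_left _ _).trans_lt (by linarith))
    have := hball hη'
    simp only [FormalMultilinearSeries.partialSum, Finset.sum_range_succ, Finset.sum_range_zero,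
      binomialSeries_apply, zero_add, Ring.choose_zero_right, Ring.choose_one_right] at this
    simp at this
    rw [sq]
    exact this

theorem mul_cpow_of_re_pos {x y : ℂ} (hx : 0 < x.re) (hy : 0 < y.re) (a : ℂ) :
    (x * y) ^ a = x ^ a * y ^ a := by
  have hx0 : x ≠ 0 := fun h => by simp [h] at hx
  have hy0 : y ≠ 0 := fun h => by simp [h] at hy
  have h1 := abs_lt.1 (Complex.abs_arg_lt_pi_div_two_iff.2 (Or.inl hx))
  have h2 := abs_lt.1 (Complex.abs_arg_lt_pi_div_two_iff.2 (Or.inl hy))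
  rw [Complex.cpow_def_of_ne_zero (mul_ne_zero hx0 hy0), Complex.cpow_def_of_ne_zero hx0,
    Complex.cpow_def_of_ne_zero hy0, ← Complex.exp_add, ← add_mul]
  congr 2
  exact Complex.log_mul hx0 hy0 ⟨by linarith, by linarith⟩

theorem re_one_add_pos {η : ℂ} (h : ‖η‖ < 1) : 0 < (1 + η).re := by
  have := Complex.abs_re_le_norm η
  have := neg_abs_le η.re
  simp
  linarith

theorem exists_norm_one_add_rpow_ge (ν : ℝ) :
    ∃ b : ℂ, ∃ C r : ℝ, 0 ≤ C ∧ 0 < r ∧ r < 1 ∧ ∀ η : ℂ, ‖η‖ ≤ r →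
      1 + ν * η.re + (b * η ^ 2).re + (ν / 2) ^ 2 * ‖η‖ ^ 2 - C * ‖η‖ ^ 3 ≤ ‖1 + η‖ ^ ν := by
  obtain ⟨b, C, r, hC, hr, hr1, h⟩ := exists_norm_one_add_cpow_sub_le ((ν / 2 : ℝ) : ℂ)
  refine ⟨2 * b, 2 * C + 2 * |ν / 2| * (‖b‖ + C), r, by positivity, hr, hr1, fun η hη => ?_⟩
  set X : ℂ := (1 + η) ^ ((ν / 2 : ℝ) : ℂ) with hX
  set E : ℂ := X - (1 + ((ν / 2 : ℝ) : ℂ) * η + b * η ^ 2) with hE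
  have hE3 : ‖E‖ ≤ C * ‖η‖ ^ 3 := h η hη
  have hXE : X = 1 + (((ν / 2 : ℝ) : ℂ) * η + b * η ^ 2 + E) := by rw [hE]; ring
  set Y : ℂ := ((ν / 2 : ℝ) : ℂ) * η + b * η ^ 2 + E with hY
  have hη1 : ‖η‖ ≤ 1 := hη.trans hr1.le
  have h1 : ‖1 + η‖ ^ ν = ‖X‖ ^ 2 := by
    rw [hX, Complex.norm_cpow_real, ← Real.rpow_natCast, ← Real.rpow_mul (norm_nonneg _)]
    norm_num
  have h2 : ‖X‖ ^ 2 = 1 + 2 * Y.re + ‖Y‖ ^ 2 := by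
    rw [hXE, ← Complex.normSq_eq_norm_sq, ← Complex.normSq_eq_norm_sq, Complex.normSq_apply,
      Complex.normSq_apply]
    simp
    ring
  have h3 : Y.re = ν / 2 * η.re + (b * η ^ 2).re + E.re := by
    rw [hY, Complex.add_re, Complex.add_re, Complex.re_ofReal_mul]
  have h4 : -(C * ‖η‖ ^ 3) ≤ E.re := by
    have := neg_abs_le E.re
    have := Complex.abs_re_le_norm E
    linarith
  have h5 : |ν / 2| * ‖η‖ - (‖b‖ + C) * ‖η‖ ^ 2 ≤ ‖Y‖ := by
    have e1 : ‖((ν / 2 : ℝ) : ℂ) * η‖ = |ν / 2| * ‖η‖ := by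
      rw [norm_mul, Complex.norm_real, Real.norm_eq_abs]
    have e2 : ((ν / 2 : ℝ) : ℂ) * η = Y - (b * η ^ 2 + E) := by rw [hY]; ring
    have e3 := norm_sub_le Y (b * η ^ 2 + E)
    rw [← e2, e1] at e3
    have e4 := norm_add_le (b * η ^ 2) E
    rw [norm_mul, norm_pow] at e4
    have e5 : C * ‖η‖ ^ 3 ≤ C * ‖η‖ ^ 2 :=
      mul_le_mul_of_nonneg_left (pow_le_pow_of_le_one (norm_nonneg _) hη1 (by norm_num)) hC
    linarith
  have h6 : (ν / 2) ^ 2 * ‖η‖ ^ 2 - 2 * |ν / 2| * (‖b‖ + C) * ‖η‖ ^ 3 ≤ ‖Y‖ ^ 2 := by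
    set B := |ν / 2| * ‖η‖ with hB
    set D := (‖b‖ + C) * ‖η‖ ^ 2 with hD
    have hB0 : 0 ≤ B := by positivity
    have hD0 : 0 ≤ D := by positivity
    have e1 : (ν / 2) ^ 2 * ‖η‖ ^ 2 - 2 * |ν / 2| * (‖b‖ + C) * ‖η‖ ^ 3 = B ^ 2 - 2 * B * D := by
      rw [hB, hD, mul_pow, sq_abs]
      ring
    rw [e1]
    rcases le_or_gt D B with hle | hlt
    · have : (B - D) ^ 2 ≤ ‖Y‖ ^ 2 := pow_le_pow_left₀ (by linarith) h5 2
      nlinarith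
    · nlinarith [sq_nonneg ‖Y‖]
  rw [h1, h2, h3]
  have h7 : ((2 * b) * η ^ 2).re = 2 * (b * η ^ 2).re := by
    rw [mul_assoc, show (2 : ℂ) = ((2 : ℝ) : ℂ) by norm_num, Complex.re_ofReal_mul]
  rw [h7]
  linarith

variable {ι : Type*} [Fintype ι] {w : ι → ℝ} {d : ι → ℂ}

theorem exists_norm_sum_cpow_sub_le (hw : ∀ i, 0 ≤ w i) (h0 : ∑ i, w i = 1)
    (h1 : ∑ i, (w i : ℂ) * d i = 0) (h2 : ∑ i, (w i : ℂ) * d i ^ 2 = 0) (α : ℝ) :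
    ∃ C R : ℝ, 0 ≤ C ∧ 0 < R ∧ ∀ ζ : ℂ, 0 < ζ.re → R ≤ ‖ζ‖ →
      ‖∑ i, (w i : ℂ) * (ζ + d i) ^ (α : ℂ) - ζ ^ (α : ℂ)‖ ≤ C * ‖ζ‖ ^ (α - 3) := by
  obtain ⟨b, C, r, hC, hr, hr1, h⟩ := exists_norm_one_add_cpow_sub_le (α : ℂ)
  set D : ℝ := ∑ i, ‖d i‖ with hD
  have hDi : ∀ i, ‖d i‖ ≤ D := fun i =>
    Finset.single_le_sum (f := fun i => ‖d i‖) (fun _ _ => norm_nonneg _) (Finset.mem_univ i)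
  have hD0 : 0 ≤ D := Finset.sum_nonneg fun _ _ => norm_nonneg _
  refine ⟨C * D ^ 3, (D + 1) / r, by positivity, by positivity, fun ζ hζ hR => ?_⟩
  have hζ0 : ζ ≠ 0 := fun h => by simp [h] at hζ
  have hn : 0 < ‖ζ‖ := norm_pos_iff.2 hζ0
  have hη : ∀ i, ‖d i / ζ‖ ≤ r := fun i => by
    rw [norm_div, div_le_iff₀ hn]
    rw [div_le_iff₀ hr] at hR
    linarith [hDi i]
  have e1 : ∀ i, (ζ + d i) ^ (α : ℂ) = ζ ^ (α : ℂ) * (1 + d i / ζ) ^ (α : ℂ) := fun i => by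
    rw [← mul_cpow_of_re_pos hζ (re_one_add_pos ((hη i).trans_lt hr1))]
    congr 1
    field_simp
  have hw' : ∑ i, (w i : ℂ) = 1 := by exact_mod_cast congrArg (fun x : ℝ => (x : ℂ)) h0
  have e2 : ∑ i, (w i : ℂ) * (1 + α * (d i / ζ) + b * (d i / ζ) ^ 2) = 1 := by
    have : ∀ i, (w i : ℂ) * (1 + α * (d i / ζ) + b * (d i / ζ) ^ 2) =
        w i + α / ζ * (w i * d i) + b / ζ ^ 2 * (w i * d i ^ 2) := fun i => by
      field_simp
    simp only [this, Finset.sum_add_distrib, ← Finset.mul_sum, h1, h2, hw']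
    ring
  have e3 : ∑ i, (w i : ℂ) * (ζ + d i) ^ (α : ℂ) - ζ ^ (α : ℂ) =
      ζ ^ (α : ℂ) * ∑ i, (w i : ℂ) * ((1 + d i / ζ) ^ (α : ℂ) -
        (1 + α * (d i / ζ) + b * (d i / ζ) ^ 2)) := by
    simp only [mul_sub, Finset.sum_sub_distrib]
    simp only [← mul_sub]
    rw [e2, mul_sub, mul_one, Finset.mul_sum]
    congr 1
    exact Finset.sum_congr rfl fun i _ => by rw [e1]; ring
  rw [e3, norm_mul, Complex.norm_cpow_real]
  calc _ ≤ ‖ζ‖ ^ α * ∑ i, w i * (C * (D / ‖ζ‖) ^ 3) := by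
        gcongr
        refine (norm_sum_le _ _).trans (Finset.sum_le_sum fun i _ => ?_)
        rw [norm_mul, Complex.norm_real, Real.norm_of_nonneg (hw i)]
        refine mul_le_mul_of_nonneg_left ((h _ (hη i)).trans ?_) (hw i)
        rw [norm_div]
        gcongr
        exact hDi i
    _ = _ := by
        rw [← Finset.sum_mul, h0, one_mul, Real.rpow_sub hn,
          show (3 : ℝ) = ((3 : ℕ) : ℝ) by norm_num, Real.rpow_natCast]
        ring

theorem exists_le_sum_norm_rpow (hw : ∀ i, 0 ≤ w i) (h0 : ∑ i, w i = 1)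
    (h1 : ∑ i, (w i : ℂ) * d i = 0) (h2 : ∑ i, (w i : ℂ) * d i ^ 2 = 0)
    (hV : 0 < ∑ i, w i * ‖d i‖ ^ 2) {ν : ℝ} (hν : ν ≠ 0) :
    ∃ q R : ℝ, 0 < q ∧ 0 < R ∧ ∀ ζ : ℂ, R ≤ ‖ζ‖ →
      ‖ζ‖ ^ ν + q * ‖ζ‖ ^ (ν - 2) ≤ ∑ i, w i * ‖ζ + d i‖ ^ ν := by
  obtain ⟨b, C, r, hC, hr, hr1, h⟩ := exists_norm_one_add_rpow_ge ν
  set D : ℝ := ∑ i, ‖d i‖ with hD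
  have hDi : ∀ i, ‖d i‖ ≤ D := fun i =>
    Finset.single_le_sum (f := fun i => ‖d i‖) (fun _ _ => norm_nonneg _) (Finset.mem_univ i)
  have hD0 : 0 ≤ D := Finset.sum_nonneg fun _ _ => norm_nonneg _
  set V := ∑ i, w i * ‖d i‖ ^ 2 with hVd
  set q := (ν / 2) ^ 2 * V / 2 with hq
  have hq0 : 0 < q := by positivity
  refine ⟨q, (D + 1) / r + C * D ^ 3 / q, hq0, by positivity, fun ζ hR => ?_⟩
  have hR1 : (D + 1) / r ≤ ‖ζ‖ := (le_add_of_nonneg_right (by positivity)).trans hR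
  have hR2 : C * D ^ 3 / q ≤ ‖ζ‖ := (le_add_of_nonneg_left (by positivity)).trans hR
  have hn : 0 < ‖ζ‖ := lt_of_lt_of_le (by positivity) hR1
  have hζ0 : ζ ≠ 0 := norm_pos_iff.1 hn
  have hη : ∀ i, ‖d i / ζ‖ ≤ r := fun i => by
    rw [norm_div, div_le_iff₀ hn]
    rw [div_le_iff₀ hr] at hR1
    linarith [hDi i]
  have e1 : ∀ i, ‖ζ + d i‖ ^ ν = ‖ζ‖ ^ ν * ‖1 + d i / ζ‖ ^ ν := fun i => by
    rw [← Real.mul_rpow (norm_nonneg _) (norm_nonneg _), ← norm_mul]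
    congr 2
    field_simp
  have e2 : ∑ i, w i * (d i / ζ).re = 0 := by
    have : ∑ i, (w i : ℂ) * (d i / ζ) = 0 := by
      simp only [mul_div_assoc', ← Finset.sum_div, h1, zero_div]
    have := congrArg Complex.re this
    simpa [Complex.re_sum] using this
  have e3 : ∑ i, w i * (b * (d i / ζ) ^ 2).re = 0 := by
    have : ∑ i, (w i : ℂ) * (b * (d i / ζ) ^ 2) = 0 := by
      have h3 : ∀ i, (w i : ℂ) * (b * (d i / ζ) ^ 2) = b / ζ ^ 2 * (w i * d i ^ 2) := fun i => by
        field_simp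
      simp only [h3, ← Finset.mul_sum, h2, mul_zero]
    have := congrArg Complex.re this
    rw [Complex.re_sum] at this
    simp only [Complex.re_ofReal_mul] at this
    simpa using this
  have e4 : ∑ i, w i * ‖d i / ζ‖ ^ 2 = V / ‖ζ‖ ^ 2 := by
    rw [hVd, Finset.sum_div]
    exact Finset.sum_congr rfl fun i _ => by rw [norm_div]; ring
  have e5 : ∑ i, w i * ‖d i / ζ‖ ^ 3 ≤ D ^ 3 / ‖ζ‖ ^ 3 := by
    calc _ ≤ ∑ i, w i * (D ^ 3 / ‖ζ‖ ^ 3) := by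
          refine Finset.sum_le_sum fun i _ => mul_le_mul_of_nonneg_left ?_ (hw i)
          rw [norm_div, div_pow]
          gcongr
          exact hDi i
      _ = _ := by rw [← Finset.sum_mul, h0, one_mul]
  have e6 : 1 + (ν / 2) ^ 2 * (V / ‖ζ‖ ^ 2) - C * (D ^ 3 / ‖ζ‖ ^ 3) ≤
      ∑ i, w i * ‖1 + d i / ζ‖ ^ ν := by
    calc _ ≤ ∑ i, w i * (1 + ν * (d i / ζ).re + (b * (d i / ζ) ^ 2).re +
          (ν / 2) ^ 2 * ‖d i / ζ‖ ^ 2 - C * ‖d i / ζ‖ ^ 3) := by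
          have : ∀ i, w i * (1 + ν * (d i / ζ).re + (b * (d i / ζ) ^ 2).re +
              (ν / 2) ^ 2 * ‖d i / ζ‖ ^ 2 - C * ‖d i / ζ‖ ^ 3) =
              w i + ν * (w i * (d i / ζ).re) + w i * (b * (d i / ζ) ^ 2).re +
              (ν / 2) ^ 2 * (w i * ‖d i / ζ‖ ^ 2) - C * (w i * ‖d i / ζ‖ ^ 3) := fun i => by ring
          simp only [this, Finset.sum_sub_distrib, Finset.sum_add_distrib, ← Finset.mul_sum, e2, e3,
            e4, h0]
          have := mul_le_mul_of_nonneg_left e5 hC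
          linarith
      _ ≤ _ := Finset.sum_le_sum fun i _ => mul_le_mul_of_nonneg_left (h _ (hη i)) (hw i)
  have e7 : 1 + q / ‖ζ‖ ^ 2 ≤ 1 + (ν / 2) ^ 2 * (V / ‖ζ‖ ^ 2) - C * (D ^ 3 / ‖ζ‖ ^ 3) := by
    have h3 : C * (D ^ 3 / ‖ζ‖ ^ 3) ≤ q / ‖ζ‖ ^ 2 := by
      rw [← mul_div_assoc, div_le_div_iff₀ (by positivity) (by positivity)]
      rw [div_le_iff₀ hq0] at hR2
      have := mul_le_mul_of_nonneg_right hR2 (by positivity : 0 ≤ ‖ζ‖ ^ 2)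
      linarith
    have h4 : (ν / 2) ^ 2 * (V / ‖ζ‖ ^ 2) = 2 * (q / ‖ζ‖ ^ 2) := by rw [hq]; ring
    linarith
  have e8 : ‖ζ‖ ^ (ν - 2) = ‖ζ‖ ^ ν / ‖ζ‖ ^ 2 := by
    rw [Real.rpow_sub hn, show (2 : ℝ) = ((2 : ℕ) : ℝ) by norm_num, Real.rpow_natCast]
  calc _ = ‖ζ‖ ^ ν * (1 + q / ‖ζ‖ ^ 2) := by rw [e8]; ring
    _ ≤ ‖ζ‖ ^ ν * ∑ i, w i * ‖1 + d i / ζ‖ ^ ν := by gcongr; exact e7.trans e6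
    _ = _ := by
        rw [Finset.mul_sum]
        exact Finset.sum_congr rfl fun i _ => by rw [e1]; ring

end CpowTaylor

section Sector

/-- The linear map taking the quadrant to the sector `|arg| ≤ θ / 2`. -/
noncomputable def sectorPoint (θ x y : ℝ) : ℂ :=
  ⟨(x + y) * Real.cos (θ / 2), (y - x) * Real.sin (θ / 2)⟩

/-- The restriction of `sectorPoint` to the lattice. -/
noncomputable def latticeSector (θ : ℝ) (v : ℤ × ℤ) : ℂ := sectorPoint θ v.1 v.2

theorem sectorPoint_add (θ x y x' y' : ℝ) :
    sectorPoint θ (x + x') (y + y') = sectorPoint θ x y + sectorPoint θ x' y' := by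
  apply Complex.ext <;> simp [sectorPoint] <;> ring

theorem sectorPoint_mul (θ t x y : ℝ) :
    sectorPoint θ (t * x) (t * y) = t * sectorPoint θ x y := by
  apply Complex.ext <;> simp [sectorPoint] <;> ring

theorem latticeSector_add (θ : ℝ) (v w : ℤ × ℤ) :
    latticeSector θ (v + w) = latticeSector θ v + latticeSector θ w := by
  simp [latticeSector, ← sectorPoint_add]

variable {θ : ℝ}

theorem sectorPoint_re (θ x y : ℝ) : (sectorPoint θ x y).re = (x + y) * Real.cos (θ / 2) := rfl

theorem cos_half_pos (hθ0 : 0 < θ) (hθ1 : θ < Real.pi / 2) : 0 < Real.cos (θ / 2) :=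
  Real.cos_pos_of_mem_Ioo ⟨by linarith [Real.pi_pos], by linarith [Real.pi_pos]⟩

theorem le_norm_sectorPoint (θ x y : ℝ) : (x + y) * Real.cos (θ / 2) ≤ ‖sectorPoint θ x y‖ :=
  Complex.re_le_norm (sectorPoint θ x y)

theorem abs_arg_sectorPoint_le (hθ0 : 0 < θ) (hθ1 : θ < Real.pi / 2) {x y : ℝ} (hx : 0 ≤ x)
    (hy : 0 ≤ y) (hxy : 0 < x + y) : |(sectorPoint θ x y).arg| ≤ θ / 2 := by
  have hc := cos_half_pos hθ0 hθ1
  have hs : 0 < Real.sin (θ / 2) :=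
    Real.sin_pos_of_pos_of_lt_pi (by linarith) (by linarith [Real.pi_pos])
  set ζ := sectorPoint θ x y with hζ
  have hre : 0 < ζ.re := mul_pos hxy hc
  have hn : 0 < ‖ζ‖ := norm_pos_iff.2 fun h => by simp [h] at hre
  have harg := abs_lt.1 (Complex.abs_arg_lt_pi_div_two_iff.2 (Or.inl hre))
  have e1 : ‖ζ‖ * Real.cos ζ.arg = (x + y) * Real.cos (θ / 2) := Complex.norm_mul_cos_arg ζ
  have e2 : ‖ζ‖ * Real.sin ζ.arg = (y - x) * Real.sin (θ / 2) := Complex.norm_mul_sin_arg ζ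
  rw [abs_le]
  constructor
  · by_contra! hcon
    have h1 : 0 < Real.sin (-ζ.arg - θ / 2) :=
      Real.sin_pos_of_pos_of_lt_pi (by linarith) (by linarith [Real.pi_pos])
    have h2 : ‖ζ‖ * Real.sin (-ζ.arg - θ / 2) = -2 * y * (Real.sin (θ / 2) * Real.cos (θ / 2)) := by
      rw [Real.sin_sub, Real.sin_neg, Real.cos_neg]
      linear_combination (-Real.sin (θ / 2)) * e1 - Real.cos (θ / 2) * e2
    have h3 := mul_pos hn h1
    have h4 := mul_nonneg hy (mul_pos hs hc).le
    linarith
  · by_contra! hcon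
    have h1 : 0 < Real.sin (ζ.arg - θ / 2) :=
      Real.sin_pos_of_pos_of_lt_pi (by linarith) (by linarith [Real.pi_pos])
    have h2 : ‖ζ‖ * Real.sin (ζ.arg - θ / 2) = -2 * x * (Real.sin (θ / 2) * Real.cos (θ / 2)) := by
      rw [Real.sin_sub]
      linear_combination (-Real.sin (θ / 2)) * e1 + Real.cos (θ / 2) * e2
    have h3 := mul_pos hn h1
    have h4 := mul_nonneg hx (mul_pos hs hc).le
    linarith

theorem re_cpow_real {ζ : ℂ} (hζ : ζ ≠ 0) (κ : ℝ) :
    (ζ ^ (κ : ℂ)).re = ‖ζ‖ ^ κ * Real.cos (κ * ζ.arg) := by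
  rw [Complex.cpow_def_of_ne_zero hζ, Complex.exp_re, Complex.re_mul_ofReal,
    Complex.im_mul_ofReal, Complex.log_re, Complex.log_im,
    Real.rpow_def_of_pos (norm_pos_iff.2 hζ), mul_comm (ζ.arg)]

variable {c : ℝ≥0}

theorem sum_baxterWt_mul_sector (c : ℝ≥0) (θ : ℝ) :
    ∑ i, ((baxterWt c i : ℝ) : ℂ) * latticeSector θ (baxterStep i) = 0 := by
  have h := sum_baxterWt_mul_complex c (latticeSector θ)
  refine h.trans (div_eq_zero_iff.2 (Or.inl ?_))
  apply Complex.ext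
  · simp [latticeSector, sectorPoint, pow_two]
  · simp [latticeSector, sectorPoint, pow_two]
    ring

theorem sum_baxterWt_mul_sector_sq (hc : (c : ℝ) ^ 3 + c ^ 2 = 1)
    (hθ : Real.cos θ = (c : ℝ) ^ 3 / 2) :
    ∑ i, ((baxterWt c i : ℝ) : ℂ) * latticeSector θ (baxterStep i) ^ 2 = 0 := by
  have h := sum_baxterWt_mul_complex c fun v => latticeSector θ v ^ 2
  refine h.trans (div_eq_zero_iff.2 (Or.inl ?_))
  have h1 : Real.cos (θ / 2) ^ 2 - Real.sin (θ / 2) ^ 2 = (c : ℝ) ^ 3 / 2 := by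
    rw [← hθ, ← Real.cos_two_mul']
    ring_nf
  have h2 := Real.sin_sq_add_cos_sq (θ / 2)
  apply Complex.ext
  · simp [latticeSector, sectorPoint, pow_two]
    set C := Real.cos (θ / 2)
    set S := Real.sin (θ / 2)
    have hS : S ^ 2 = (1 - (c : ℝ) ^ 3 / 2) / 2 := by linarith
    have hC : C ^ 2 = (1 + (c : ℝ) ^ 3 / 2) / 2 := by linarith
    linear_combination (4 * (c : ℝ) + 2 * c ^ 2) * hC - (4 * (c : ℝ) + 6 * c ^ 2) * hS +
      2 * (c : ℝ) ^ 2 * hc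
  · simp [latticeSector, sectorPoint, pow_two]
    ring

theorem sum_baxterWt_mul_sector_norm (hc : 0 < c) (hθ0 : 0 < θ) (hθ1 : θ < Real.pi / 2) :
    0 < ∑ i, (baxterWt c i : ℝ) * ‖latticeSector θ (baxterStep i)‖ ^ 2 := by
  refine Finset.sum_pos' (fun i _ => by positivity) ⟨2, Finset.mem_univ _, ?_⟩
  have h1 : 0 < baxterWt c 2 := div_pos hc (baxterTotal_pos c)
  have h2 : (0 : ℝ) < ‖latticeSector θ (baxterStep 2)‖ := by
    refine lt_of_lt_of_le ?_ (le_norm_sectorPoint _ _ _)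
    simpa [baxterStep] using cos_half_pos hθ0 hθ1
  have h3 : (0 : ℝ) < baxterWt c 2 := h1
  positivity

theorem exists_sector_superharmonic (hc0 : 0 < c) (hc : (c : ℝ) ^ 3 + c ^ 2 = 1) (hθ0 : 0 < θ)
    (hθ1 : θ < Real.pi / 2) (hθ : Real.cos θ = (c : ℝ) ^ 3 / 2) {κ : ℝ} (hκ : 1 / 2 < κ) :
    ∃ R : ℝ, 0 < R ∧ ∀ ζ : ℂ, 0 < ζ.re → R ≤ ‖ζ‖ →
      ∑ i, (baxterWt c i : ℝ) * (((ζ + latticeSector θ (baxterStep i)) ^ (κ : ℂ)).re -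
        ‖ζ + latticeSector θ (baxterStep i)‖ ^ (κ - 1 / 2)) ≤
      (ζ ^ (κ : ℂ)).re - ‖ζ‖ ^ (κ - 1 / 2) := by
  have hsum : ∑ i, (baxterWt c i : ℝ) = 1 := by exact_mod_cast sum_baxterWt c
  obtain ⟨C, R₁, hC, hR₁, h₁⟩ := exists_norm_sum_cpow_sub_le (w := fun i => (baxterWt c i : ℝ))
    (fun i => NNReal.coe_nonneg _) hsum
    (sum_baxterWt_mul_sector c θ) (sum_baxterWt_mul_sector_sq hc hθ) κ
  obtain ⟨q, R₂, hq, hR₂, h₂⟩ := exists_le_sum_norm_rpow (w := fun i => (baxterWt c i : ℝ))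
    (fun i => NNReal.coe_nonneg _) hsum
    (sum_baxterWt_mul_sector c θ) (sum_baxterWt_mul_sector_sq hc hθ)
    (sum_baxterWt_mul_sector_norm hc0 hθ0 hθ1) (ν := κ - 1 / 2) (by linarith)
  refine ⟨R₁ + R₂ + (C / q) ^ 2, by positivity, fun ζ hζ hR => ?_⟩
  have hCq : 0 ≤ (C / q) ^ 2 := by positivity
  have hn : 0 < ‖ζ‖ := norm_pos_iff.2 fun h => by simp [h] at hζ
  have e1 := h₁ ζ hζ (by linarith)
  have e2 := h₂ ζ (by linarith)
  have e3 := (Complex.re_le_norm _).trans e1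
  rw [Complex.sub_re, Complex.re_sum] at e3
  simp only [Complex.re_ofReal_mul] at e3
  have e4 : C * ‖ζ‖ ^ (κ - 3) ≤ q * ‖ζ‖ ^ (κ - 1 / 2 - 2) := by
    have : ‖ζ‖ ^ (κ - 1 / 2 - 2) = ‖ζ‖ ^ (κ - 3) * Real.sqrt ‖ζ‖ := by
      rw [Real.sqrt_eq_rpow, ← Real.rpow_add hn]
      ring_nf
    rw [this, mul_left_comm, mul_comm C]
    refine mul_le_mul_of_nonneg_left ?_ (by positivity)
    have : C / q ≤ Real.sqrt ‖ζ‖ := Real.le_sqrt_of_sq_le (by linarith)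
    rw [div_le_iff₀ hq] at this
    linarith
  simp only [mul_sub, Finset.sum_sub_distrib]
  linarith

theorem exists_sector_subharmonic (hc0 : 0 < c) (hc : (c : ℝ) ^ 3 + c ^ 2 = 1) (hθ0 : 0 < θ)
    (hθ1 : θ < Real.pi / 2) (hθ : Real.cos θ = (c : ℝ) ^ 3 / 2) {κ : ℝ} (hκ : 0 < κ) :
    ∃ R : ℝ, 0 < R ∧ ∀ ζ : ℂ, 0 < ζ.re → R ≤ ‖ζ‖ →
      (ζ ^ ((-κ : ℝ) : ℂ)).re + ‖ζ‖ ^ (-κ - 1 / 2) <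
      ∑ i, (baxterWt c i : ℝ) * (((ζ + latticeSector θ (baxterStep i)) ^ ((-κ : ℝ) : ℂ)).re +
        ‖ζ + latticeSector θ (baxterStep i)‖ ^ (-κ - 1 / 2)) := by
  have hsum : ∑ i, (baxterWt c i : ℝ) = 1 := by exact_mod_cast sum_baxterWt c
  obtain ⟨C, R₁, hC, hR₁, h₁⟩ := exists_norm_sum_cpow_sub_le (w := fun i => (baxterWt c i : ℝ))
    (fun i => NNReal.coe_nonneg _) hsum
    (sum_baxterWt_mul_sector c θ) (sum_baxterWt_mul_sector_sq hc hθ) (-κ)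
  obtain ⟨q, R₂, hq, hR₂, h₂⟩ := exists_le_sum_norm_rpow (w := fun i => (baxterWt c i : ℝ))
    (fun i => NNReal.coe_nonneg _) hsum
    (sum_baxterWt_mul_sector c θ) (sum_baxterWt_mul_sector_sq hc hθ)
    (sum_baxterWt_mul_sector_norm hc0 hθ0 hθ1) (ν := -κ - 1 / 2) (by linarith)
  refine ⟨R₁ + R₂ + ((C + 1) / q) ^ 2, by positivity, fun ζ hζ hR => ?_⟩
  have hCq : 0 ≤ ((C + 1) / q) ^ 2 := by positivity
  have hn : 0 < ‖ζ‖ := norm_pos_iff.2 fun h => by simp [h] at hζ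
  have e1 := h₁ ζ hζ (by linarith)
  have e2 := h₂ ζ (by linarith)
  have e3 := (neg_le_of_abs_le ((Complex.abs_re_le_norm _).trans e1))
  rw [Complex.sub_re, Complex.re_sum] at e3
  simp only [Complex.re_ofReal_mul] at e3
  have e4 : C * ‖ζ‖ ^ (-κ - 3) < q * ‖ζ‖ ^ (-κ - 1 / 2 - 2) := by
    have : ‖ζ‖ ^ (-κ - 1 / 2 - 2) = ‖ζ‖ ^ (-κ - 3) * Real.sqrt ‖ζ‖ := by
      rw [Real.sqrt_eq_rpow, ← Real.rpow_add hn]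
      ring_nf
    rw [this, mul_left_comm, mul_comm C]
    refine mul_lt_mul_of_pos_left ?_ (by positivity)
    have : (C + 1) / q ≤ Real.sqrt ‖ζ‖ := Real.le_sqrt_of_sq_le (by linarith)
    rw [div_le_iff₀ hq] at this
    linarith
  simp only [mul_add, Finset.sum_add_distrib]
  linarith

/-- A superharmonic function on the quadrant growing like a power of the distance. -/
theorem exists_superharmonic (hc0 : 0 < c) (hc : (c : ℝ) ^ 3 + c ^ 2 = 1) (hθ0 : 0 < θ)
    (hθ1 : θ < Real.pi / 2) (hθ : Real.cos θ = (c : ℝ) ^ 3 / 2) {κ : ℝ} (hκ : 1 / 2 < κ)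
    (hκθ : κ * θ < Real.pi) :
    ∃ (h : ℤ × ℤ → ℝ≥0∞) (c₀ : ℝ), 0 < c₀ ∧
      (∀ z, 0 ≤ z → ∑ i, baxterWt c i * h (z + baxterStep i) ≤ h z) ∧
      (∀ z : ℤ × ℤ, 0 ≤ z → ENNReal.ofReal (c₀ * ((1 + z.1 + z.2 : ℤ) : ℝ) ^ κ) ≤ h z) ∧
      h 0 ≠ ⊤ := by
  obtain ⟨R, hR0, hR⟩ := exists_sector_superharmonic hc0 hc hθ0 hθ1 hθ hκ
  have hch := cos_half_pos hθ0 hθ1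
  set a := Real.cos (κ * (θ / 2)) with ha
  have ha0 : 0 < a := Real.cos_pos_of_mem_Ioo ⟨by nlinarith [Real.pi_pos], by linarith⟩
  obtain ⟨K, hK⟩ := exists_nat_gt ((R + (2 / a) ^ 2) / Real.cos (θ / 2))
  rw [div_lt_iff₀ hch] at hK
  set g : ℂ → ℝ := fun ζ => (ζ ^ (κ : ℂ)).re - ‖ζ‖ ^ (κ - 1 / 2) with hg
  set P : ℤ × ℤ → ℂ := fun z => latticeSector θ (z + ((K : ℤ) + 1, (K : ℤ) + 1)) with hP
  -- lower bound for points close to the quadrant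
  have hnorm : ∀ z : ℤ × ℤ, -1 ≤ z.1 → -1 ≤ z.2 →
      (0 < (P z).re ∧ R + (2 / a) ^ 2 ≤ ‖P z‖) ∧ a / 2 * ‖P z‖ ^ κ ≤ g (P z) := by
    intro z h1 h2
    have h1' : (-1 : ℝ) ≤ z.1 := by exact_mod_cast h1
    have h2' : (-1 : ℝ) ≤ z.2 := by exact_mod_cast h2
    have hKR : (0 : ℝ) < K := by
      by_contra! hcon
      have : (K : ℝ) * Real.cos (θ / 2) ≤ 0 := mul_nonpos_of_nonpos_of_nonneg hcon hch.le
      have : 0 < R + (2 / a) ^ 2 := by positivity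
      linarith
    have hPe : P z = sectorPoint θ (z.1 + (K + 1)) (z.2 + (K + 1)) := by
      simp [hP, latticeSector]
    have hle : R + (2 / a) ^ 2 ≤ (P z).re := by
      rw [hPe, sectorPoint_re]
      refine hK.le.trans (mul_le_mul_of_nonneg_right ?_ hch.le)
      linarith
    have hnle : R + (2 / a) ^ 2 ≤ ‖P z‖ := hle.trans (Complex.re_le_norm _)
    have hpos : 0 < R + (2 / a) ^ 2 := by positivity
    refine ⟨⟨by linarith, hnle⟩, ?_⟩
    have hn : 0 < ‖P z‖ := by linarith
    have harg : |(P z).arg| ≤ θ / 2 := by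
      rw [hPe]
      exact abs_arg_sectorPoint_le hθ0 hθ1 (by linarith) (by linarith) (by linarith)
    have hcos : a ≤ Real.cos (κ * (P z).arg) := by
      rw [ha, ← Real.cos_abs (κ * (P z).arg), abs_mul, abs_of_pos (by linarith : 0 < κ)]
      refine Real.cos_le_cos_of_nonneg_of_le_pi (by positivity) (by linarith [Real.pi_pos]) ?_
      exact mul_le_mul_of_nonneg_left harg (by linarith)
    simp only [hg]
    rw [re_cpow_real (norm_pos_iff.1 hn)]
    have hs : 2 / a ≤ Real.sqrt ‖P z‖ := Real.le_sqrt_of_sq_le (by linarith)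
    have e1 : ‖P z‖ ^ κ = ‖P z‖ ^ (κ - 1 / 2) * Real.sqrt ‖P z‖ := by
      rw [Real.sqrt_eq_rpow, ← Real.rpow_add hn]
      ring_nf
    have e2 : ‖P z‖ ^ (κ - 1 / 2) ≤ a / 2 * ‖P z‖ ^ κ := by
      rw [e1, mul_left_comm]
      refine le_mul_of_one_le_right (by positivity) ?_
      rw [div_le_iff₀ ha0] at hs
      linarith
    have e3 : ‖P z‖ ^ κ * a ≤ ‖P z‖ ^ κ * Real.cos (κ * (P z).arg) :=
      mul_le_mul_of_nonneg_left hcos (by positivity)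
    linarith
  refine ⟨fun z => ENNReal.ofReal (g (P z)), a / 2 * Real.cos (θ / 2) ^ κ, by positivity, ?_, ?_,
    ENNReal.ofReal_ne_top⟩
  · intro z hz
    have hz1 : (0 : ℤ) ≤ z.1 := hz.1
    have hz2 : (0 : ℤ) ≤ z.2 := hz.2
    have hstep : ∀ i, -1 ≤ (baxterStep i).1 ∧ -1 ≤ (baxterStep i).2 := by decide
    have hnn : ∀ i, 0 ≤ g (P (z + baxterStep i)) := fun i => by
      have := (hnorm (z + baxterStep i) (by have := (hstep i).1; rw [Prod.fst_add]; omega)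
        (by have := (hstep i).2; rw [Prod.snd_add]; omega)).2
      exact le_trans (by positivity) this
    have e1 : ∀ i, (baxterWt c i : ℝ≥0∞) * ENNReal.ofReal (g (P (z + baxterStep i))) =
        ENNReal.ofReal ((baxterWt c i : ℝ) * g (P (z + baxterStep i))) := fun i => by
      rw [ENNReal.ofReal_mul (NNReal.coe_nonneg (baxterWt c i)), ENNReal.ofReal_coe_nnreal]
    simp only [e1]
    rw [← ENNReal.ofReal_sum_of_nonneg fun i _ =>
      mul_nonneg (NNReal.coe_nonneg (baxterWt c i)) (hnn i)]
    refine ENNReal.ofReal_le_ofReal ?_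
    obtain ⟨⟨h1, h2⟩, -⟩ := hnorm z (by omega) (by omega)
    have h3 : 0 ≤ (2 / a) ^ 2 := by positivity
    have h4 := hR (P z) h1 (by linarith)
    have h5 : ∀ i, P (z + baxterStep i) = P z + latticeSector θ (baxterStep i) := fun i => by
      simp only [hP]
      rw [← latticeSector_add]
      congr 1
      abel
    simp only [h5]
    exact h4
  · intro z hz
    have hz1 : (0 : ℤ) ≤ z.1 := hz.1
    have hz2 : (0 : ℤ) ≤ z.2 := hz.2
    refine ENNReal.ofReal_le_ofReal (le_trans ?_ (hnorm z (by omega) (by omega)).2)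
    have hz1' : (0 : ℝ) ≤ z.1 := by exact_mod_cast hz1
    have hz2' : (0 : ℝ) ≤ z.2 := by exact_mod_cast hz2
    have h0 : (0 : ℝ) ≤ ((1 + z.1 + z.2 : ℤ) : ℝ) := by push_cast; linarith
    rw [mul_assoc, ← Real.mul_rpow hch.le h0]
    refine mul_le_mul_of_nonneg_left (Real.rpow_le_rpow (by positivity) ?_ (by linarith))
      (by positivity)
    refine le_trans ?_ (Complex.re_le_norm (P z))
    have hPe : P z = sectorPoint θ (z.1 + (K + 1)) (z.2 + (K + 1)) := by
      simp [hP, latticeSector]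
    rw [hPe, sectorPoint_re, mul_comm]
    refine mul_le_mul_of_nonneg_right ?_ hch.le
    push_cast
    have : (0 : ℝ) ≤ K := Nat.cast_nonneg K
    linarith

end Sector

section Subharmonic

open Filter Topology

variable {θ : ℝ}

theorem arg_sectorPoint_mul (θ : ℝ) {t : ℝ} (ht : 0 < t) (x y : ℝ) :
    (sectorPoint θ (t * x) (t * y)).arg = (sectorPoint θ x y).arg := by
  rw [sectorPoint_mul, Complex.arg_real_mul _ ht]

theorem arg_sectorPoint_zero_one (hθ0 : 0 < θ) (hθ1 : θ < Real.pi / 2) :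
    (sectorPoint θ 0 1).arg = θ / 2 := by
  rw [← Complex.arg_cos_add_sin_mul_I (θ := θ / 2)
    ⟨by linarith [Real.pi_pos], by linarith [Real.pi_pos]⟩]
  congr 1
  rw [← Complex.ofReal_cos, ← Complex.ofReal_sin, ← Complex.mk_eq_add_mul_I]
  simp [sectorPoint]

theorem arg_sectorPoint_one_zero (hθ0 : 0 < θ) (hθ1 : θ < Real.pi / 2) :
    (sectorPoint θ 1 0).arg = -(θ / 2) := by
  rw [← Complex.arg_cos_add_sin_mul_I (θ := -(θ / 2))
    ⟨by linarith [Real.pi_pos], by linarith [Real.pi_pos]⟩]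
  congr 1
  rw [← Complex.ofReal_cos, ← Complex.ofReal_sin, ← Complex.mk_eq_add_mul_I]
  simp [sectorPoint]

theorem arg_sectorPoint_one_one (hθ0 : 0 < θ) (hθ1 : θ < Real.pi / 2) :
    (sectorPoint θ 1 1).arg = 0 := by
  rw [Complex.arg_eq_zero_iff]
  have := cos_half_pos hθ0 hθ1
  constructor
  · rw [sectorPoint_re]
    positivity
  · simp [sectorPoint]

theorem continuousAt_arg_sectorPoint (hθ0 : 0 < θ) (hθ1 : θ < Real.pi / 2) {p : ℝ × ℝ}
    (hp : 0 < p.1 + p.2) : ContinuousAt (fun q : ℝ × ℝ => (sectorPoint θ q.1 q.2).arg) p := by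
  refine ContinuousAt.comp (g := Complex.arg) (f := fun q : ℝ × ℝ => sectorPoint θ q.1 q.2)
    (Complex.continuousAt_arg (Or.inl (mul_pos hp (cos_half_pos hθ0 hθ1)))) ?_
  have : (fun q : ℝ × ℝ => sectorPoint θ q.1 q.2) = fun q =>
      (((q.1 + q.2) * Real.cos (θ / 2) : ℝ) : ℂ) +
        (((q.2 - q.1) * Real.sin (θ / 2) : ℝ) : ℂ) * Complex.I := by
    funext q
    exact Complex.mk_eq_add_mul_I _ _
  rw [this]
  fun_prop

theorem norm_sectorPoint_le {x y : ℝ} (hx : 0 ≤ x) (hy : 0 ≤ y) :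
    ‖sectorPoint θ x y‖ ≤ 2 * (x + y) := by
  refine (Complex.norm_le_abs_re_add_abs_im _).trans ?_
  have h1 : |(sectorPoint θ x y).re| ≤ x + y := by
    rw [sectorPoint_re, abs_mul, abs_of_nonneg (by linarith : 0 ≤ x + y)]
    exact mul_le_of_le_one_right (by linarith) (Real.abs_cos_le_one _)
  have h2 : |(sectorPoint θ x y).im| ≤ x + y := by
    change |(y - x) * Real.sin (θ / 2)| ≤ _
    rw [abs_mul]
    refine (mul_le_of_le_one_right (abs_nonneg _) (Real.abs_sin_le_one _)).trans ?_
    rw [abs_le]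
    constructor <;> linarith
  linarith

variable {c : ℝ≥0}

/-- A function on the lattice that is subharmonic far from the origin, nonpositive outside the
quadrant, and decays like a power of the distance. -/
theorem exists_subharmonic (hc0 : 0 < c) (hc : (c : ℝ) ^ 3 + c ^ 2 = 1) (hθ0 : 0 < θ)
    (hθ1 : θ < Real.pi / 2) (hθ : Real.cos θ = (c : ℝ) ^ 3 / 2) {κ : ℝ} (hκ : 0 < κ)
    (hκθ : Real.pi < κ * θ) (hκθ' : κ * θ < 3 * Real.pi) :
    ∃ (f : ℤ × ℤ → ℝ) (R : ℤ),
      (∀ z, 0 ≤ z → R ≤ z.1 + z.2 → f z < ∑ i, (baxterWt c i : ℝ) * f (z + baxterStep i)) ∧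
      (∀ z, 0 ≤ z → R ≤ z.1 + z.2 → ∀ i, ¬ 0 ≤ z + baxterStep i → f (z + baxterStep i) ≤ 0) ∧
      (∀ t : ℝ, 0 < t → ∃ M : ℤ, ∀ z, 0 ≤ z → M ≤ z.1 + z.2 → f z < t) ∧
      ∃ (η b : ℝ), 0 < η ∧ 0 < b ∧ ∀ (r : ℝ) (z : ℤ × ℤ), 0 < r → r ≤ z.1 → r ≤ z.2 →
        z.1 ≤ (1 + η) * r → z.2 ≤ (1 + η) * r → b * r ^ (-κ) ≤ f z := by
  obtain ⟨R, hR0, hR⟩ := exists_sector_subharmonic hc0 hc hθ0 hθ1 hθ hκ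
  have hch := cos_half_pos hθ0 hθ1
  set g : ℂ → ℝ := fun ζ => (ζ ^ ((-κ : ℝ) : ℂ)).re + ‖ζ‖ ^ (-κ - 1 / 2) with hg
  have hgeq : ∀ ζ : ℂ, ζ ≠ 0 → g ζ = ‖ζ‖ ^ (-κ) * (Real.cos (κ * ζ.arg) + ‖ζ‖ ^ (-(1 / 2) : ℝ)) := by
    intro ζ hζ
    simp only [hg]
    rw [re_cpow_real hζ, neg_mul, Real.cos_neg, mul_add, ← Real.rpow_add (norm_pos_iff.2 hζ),
      sub_eq_add_neg]
  have hcos : Real.cos (κ * (θ / 2)) < 0 :=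
    Real.cos_neg_of_pi_div_two_lt_of_lt (by linarith) (by linarith)
  have hinv : Tendsto (fun x : ℝ => -x⁻¹) atTop (𝓝 0) := by
    simpa using (tendsto_inv_atTop_zero (𝕜 := ℝ)).neg
  -- behaviour along the two boundary rays
  have hlim1 : Tendsto (fun x : ℝ => Real.cos (κ * (sectorPoint θ (-x⁻¹) 1).arg) +
      ((x - 1) * Real.cos (θ / 2)) ^ (-(1 / 2) : ℝ)) atTop (𝓝 (Real.cos (κ * (θ / 2)) + 0)) := by
    refine Tendsto.add ?_ ?_
    · refine (Real.continuous_cos.tendsto _).comp (Tendsto.const_mul κ ?_)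
      have h1 := (continuousAt_arg_sectorPoint hθ0 hθ1 (p := (0, 1)) (by norm_num)).tendsto
      rw [arg_sectorPoint_zero_one hθ0 hθ1] at h1
      exact h1.comp (hinv.prodMk_nhds tendsto_const_nhds)
    · refine (tendsto_rpow_neg_atTop (by norm_num)).comp ?_
      exact (tendsto_atTop_add_const_right _ (-1) tendsto_id).atTop_mul_const hch
  have hlim2 : Tendsto (fun x : ℝ => Real.cos (κ * (sectorPoint θ 1 (-x⁻¹)).arg) +
      ((x - 1) * Real.cos (θ / 2)) ^ (-(1 / 2) : ℝ)) atTop (𝓝 (Real.cos (κ * (θ / 2)) + 0)) := by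
    refine Tendsto.add ?_ ?_
    · rw [← Real.cos_neg, ← mul_neg]
      refine (Real.continuous_cos.tendsto _).comp (Tendsto.const_mul κ ?_)
      have h1 := (continuousAt_arg_sectorPoint hθ0 hθ1 (p := (1, 0)) (by norm_num)).tendsto
      rw [arg_sectorPoint_one_zero hθ0 hθ1] at h1
      exact h1.comp (tendsto_const_nhds.prodMk_nhds hinv)
    · refine (tendsto_rpow_neg_atTop (by norm_num)).comp ?_
      exact (tendsto_atTop_add_const_right _ (-1) tendsto_id).atTop_mul_const hch
  rw [add_zero] at hlim1 hlim2
  obtain ⟨Y₀, hY₀⟩ := eventually_atTop.1 ((hlim1.eventually_lt_const hcos).and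
    (hlim2.eventually_lt_const hcos))
  obtain ⟨Y, hY⟩ := exists_int_gt (max (max Y₀ 2) (R / Real.cos (θ / 2)))
  simp only [max_lt_iff] at hY
  obtain ⟨⟨hY1, hY2⟩, hY3⟩ := hY
  rw [div_lt_iff₀ hch] at hY3
  have hedge : ∀ ζ : ℂ, ∀ x : ℝ, 2 ≤ x → (x - 1) * Real.cos (θ / 2) ≤ ‖ζ‖ →
      Real.cos (κ * ζ.arg) + ((x - 1) * Real.cos (θ / 2)) ^ (-(1 / 2) : ℝ) < 0 → g ζ ≤ 0 := by
    intro ζ x hx h1 h2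
    have hpos : 0 < (x - 1) * Real.cos (θ / 2) := mul_pos (by linarith) hch
    rw [hgeq ζ (norm_pos_iff.1 (hpos.trans_le h1))]
    refine mul_nonpos_of_nonneg_of_nonpos (by positivity) ?_
    have := Real.rpow_le_rpow_of_nonpos hpos h1 (by norm_num : (-(1 / 2) : ℝ) ≤ 0)
    linarith
  have hout1 : ∀ x : ℤ, Y ≤ x → g (latticeSector θ (-1, x)) ≤ 0 := by
    intro x hx
    have hx' : (Y : ℝ) ≤ x := by exact_mod_cast hx
    have hx0 : (0 : ℝ) < x := by linarith
    refine hedge _ x (by linarith) ?_ ?_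
    · refine le_trans (le_of_eq ?_) (le_norm_sectorPoint _ _ _)
      push_cast
      ring
    · have h := (hY₀ x (by linarith)).1
      rw [← arg_sectorPoint_mul θ hx0] at h
      rw [mul_neg, mul_inv_cancel₀ hx0.ne', mul_one] at h
      simpa [latticeSector] using h
  have hout2 : ∀ x : ℤ, Y ≤ x → g (latticeSector θ (x, -1)) ≤ 0 := by
    intro x hx
    have hx' : (Y : ℝ) ≤ x := by exact_mod_cast hx
    have hx0 : (0 : ℝ) < x := by linarith
    refine hedge _ x (by linarith) ?_ ?_
    · refine le_trans (le_of_eq ?_) (le_norm_sectorPoint _ _ _)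
      push_cast
      ring
    · have h := (hY₀ x (by linarith)).2
      rw [← arg_sectorPoint_mul θ hx0] at h
      rw [mul_neg, mul_inv_cancel₀ hx0.ne', mul_one] at h
      simpa [latticeSector] using h
  refine ⟨fun z => g (latticeSector θ z), Y, ?_, ?_, ?_, ?_⟩
  · intro z hz hzY
    have hz1 : (0 : ℤ) ≤ z.1 := hz.1
    have hz2 : (0 : ℤ) ≤ z.2 := hz.2
    have hzY' : (Y : ℝ) ≤ z.1 + z.2 := by exact_mod_cast hzY
    have hre : R ≤ (latticeSector θ z).re := by
      refine hY3.le.trans ?_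
      exact mul_le_mul_of_nonneg_right hzY' hch.le
    simp only [latticeSector_add]
    exact hR _ (by linarith) (hre.trans (Complex.re_le_norm _))
  · intro z hz hzY i hi
    have hz1 : (0 : ℤ) ≤ z.1 := hz.1
    have hz2 : (0 : ℤ) ≤ z.2 := hz.2
    obtain ⟨x, y⟩ := z
    have hstep : (∃ v, Y ≤ v ∧ (x, y) + baxterStep i = (-1, v)) ∨
        ∃ v, Y ≤ v ∧ (x, y) + baxterStep i = (v, -1) := by
      simp only [Prod.le_def, Prod.fst_add, Prod.snd_add, Prod.fst_zero, Prod.snd_zero] at hi hz1 hz2 hzY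
      fin_cases i <;> simp [baxterStep] at hi ⊢ <;> omega
    obtain ⟨v, hv, h⟩ | ⟨v, hv, h⟩ := hstep
    · simp only [h]
      exact hout1 v hv
    · simp only [h]
      exact hout2 v hv
  · intro t ht
    have h1 : Tendsto (fun x : ℝ => (x * Real.cos (θ / 2)) ^ (-κ) +
        (x * Real.cos (θ / 2)) ^ (-(κ + 1 / 2))) atTop (𝓝 (0 + 0)) := by
      have h2 : Tendsto (fun x : ℝ => x * Real.cos (θ / 2)) atTop atTop :=
        tendsto_id.atTop_mul_const hch
      exact ((tendsto_rpow_neg_atTop hκ).comp h2).add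
        ((tendsto_rpow_neg_atTop (by linarith)).comp h2)
    rw [add_zero] at h1
    obtain ⟨M₀, hM₀⟩ := eventually_atTop.1 (h1.eventually_lt_const ht)
    obtain ⟨M, hM⟩ := exists_int_gt (max M₀ 0)
    rw [max_lt_iff] at hM
    refine ⟨M, fun z hz hzM => ?_⟩
    have hzM' : (M : ℝ) ≤ z.1 + z.2 := by exact_mod_cast hzM
    refine lt_of_le_of_lt ?_ (hM₀ (z.1 + z.2) (by linarith))
    have hpos : 0 < ((z.1 : ℝ) + z.2) * Real.cos (θ / 2) := mul_pos (by linarith) hch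
    have hle : ((z.1 : ℝ) + z.2) * Real.cos (θ / 2) ≤ ‖latticeSector θ z‖ :=
      le_norm_sectorPoint _ _ _
    have hne : latticeSector θ z ≠ 0 := norm_pos_iff.1 (hpos.trans_le hle)
    have e1 := Real.rpow_le_rpow_of_nonpos hpos hle (by linarith : -κ ≤ 0)
    have e2 := Real.rpow_le_rpow_of_nonpos hpos hle (by linarith : -(κ + 1 / 2) ≤ 0)
    have e3 : ((latticeSector θ z) ^ ((-κ : ℝ) : ℂ)).re ≤ ‖latticeSector θ z‖ ^ (-κ) := by
      rw [re_cpow_real hne]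
      exact mul_le_of_le_one_right (by positivity) (Real.cos_le_one _)
    simp only [hg]
    have e4 : -κ - 1 / 2 = -(κ + 1 / 2) := by ring
    rw [e4]
    linarith
  · have h1 := (continuousAt_arg_sectorPoint hθ0 hθ1 (p := (1, 1)) (by norm_num)).tendsto
    rw [arg_sectorPoint_one_one hθ0 hθ1] at h1
    have h2 : Tendsto (fun q : ℝ × ℝ => Real.cos (κ * (sectorPoint θ q.1 q.2).arg)) (𝓝 (1, 1))
        (𝓝 (Real.cos (κ * 0))) := (Real.continuous_cos.tendsto _).comp (h1.const_mul κ)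
    rw [mul_zero, Real.cos_zero] at h2
    obtain ⟨ε, hε, hball⟩ := Metric.eventually_nhds_iff.1
      (h2.eventually_const_lt (by norm_num : (1 / 2 : ℝ) < 1))
    refine ⟨ε / 2, 1 / 2 * (4 * (1 + ε / 2)) ^ (-κ), by positivity, by positivity, ?_⟩
    intro r z hr hx1 hy1 hx2 hy2
    have hζ : latticeSector θ z = r * sectorPoint θ (z.1 / r) (z.2 / r) := by
      rw [← sectorPoint_mul, latticeSector]
      congr 1 <;> field_simp
    have harg : (latticeSector θ z).arg = (sectorPoint θ (z.1 / r) (z.2 / r)).arg := by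
      rw [hζ, Complex.arg_real_mul _ hr]
    have hd : ∀ x : ℝ, r ≤ x → x ≤ (1 + ε / 2) * r → |x / r - 1| < ε := by
      intro x h1 h2
      rw [← one_le_div hr] at h1
      rw [← div_le_iff₀ hr] at h2
      rw [abs_lt]
      constructor <;> linarith
    have hcos2 := hball (y := (z.1 / r, z.2 / r)) (by
      rw [Prod.dist_eq, max_lt_iff, Real.dist_eq, Real.dist_eq]
      exact ⟨hd _ hx1 hx2, hd _ hy1 hy2⟩)
    have hpos : 0 < ((z.1 : ℝ) + z.2) * Real.cos (θ / 2) := mul_pos (by linarith) hch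
    have hle : ((z.1 : ℝ) + z.2) * Real.cos (θ / 2) ≤ ‖latticeSector θ z‖ :=
      le_norm_sectorPoint _ _ _
    have hnpos := hpos.trans_le hle
    have hup : ‖latticeSector θ z‖ ≤ 4 * (1 + ε / 2) * r := by
      refine (norm_sectorPoint_le (by linarith) (by linarith)).trans ?_
      linarith
    simp only
    rw [hgeq _ (norm_pos_iff.1 hnpos), harg]
    have e1 := Real.rpow_le_rpow_of_nonpos hnpos hup (by linarith : -κ ≤ 0)
    rw [Real.mul_rpow (by positivity) hr.le] at e1
    have e2 : 0 ≤ ‖latticeSector θ z‖ ^ (-(1 / 2) : ℝ) := by positivity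
    calc 1 / 2 * (4 * (1 + ε / 2)) ^ (-κ) * r ^ (-κ) =
        ((4 * (1 + ε / 2)) ^ (-κ) * r ^ (-κ)) * (1 / 2) := by ring
      _ ≤ ‖latticeSector θ z‖ ^ (-κ) * (1 / 2) := by gcongr
      _ ≤ _ := mul_le_mul_of_nonneg_left (by linarith) (by positivity)

end Subharmonic

section Green

variable {ι : Type*} [Fintype ι] {wt : ι → ℝ≥0} {st : ι → ℤ × ℤ}

theorem sum_mul_tsum_quadrantWalk_le {z : ℤ × ℤ} (hz : 0 ≤ z) (w : ℤ × ℤ) :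
    ∑ i, (wt i : ℝ≥0∞) * ∑' n, (quadrantWalk wt st n (z + st i) w : ℝ≥0∞) ≤
      ∑' n, (quadrantWalk wt st n z w : ℝ≥0∞) := by
  simp only [← ENNReal.tsum_mul_left]
  rw [← Summable.tsum_finsetSum fun _ _ => ENNReal.summable]
  have h : ∀ n, ∑ i, (wt i : ℝ≥0∞) * (quadrantWalk wt st n (z + st i) w : ℝ≥0∞) =
      quadrantWalk wt st (n + 1) z w := fun n => by
    rw [quadrantWalk_succ wt st hz]
    push_cast
    rfl
  simp only [h]
  exact ENNReal.tsum_comp_le_tsum_of_injective (add_left_injective 1)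
    fun n => (quadrantWalk wt st n z w : ℝ≥0∞)

/-- Comparison of a decaying function, subharmonic far from the corner, with Green's function. -/
theorem exists_le_tsum_quadrantWalk (hwt : ∑ i, wt i = 1) {f : ℤ × ℤ → ℝ} {R : ℤ}
    (hsub : ∀ z, 0 ≤ z → R ≤ z.1 + z.2 → f z < ∑ i, (wt i : ℝ) * f (z + st i))
    (hout : ∀ z, 0 ≤ z → R ≤ z.1 + z.2 → ∀ i, ¬ 0 ≤ z + st i → f (z + st i) ≤ 0)
    (hdecay : ∀ t : ℝ, 0 < t → ∃ M : ℤ, ∀ z, 0 ≤ z → M ≤ z.1 + z.2 → f z < t)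
    (hpos : ∀ z, 0 ≤ z → ∃ n, quadrantWalk wt st n z 0 ≠ 0) :
    ∃ ε : ℝ, 0 < ε ∧ ∀ z, 0 ≤ z →
      ENNReal.ofReal (ε * f z) ≤ ∑' n, (quadrantWalk wt st n z 0 : ℝ≥0∞) := by
  set G : ℤ × ℤ → ℝ≥0∞ := fun z => ∑' n, (quadrantWalk wt st n z 0 : ℝ≥0∞) with hG
  set m : ℤ × ℤ → ℝ := fun z => (min (G z) 1).toReal with hm
  have htop : ∀ z, min (G z) 1 ≠ ⊤ := fun z => ne_top_of_le_ne_top ENNReal.one_ne_top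
    (min_le_right _ _)
  have hm0 : ∀ z, 0 ≤ m z := fun z => ENNReal.toReal_nonneg
  have hmpos : ∀ z, 0 ≤ z → 0 < m z := by
    intro z hz
    refine ENNReal.toReal_pos ?_ (htop z)
    obtain ⟨n, hn⟩ := hpos z hz
    have h1 : (0 : ℝ≥0∞) < quadrantWalk wt st n z 0 := by exact_mod_cast pos_iff_ne_zero.2 hn
    exact (lt_min (h1.trans_le (ENNReal.le_tsum n)) one_pos).ne'
  have hmsup : ∀ z, 0 ≤ z → ∑ i, (wt i : ℝ) * m (z + st i) ≤ m z := by
    intro z hz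
    have h1 : ∑ i, (wt i : ℝ≥0∞) * min (G (z + st i)) 1 ≤ min (G z) 1 := by
      refine le_min ?_ ?_
      · refine le_trans (Finset.sum_le_sum fun i _ => ?_) (sum_mul_tsum_quadrantWalk_le hz 0)
        gcongr
        exact min_le_left _ _
      · refine le_trans (Finset.sum_le_sum fun i _ => mul_le_mul_right (min_le_right _ _) _) ?_
        simp only [mul_one]
        exact_mod_cast hwt.le
    have h2 := ENNReal.toReal_mono (htop z) h1
    rw [ENNReal.toReal_sum fun i _ => ENNReal.mul_ne_top ENNReal.coe_ne_top (htop _)] at h2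
    simpa only [ENNReal.toReal_mul, ENNReal.coe_toReal] using h2
  have hfin : ∀ M : ℤ, {z : ℤ × ℤ | 0 ≤ z ∧ z.1 + z.2 < M}.Finite := by
    intro M
    refine (Set.finite_Icc (0 : ℤ × ℤ) (M, M)).subset fun z hz => ⟨hz.1, ?_⟩
    have h1 : (0 : ℤ) ≤ z.1 := hz.1.1
    have h2 : (0 : ℤ) ≤ z.2 := hz.1.2
    have h3 := hz.2
    constructor <;> simp only <;> omega
  set S := (hfin R).toFinset with hS
  set B : ℝ := 1 + ∑ z ∈ S, |f z| / m z with hB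
  have hB0 : 0 < B := by
    have : 0 ≤ ∑ z ∈ S, |f z| / m z := Finset.sum_nonneg fun z _ =>
      div_nonneg (abs_nonneg _) (hm0 z)
    linarith
  have hnear : ∀ z, 0 ≤ z → z.1 + z.2 < R → B⁻¹ * f z ≤ m z := by
    intro z hz hzR
    rw [inv_mul_le_iff₀ hB0]
    have h1 : |f z| / m z ≤ B := by
      have := Finset.single_le_sum (f := fun z => |f z| / m z)
        (fun z _ => div_nonneg (abs_nonneg _) (hm0 z))
        (show z ∈ S by rw [hS, Set.Finite.mem_toFinset]; exact ⟨hz, hzR⟩)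
      linarith
    rw [div_le_iff₀ (hmpos z hz)] at h1
    exact (le_abs_self _).trans h1
  refine ⟨B⁻¹, inv_pos.2 hB0, ?_⟩
  suffices hle : ∀ z, 0 ≤ z → B⁻¹ * f z ≤ m z by
    intro z hz
    refine (ENNReal.ofReal_le_of_le_toReal (hle z hz)).trans (min_le_left _ _)
  by_contra! hcon
  obtain ⟨z₀, hz₀, h₀⟩ := hcon
  set φ : ℤ × ℤ → ℝ := fun z => B⁻¹ * f z - m z with hφ
  have hφ₀ : 0 < φ z₀ := sub_pos.2 h₀
  obtain ⟨M, hM⟩ := hdecay (B * φ z₀) (by positivity)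
  have hTfin : {z : ℤ × ℤ | 0 ≤ z ∧ φ z₀ ≤ φ z}.Finite := by
    refine (hfin M).subset fun z hz => ⟨hz.1, ?_⟩
    by_contra! hcon
    have h1 := hM z hz.1 hcon
    rw [← inv_mul_lt_iff₀ hB0] at h1
    have h2 := hz.2
    have h3 := hm0 z
    simp only [hφ] at h2 h1
    linarith
  obtain ⟨z, hz, hmax⟩ := hTfin.exists_maximalFor φ _ ⟨z₀, hz₀, le_rfl⟩
  have hzmax : ∀ v, 0 ≤ v → φ v ≤ φ z := by
    intro v hv
    by_contra! hcon
    exact absurd (hmax ⟨hv, hz.2.trans hcon.le⟩ hcon.le) (not_le.2 hcon)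
  have hzpos : 0 < φ z := hφ₀.trans_le hz.2
  have hfar : R ≤ z.1 + z.2 := by
    by_contra! hcon
    have := hnear z hz.1 hcon
    simp only [hφ] at hzpos
    linarith
  have hwt' : ∑ i, (wt i : ℝ) = 1 := by exact_mod_cast hwt
  have h1 : ∑ i, (wt i : ℝ) * φ (z + st i) ≤ φ z := by
    calc ∑ i, (wt i : ℝ) * φ (z + st i) ≤ ∑ i, (wt i : ℝ) * φ z := by
          refine Finset.sum_le_sum fun i _ => mul_le_mul_of_nonneg_left ?_ (NNReal.coe_nonneg _)
          by_cases hv : 0 ≤ z + st i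
          · exact hzmax _ hv
          · have h1 := hout z hz.1 hfar i hv
            have h2 := hm0 (z + st i)
            have h3 : B⁻¹ * f (z + st i) ≤ 0 :=
              mul_nonpos_of_nonneg_of_nonpos (inv_pos.2 hB0).le h1
            refine le_trans ?_ hzpos.le
            simp only [hφ]
            linarith
      _ = φ z := by rw [← Finset.sum_mul, hwt', one_mul]
  have h2 := mul_lt_mul_of_pos_left (hsub z hz.1 hfar) (inv_pos.2 hB0)
  have h3 := hmsup z hz.1
  have h4 : ∑ i, (wt i : ℝ) * φ (z + st i) =
      B⁻¹ * ∑ i, (wt i : ℝ) * f (z + st i) - ∑ i, (wt i : ℝ) * m (z + st i) := by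
    rw [Finset.mul_sum, ← Finset.sum_sub_distrib]
    exact Finset.sum_congr rfl fun i _ => by simp only [hφ]; ring
  rw [h4] at h1
  simp only [hφ] at h1
  linarith

end Green

section Lower

open Filter Topology

theorem ENNReal_tsum_tsum_add (f : ℕ → ℝ≥0∞) :
    ∑' m, ∑' k, f (m + k) = ∑' n, (n + 1 : ℕ) * f n := by
  rw [← ENNReal.tsum_prod (f := fun m k => f (m + k)),
    ← Finset.HasAntidiagonal.sigmaAntidiagonalEquivProd.tsum_eq (fun p : ℕ × ℕ => f (p.1 + p.2)),
    ENNReal.tsum_sigma']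
  refine tsum_congr fun n => ?_
  have h : ∀ p : Finset.HasAntidiagonal.antidiagonal n,
      f ((Finset.HasAntidiagonal.sigmaAntidiagonalEquivProd ⟨n, p⟩).1 +
      (Finset.HasAntidiagonal.sigmaAntidiagonalEquivProd ⟨n, p⟩).2) = f n := fun p => by
    rw [Finset.HasAntidiagonal.sigmaAntidiagonalEquivProd_apply,
      Finset.HasAntidiagonal.mem_antidiagonal.1 p.2]
  rw [tsum_congr h, tsum_fintype, Finset.sum_const, nsmul_eq_mul]
  simp

variable {ι : Type*} [Fintype ι] {wt : ι → ℝ≥0} {st : ι → ℤ × ℤ}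

theorem sum_green_mul_green_le {τ : Equiv.Perm ι} (hst : ∀ i, st (τ i) = -(st i).swap)
    (hwτ : ∀ i, wt (τ i) = wt i) (N : ℕ) (D : Finset (ℤ × ℤ)) :
    ∑ z ∈ D, (∑' m, (quadrantWalk wt st (m + N) z.swap 0 : ℝ≥0∞)) *
        ∑' k, (quadrantWalk wt st (k + N) z 0 : ℝ≥0∞) ≤
      ∑' n, (n + 1 : ℕ) * (quadrantWalk wt st (n + (N + N)) 0 0 : ℝ≥0∞) := by
  rw [← ENNReal_tsum_tsum_add fun n => (quadrantWalk wt st (n + (N + N)) 0 0 : ℝ≥0∞)]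
  refine (ENNReal.sum_le_tsum D).trans ?_
  have h : ∀ z : ℤ × ℤ, ∀ m, quadrantWalk wt st m z.swap 0 = quadrantWalk wt st m 0 z :=
    fun z m => quadrantWalk_swap hst hwτ m 0 z
  simp only [h, ← ENNReal.tsum_mul_right]
  rw [ENNReal.tsum_comm]
  refine ENNReal.tsum_le_tsum fun m => ?_
  simp only [← ENNReal.tsum_mul_left]
  rw [ENNReal.tsum_comm]
  refine ENNReal.tsum_le_tsum fun k => ?_
  rw [← quadrantWalk_add, show m + N + (k + N) = m + k + (N + N) by ring]

/-- Many long walks start from the diagonal, so the return series cannot decay too fast. -/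
theorem not_summable_quadrantWalk_mul_rpow {τ : Equiv.Perm ι}
    (hst : ∀ i, st (τ i) = -(st i).swap) (hwτ : ∀ i, wt (τ i) = wt i)
    (hexp : ∀ (σ : ℝ) (n : ℕ) (z : ℤ × ℤ), (quadrantWalk wt st n z 0 : ℝ) ≤
      Real.exp (-σ * ((z.1 + z.2 : ℤ) : ℝ) + σ ^ 2 / 2 * n))
    {κ η b : ℝ} (hη : 0 < η) (hb : 0 < b) (hκ : 1 < κ)
    (hdiag : ∀ (r : ℝ) (z : ℤ × ℤ), 0 < r → r ≤ z.1 → r ≤ z.2 →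
        z.1 ≤ (1 + η) * r → z.2 ≤ (1 + η) * r →
        ENNReal.ofReal (b * r ^ (-κ)) ≤ ∑' n, (quadrantWalk wt st n z 0 : ℝ≥0∞))
    {s : ℝ} (hs : κ < s) :
    ¬ Summable fun n : ℕ => (quadrantWalk wt st n 0 0 : ℝ) * (n : ℝ) ^ s := by
  intro hsum
  -- exponent for the time cutoff
  obtain ⟨t, ht1, ht2⟩ : ∃ t, max 1 (2 * (κ - 1) / (s - 1)) < t ∧ t < 2 := by
    refine exists_between (max_lt (by norm_num) ?_)
    rw [div_lt_iff₀ (by linarith)]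
    linarith
  rw [max_lt_iff, div_lt_iff₀ (by linarith)] at ht1
  obtain ⟨ht1, hts⟩ := ht1
  set p : ℝ := 1 - t / 2 with hp
  have hp0 : 0 < p := by linarith
  set U : ℝ := ∑' n : ℕ, (quadrantWalk wt st n 0 0 : ℝ) * (n : ℝ) ^ s with hU
  -- short walks are negligible
  have hneg : Tendsto (fun r : ℝ => 2 * Real.exp (1 / 2) *
      ((r ^ p) ^ ((κ + t) / p) * Real.exp (-2 * r ^ p))) atTop
      (𝓝 (2 * Real.exp (1 / 2) * 0)) :=
    ((tendsto_rpow_mul_exp_neg_mul_atTop_nhds_zero _ 2 (by norm_num)).comp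
      (tendsto_rpow_atTop hp0)).const_mul _
  rw [mul_zero] at hneg
  have hbig : Tendsto (fun r : ℝ => η ^ 2 * (b / 2) ^ 2 * r ^ (t * (s - 1) - 2 * (κ - 1))) atTop
      atTop := (tendsto_rpow_atTop (by linarith)).const_mul_atTop (by positivity)
  obtain ⟨r₀, hr₀⟩ := eventually_atTop.1
    ((hneg.eventually_lt_const (by positivity : 0 < b / 2)).and
      (hbig.eventually_gt_atTop U))
  obtain ⟨r', hr'⟩ := exists_nat_gt (max r₀ 1)
  rw [max_lt_iff] at hr'
  obtain ⟨h1, h2⟩ := hr₀ r' hr'.1.le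
  set r : ℝ := (r' : ℝ) with hr
  have hr1 : 1 < r := hr'.2
  have hr0 : 0 < r := by linarith
  set N : ℕ := ⌊r ^ t⌋₊ with hN
  have hrt : 1 ≤ r ^ t := Real.one_le_rpow hr1.le (by linarith)
  have hN1 : (N : ℝ) ≤ r ^ t := Nat.floor_le (by positivity)
  have hN2 : r ^ t < (N + 1 : ℕ) := by
    push_cast
    exact Nat.lt_floor_add_one _
  set D₁ : Finset ℤ := Finset.Icc (r' : ℤ) (r' + ⌊η * r⌋) with hD₁
  have hD₁mem : ∀ x ∈ D₁, r ≤ x ∧ (x : ℝ) ≤ (1 + η) * r := by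
    intro x hx
    rw [hD₁, Finset.mem_Icc] at hx
    have e1 : ((r' : ℤ) : ℝ) ≤ x := by exact_mod_cast hx.1
    have e2 : (x : ℝ) ≤ ((r' : ℤ) : ℝ) + ⌊η * r⌋ := by exact_mod_cast hx.2
    have e3 := Int.floor_le (η * r)
    rw [Int.cast_natCast] at e1 e2
    exact ⟨e1, by linarith⟩
  have hD₁card : η * r ≤ (D₁.card : ℝ) := by
    have e1 : (D₁.card : ℤ) = ⌊η * r⌋ + 1 := by
      have : (0 : ℤ) ≤ ⌊η * r⌋ := Int.floor_nonneg.2 (by positivity)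
      rw [hD₁, Int.card_Icc, Int.toNat_of_nonneg (by omega)]
      ring
    have e2 : (D₁.card : ℝ) = (⌊η * r⌋ : ℝ) + 1 := by exact_mod_cast e1
    rw [e2]
    exact (Int.lt_floor_add_one _).le
  have htail : ∀ z ∈ D₁ ×ˢ D₁, ENNReal.ofReal (b / 2 * r ^ (-κ)) ≤
      ∑' k, (quadrantWalk wt st (k + (N + 1)) z 0 : ℝ≥0∞) := by
    intro z hz
    rw [Finset.mem_product] at hz
    obtain ⟨ex1, ex2⟩ := hD₁mem _ hz.1
    obtain ⟨ey1, ey2⟩ := hD₁mem _ hz.2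
    have hG := hdiag r z hr0 ex1 ey1 ex2 ey2
    rw [← ENNReal.summable.sum_add_tsum_nat_add' (k := N + 1)] at hG
    have hshort : ∑ k ∈ Finset.range (N + 1), (quadrantWalk wt st k z 0 : ℝ≥0∞) ≤
        ENNReal.ofReal (b / 2 * r ^ (-κ)) := by
      have e1 : ∀ k ∈ Finset.range (N + 1), (quadrantWalk wt st k z 0 : ℝ) ≤
          Real.exp (1 / 2) * Real.exp (-2 * r ^ p) := by
        intro k hk
        refine (hexp (r ^ (-(t / 2))) k z).trans ?_
        rw [← Real.exp_add, Real.exp_le_exp]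
        have hkN : (k : ℝ) ≤ r ^ t :=
          le_trans (by exact_mod_cast Nat.lt_succ_iff.1 (Finset.mem_range.1 hk)) hN1
        have e2 : (r ^ (-(t / 2))) ^ 2 * r ^ t = 1 := by
          rw [← Real.rpow_natCast, ← Real.rpow_mul hr0.le, ← Real.rpow_add hr0]
          norm_num
        have e3 : r ^ (-(t / 2)) * r = r ^ p := by
          rw [← Real.rpow_add_one hr0.ne']
          congr 1
          ring
        have e4 : (r ^ (-(t / 2))) ^ 2 * k ≤ 1 := by
          rw [← e2]
          gcongr
        have e5 : r ^ (-(t / 2)) * (2 * r) ≤ r ^ (-(t / 2)) * ((z.1 + z.2 : ℤ) : ℝ) := by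
          refine mul_le_mul_of_nonneg_left ?_ (by positivity)
          push_cast
          linarith
        linarith
      have e6 : (∑ k ∈ Finset.range (N + 1), (quadrantWalk wt st k z 0 : ℝ)) ≤
          b / 2 * r ^ (-κ) := by
        refine (Finset.sum_le_sum e1).trans ?_
        rw [Finset.sum_const, Finset.card_range, nsmul_eq_mul]
        have e7 : ((N + 1 : ℕ) : ℝ) ≤ 2 * r ^ t := by
          push_cast
          linarith
        have e8 : (r ^ p) ^ ((κ + t) / p) = r ^ κ * r ^ t := by
          rw [← Real.rpow_mul hr0.le, mul_div_cancel₀ _ hp0.ne', Real.rpow_add hr0]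
        rw [e8] at h1
        have e9 : 0 < Real.exp (1 / 2) * Real.exp (-2 * r ^ p) := by positivity
        rw [Real.rpow_neg hr0.le, ← div_eq_mul_inv, le_div_iff₀ (by positivity)]
        refine le_trans ?_ h1.le
        refine (mul_le_mul_of_nonneg_right (mul_le_mul_of_nonneg_right e7 e9.le)
          (by positivity)).trans (le_of_eq ?_)
        ring
      refine le_trans (le_of_eq ?_) (ENNReal.ofReal_le_ofReal e6)
      rw [ENNReal.ofReal_sum_of_nonneg fun _ _ => NNReal.coe_nonneg _]
      simp only [ENNReal.ofReal_coe_nnreal]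
    have hsplit : ENNReal.ofReal (b * r ^ (-κ)) =
        ENNReal.ofReal (b / 2 * r ^ (-κ)) + ENNReal.ofReal (b / 2 * r ^ (-κ)) := by
      rw [← ENNReal.ofReal_add (by positivity) (by positivity)]
      congr 1
      ring
    rw [hsplit] at hG
    exact (ENNReal.add_le_add_iff_left ENNReal.ofReal_ne_top).1
      (hG.trans (add_le_add_left hshort _))
  -- upper bound
  have hupper : ∑' n, (n + 1 : ℕ) * (quadrantWalk wt st (n + (N + 1 + (N + 1))) 0 0 : ℝ≥0∞) ≤
      ENNReal.ofReal (((N + 1 : ℕ) : ℝ) ^ (1 - s) * U) := by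
    rw [ENNReal.ofReal_mul (by positivity), hU,
      ENNReal.ofReal_tsum_of_nonneg (fun n => by positivity) hsum, ← ENNReal.tsum_mul_left]
    refine le_trans (ENNReal.tsum_le_tsum fun n => ?_)
      (ENNReal.tsum_comp_le_tsum_of_injective (add_left_injective (N + 1 + (N + 1))) _)
    rw [← ENNReal.ofReal_mul (by positivity), ← ENNReal.ofReal_coe_nnreal,
      ← ENNReal.ofReal_natCast, ← ENNReal.ofReal_mul (by positivity)]
    refine ENNReal.ofReal_le_ofReal ?_
    have e1 : ((n + 1 : ℕ) : ℝ) ≤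
        ((N + 1 : ℕ) : ℝ) ^ (1 - s) * ((n + (N + 1 + (N + 1)) : ℕ) : ℝ) ^ s := by
      set x : ℝ := ((n + (N + 1 + (N + 1)) : ℕ) : ℝ) with hx
      have e2 : ((N + 1 : ℕ) : ℝ) ≤ x := by
        rw [hx]
        exact_mod_cast (by omega : N + 1 ≤ n + (N + 1 + (N + 1)))
      have e3 : ((n + 1 : ℕ) : ℝ) ≤ x := by
        rw [hx]
        exact_mod_cast (by omega : n + 1 ≤ n + (N + 1 + (N + 1)))
      have e4 : (0 : ℝ) < ((N + 1 : ℕ) : ℝ) := by positivity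
      have e5 := Real.rpow_le_rpow_of_nonpos e4 e2 (by linarith : 1 - s ≤ 0)
      have hx0 : 0 < x := e4.trans_le e2
      calc ((n + 1 : ℕ) : ℝ) ≤ x := e3
        _ = x ^ (1 - s) * x ^ s := by
          rw [← Real.rpow_add hx0]
          norm_num
        _ ≤ _ := mul_le_mul_of_nonneg_right e5 (by positivity)
    calc ((n + 1 : ℕ) : ℝ) * (quadrantWalk wt st (n + (N + 1 + (N + 1))) 0 0 : ℝ) ≤ _ :=
        mul_le_mul_of_nonneg_right e1 (NNReal.coe_nonneg _)
      _ = _ := by ring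
  have hlower : ENNReal.ofReal ((η * r) ^ 2 * (b / 2 * r ^ (-κ)) ^ 2) ≤
      ∑ z ∈ D₁ ×ˢ D₁, (∑' m, (quadrantWalk wt st (m + (N + 1)) z.swap 0 : ℝ≥0∞)) *
        ∑' k, (quadrantWalk wt st (k + (N + 1)) z 0 : ℝ≥0∞) := by
    have e1 : ∀ z ∈ D₁ ×ˢ D₁, ENNReal.ofReal ((b / 2 * r ^ (-κ)) ^ 2) ≤
        (∑' m, (quadrantWalk wt st (m + (N + 1)) z.swap 0 : ℝ≥0∞)) *
        ∑' k, (quadrantWalk wt st (k + (N + 1)) z 0 : ℝ≥0∞) := by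
      intro z hz
      rw [pow_two, ENNReal.ofReal_mul (by positivity)]
      refine mul_le_mul' (htail z.swap ?_) (htail z hz)
      rw [Finset.mem_product] at hz ⊢
      exact hz.symm
    refine le_trans ?_ (Finset.card_nsmul_le_sum _ _ _ e1)
    rw [nsmul_eq_mul, ← ENNReal.ofReal_natCast, ← ENNReal.ofReal_mul (by positivity)]
    refine ENNReal.ofReal_le_ofReal (mul_le_mul_of_nonneg_right ?_ (by positivity))
    rw [Finset.card_product, Nat.cast_mul, pow_two]
    gcongr
  have hall := (hlower.trans (sum_green_mul_green_le hst hwτ (N + 1) _)).trans hupper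
  have hU0 : 0 ≤ U := tsum_nonneg fun n => by positivity
  rw [ENNReal.ofReal_le_ofReal_iff (by positivity)] at hall
  have e1 : ((N + 1 : ℕ) : ℝ) ^ (1 - s) ≤ (r ^ t) ^ (1 - s) :=
    Real.rpow_le_rpow_of_nonpos (by positivity) hN2.le (by linarith)
  have e2 : (r ^ t) ^ (1 - s) * r ^ (t * (s - 1)) = 1 := by
    rw [← Real.rpow_mul hr0.le, ← Real.rpow_add hr0]
    ring_nf
    exact Real.rpow_zero r
  have e3 : r ^ (t * (s - 1) - 2 * (κ - 1)) = r ^ (t * (s - 1)) * (r ^ 2 * (r ^ (-κ)) ^ 2) := by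
    rw [← Real.rpow_natCast, ← Real.rpow_natCast, ← Real.rpow_mul hr0.le, ← Real.rpow_add hr0,
      ← Real.rpow_add hr0]
    congr 1
    push_cast
    ring
  have e4 : (η * r) ^ 2 * (b / 2 * r ^ (-κ)) ^ 2 ≤ (r ^ t) ^ (1 - s) * U :=
    hall.trans (mul_le_mul_of_nonneg_right e1 hU0)
  have e5 := mul_le_mul_of_nonneg_right e4 (by positivity : 0 ≤ r ^ (t * (s - 1)))
  rw [mul_right_comm ((r ^ t) ^ (1 - s)), e2, one_mul] at e5
  rw [e3] at h2
  nlinarith [e5, h2]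

end Lower

section BaxterExponent

variable {c : ℝ≥0} {θ : ℝ}

theorem exists_baxterWalk_ne_zero (hc0 : 0 < c) {z : ℤ × ℤ} (hz : 0 ≤ z) :
    ∃ n, quadrantWalk (baxterWt c) baxterStep n z 0 ≠ 0 := by
  obtain ⟨k, hk⟩ : ∃ k : ℕ, z.1 + z.2 = k :=
    Int.eq_ofNat_of_zero_le (add_nonneg hz.1 hz.2)
  have hwt : ∀ i, baxterWt c i ≠ 0 := by
    have h : ∀ x : ℝ≥0, 0 < x → x / baxterTotal c ≠ 0 := fun x hx =>
      (div_pos hx (baxterTotal_pos c)).ne'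
    intro i
    fin_cases i <;> exact h _ (by simp [hc0, hc0.ne', pos_iff_ne_zero])
  have hstep : ∀ (i : Fin 6) (z : ℤ × ℤ), 0 ≤ z →
      (∃ n, quadrantWalk (baxterWt c) baxterStep n (z + baxterStep i) 0 ≠ 0) →
      ∃ n, quadrantWalk (baxterWt c) baxterStep n z 0 ≠ 0 := by
    rintro i z hz ⟨n, hn⟩
    refine ⟨n + 1, ?_⟩
    rw [quadrantWalk_succ _ _ hz]
    exact fun h0 => mul_ne_zero (hwt i) hn (Finset.sum_eq_zero_iff.1 h0 i (Finset.mem_univ i))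
  induction k generalizing z with
  | zero =>
    have h1 : (0 : ℤ) ≤ z.1 := hz.1
    have h2 : (0 : ℤ) ≤ z.2 := hz.2
    have : z = 0 := Prod.ext (by simp; omega) (by simp; omega)
    exact ⟨0, by simp [this, quadrantWalk]⟩
  | succ k ih =>
    have h1 : (0 : ℤ) ≤ z.1 := hz.1
    have h2 : (0 : ℤ) ≤ z.2 := hz.2
    rcases h1.eq_or_lt with h | h
    · refine hstep 4 z hz (ih ⟨?_, ?_⟩ ?_) <;> simp [baxterStep] <;> omega
    · refine hstep 1 z hz (ih ⟨?_, ?_⟩ ?_) <;> simp [baxterStep] <;> omega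

theorem summable_baxterWalk_mul_rpow (hc0 : 0 < c) (hc : (c : ℝ) ^ 3 + c ^ 2 = 1) (hθ0 : 0 < θ)
    (hθ1 : θ < Real.pi / 2) (hθ : Real.cos θ = (c : ℝ) ^ 3 / 2) {s : ℝ} (hs : s < Real.pi / θ) :
    Summable fun n : ℕ => (quadrantWalk (baxterWt c) baxterStep n 0 0 : ℝ) * (n : ℝ) ^ s := by
  have hlam : 1 / 2 < Real.pi / θ := by
    rw [lt_div_iff₀ hθ0]
    linarith [Real.pi_pos]
  obtain ⟨κ, hκ1, hκ2⟩ := exists_between (max_lt hs hlam)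
  rw [max_lt_iff] at hκ1
  rw [lt_div_iff₀ hθ0] at hκ2
  obtain ⟨h, c₀, hc₀, hh, hlow, htop⟩ := exists_superharmonic hc0 hc hθ0 hθ1 hθ hκ1.2 hκ2
  obtain ⟨K, hK0, hK⟩ := baxterWalk_le_div hc0
  exact summable_quadrantWalk_mul_rpow (sum_baxterWt c).le hK0 hK baxterStep_swap (baxterWt_swap c)
    hh (by linarith [hκ1.2]) hc₀ hlow htop hκ1.1

theorem not_summable_baxterWalk_mul_rpow (hc0 : 0 < c) (hc : (c : ℝ) ^ 3 + c ^ 2 = 1)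
    (hθ0 : 0 < θ) (hθ1 : θ < Real.pi / 2) (hθ : Real.cos θ = (c : ℝ) ^ 3 / 2) {s : ℝ}
    (hs : Real.pi / θ < s) :
    ¬ Summable fun n : ℕ => (quadrantWalk (baxterWt c) baxterStep n 0 0 : ℝ) * (n : ℝ) ^ s := by
  have hlam : 1 < Real.pi / θ := by
    rw [lt_div_iff₀ hθ0]
    linarith [Real.pi_pos]
  obtain ⟨κ, hκ1, hκ2⟩ := exists_between
    (lt_min hs (by linarith : Real.pi / θ < 3 * (Real.pi / θ)))
  rw [lt_min_iff, ← mul_div_assoc, lt_div_iff₀ hθ0] at hκ2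
  have hκ : 1 < κ := hlam.trans hκ1
  rw [div_lt_iff₀ hθ0] at hκ1
  obtain ⟨f, R, hsub, hout, hdecay, η, b, hη, hb, hdiag⟩ :=
    exists_subharmonic hc0 hc hθ0 hθ1 hθ (by linarith : 0 < κ) hκ1 hκ2.2
  obtain ⟨ε, hε, hG⟩ := exists_le_tsum_quadrantWalk (sum_baxterWt c) hsub hout hdecay
    fun z hz => exists_baxterWalk_ne_zero hc0 hz
  refine not_summable_quadrantWalk_mul_rpow baxterStep_swap (baxterWt_swap c)
    (fun σ n z => baxterWalk_le_exp c σ n z) hη (mul_pos hε hb) hκ ?_ hκ2.1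
  intro r z hr hx hy hx' hy'
  have hz : 0 ≤ z := by
    constructor
    · exact_mod_cast hr.le.trans hx
    · exact_mod_cast hr.le.trans hy
  refine le_trans (ENNReal.ofReal_le_ofReal ?_) (hG z hz)
  rw [mul_assoc]
  exact mul_le_mul_of_nonneg_left (hdiag r z hr hx hy hx' hy') hε.le

end BaxterExponent

section AppendValue

/-- The value `y` after inserting a new value `v`. -/
def bumpValue (v y : ℕ) : ℕ := if y < v then y else y + 1

/-- The word of length `m + 1` obtained by appending the value `v` to a word of length `m`. -/
def appendValue (F : ℕ → ℕ) (m v : ℕ) : ℕ → ℕ :=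
  fun i => if i < m then bumpValue v (F i) else if i = m then v else 0

/-- The first `m` entries of `F` contain one of the three patterns. -/
def HasPattern (F : ℕ → ℕ) (m : ℕ) : Prop :=
  ∃ i j k, i < j ∧ j + 1 < k ∧ k < m ∧
    ((F (j + 1) < F i ∧ F i < F k ∧ F k < F j) ∨ (F j < F k ∧ F k < F i ∧ F i < F (j + 1)) ∨
      (F (j + 1) < F k ∧ F k < F i ∧ F i < F j))

/-- Appending the value `v` creates a pattern. -/
def IsForbidden (F : ℕ → ℕ) (m v : ℕ) : Prop :=
  ∃ i j, i < j ∧ j + 1 < m ∧ ((F (j + 1) < v ∧ v ≤ F j ∧ F (j + 1) < F i ∧ F i < F j) ∨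
    (F j < v ∧ v ≤ F i ∧ F i < F (j + 1)))

variable {F : ℕ → ℕ} {m v : ℕ}

theorem appendValue_of_lt {i : ℕ} (hi : i < m) : appendValue F m v i = bumpValue v (F i) :=
  if_pos hi

theorem appendValue_self : appendValue F m v m = v := by simp [appendValue]

theorem bumpValue_lt_bumpValue {a b : ℕ} : bumpValue v a < bumpValue v b ↔ a < b := by
  unfold bumpValue
  split_ifs <;> omega

theorem bumpValue_lt {a : ℕ} : bumpValue v a < v ↔ a < v := by
  unfold bumpValue
  split_ifs <;> omega

theorem lt_bumpValue {a : ℕ} : v < bumpValue v a ↔ v ≤ a := by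
  unfold bumpValue
  split_ifs <;> omega

theorem bumpValue_lt_iff {a w : ℕ} :
    bumpValue v a < w ↔ a < if w ≤ v then w else w - 1 := by
  unfold bumpValue
  split_ifs <;> omega

theorem le_bumpValue_iff {a w : ℕ} :
    w ≤ bumpValue v a ↔ (if w ≤ v then w else w - 1) ≤ a := by
  rw [← not_lt, bumpValue_lt_iff, not_lt]

theorem hasPattern_appendValue :
    HasPattern (appendValue F m v) (m + 1) ↔ HasPattern F m ∨ IsForbidden F m v := by
  constructor
  · rintro ⟨i, j, k, hij, hjk, hk, h⟩
    rw [appendValue_of_lt (by omega : i < m), appendValue_of_lt (by omega : j < m),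
      appendValue_of_lt (by omega : j + 1 < m)] at h
    rcases Nat.lt_succ_iff_lt_or_eq.1 hk with hk | rfl
    · rw [appendValue_of_lt hk] at h
      simp only [bumpValue_lt_bumpValue] at h
      exact Or.inl ⟨i, j, k, hij, hjk, hk, h⟩
    · rw [appendValue_self] at h
      simp only [bumpValue_lt_bumpValue, bumpValue_lt, lt_bumpValue] at h
      exact Or.inr ⟨i, j, hij, hjk, by omega⟩
  · rintro (⟨i, j, k, hij, hjk, hk, h⟩ | ⟨i, j, hij, hjm, h⟩)
    · refine ⟨i, j, k, hij, hjk, by omega, ?_⟩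
      rw [appendValue_of_lt (by omega : i < m), appendValue_of_lt (by omega : j < m),
        appendValue_of_lt (by omega : j + 1 < m), appendValue_of_lt hk]
      simpa only [bumpValue_lt_bumpValue] using h
    · refine ⟨i, j, m, hij, hjm, by omega, ?_⟩
      rw [appendValue_of_lt (by omega : i < m), appendValue_of_lt (by omega : j < m),
        appendValue_of_lt (by omega : j + 1 < m), appendValue_self]
      simp only [bumpValue_lt_bumpValue, bumpValue_lt, lt_bumpValue]
      omega

/-- The first `m` entries of `F` form a permutation of `0, …, m - 1`. -/
structure IsPermWord (F : ℕ → ℕ) (m : ℕ) : Prop where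
  lt : ∀ i, i < m → F i < m
  inj : ∀ i j, i < m → j < m → F i = F j → i = j
  surj : ∀ y, y < m → ∃ i, i < m ∧ F i = y

theorem isForbidden_appendValue (hF : IsPermWord F (m + 1)) (hv : v ≤ m + 1) (w : ℕ) :
    IsForbidden (appendValue F (m + 1) v) (m + 2) w ↔
      IsForbidden F (m + 1) (if w ≤ v then w else w - 1) ∨
        (v < F m ∧ v < w ∧ w ≤ F m + 1) ∨ (F m < w ∧ w < v) := by
  constructor
  · rintro ⟨i, j, hij, hjm, h⟩
    rw [appendValue_of_lt (by omega : i < m + 1), appendValue_of_lt (by omega : j < m + 1)] at h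
    rcases Nat.lt_succ_iff_lt_or_eq.1 hjm with hjm | hjm
    · rw [appendValue_of_lt hjm] at h
      simp only [bumpValue_lt_bumpValue, bumpValue_lt_iff (w := w), le_bumpValue_iff] at h
      exact Or.inl ⟨i, j, hij, hjm, h⟩
    · rw [hjm, appendValue_self] at h
      obtain rfl : j = m := by omega
      right
      unfold bumpValue at h
      split_ifs at h <;> omega
  · rintro (⟨i, j, hij, hjm, h⟩ | ⟨h1, h2, h3⟩ | ⟨h1, h2⟩)
    · refine ⟨i, j, hij, by omega, ?_⟩
      rw [appendValue_of_lt (by omega : i < m + 1), appendValue_of_lt (by omega : j < m + 1),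
        appendValue_of_lt hjm]
      simpa only [bumpValue_lt_bumpValue, bumpValue_lt_iff (w := w), le_bumpValue_iff] using h
    · obtain ⟨i, hi, hiv⟩ := hF.surj v (by have := hF.lt m (by omega); omega)
      have him : i ≠ m := by
        rintro rfl
        omega
      refine ⟨i, m, by omega, by omega, ?_⟩
      rw [appendValue_of_lt (by omega : i < m + 1), appendValue_of_lt (by omega : m < m + 1),
        appendValue_self, hiv]
      unfold bumpValue
      split_ifs <;> omega
    · obtain ⟨i, hi, hiw⟩ := hF.surj w (by omega)
      have him : i ≠ m := by
        rintro rfl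
        omega
      refine ⟨i, m, by omega, by omega, ?_⟩
      rw [appendValue_of_lt (by omega : i < m + 1), appendValue_of_lt (by omega : m < m + 1),
        appendValue_self, hiw]
      unfold bumpValue
      split_ifs <;> omega

theorem not_isForbidden_last (hF : IsPermWord F (m + 1)) (h : ¬ HasPattern F (m + 1)) :
    ¬ IsForbidden F (m + 1) (F m) := by
  rintro ⟨i, j, hij, hjm, h'⟩
  have him : F i ≠ F m := fun he => by
    have := hF.inj i m (by omega) (by omega) he
    omega
  have hjm' : F j ≠ F m := fun he => by
    have := hF.inj j m (by omega) (by omega) he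
    omega
  rcases Nat.lt_succ_iff_lt_or_eq.1 hjm with hlt | heq
  · exact h ⟨i, j, m, hij, hlt, by omega, by omega⟩
  · rw [heq] at h'
    omega

end AppendValue

section Label

open Classical in
/-- The values that can be appended. -/
noncomputable def activeSites (F : ℕ → ℕ) (m : ℕ) : Finset ℕ :=
  (Finset.range (m + 1)).filter fun v => ¬ IsForbidden F m v

theorem mem_activeSites {F : ℕ → ℕ} {m v : ℕ} :
    v ∈ activeSites F m ↔ v ≤ m ∧ ¬ IsForbidden F m v := by
  simp [activeSites]

/-- The number of active sites up to the last value. -/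
noncomputable def lowSites (F : ℕ → ℕ) (m : ℕ) : ℕ :=
  ((activeSites F m).filter fun w => w ≤ F (m - 1)).card

/-- The number of active sites above the last value. -/
noncomputable def highSites (F : ℕ → ℕ) (m : ℕ) : ℕ :=
  ((activeSites F m).filter fun w => F (m - 1) < w).card

variable {F : ℕ → ℕ} {m v : ℕ}

theorem lowSites_appendValue (hF : IsPermWord F (m + 1)) (hv : v ≤ m + 1) :
    lowSites (appendValue F (m + 1) v) (m + 2) =
      ((activeSites F (m + 1)).filter fun w => w ≤ v ∧ ¬ (F m < w ∧ w < v)).card := by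
  rw [lowSites]
  congr 1
  ext w
  rw [Finset.mem_filter, Finset.mem_filter, mem_activeSites, mem_activeSites,
    isForbidden_appendValue hF hv, show m + 2 - 1 = m + 1 from rfl, appendValue_self]
  by_cases hw : w ≤ v
  · rw [if_pos hw]
    have : ¬ v < w := by omega
    have : w ≤ m + 1 := by omega
    have : w ≤ m + 2 := by omega
    tauto
  · tauto

theorem highSites_appendValue (hF : IsPermWord F (m + 1)) (hv : v ≤ m + 1) :
    highSites (appendValue F (m + 1) v) (m + 2) =
      ((activeSites F (m + 1)).filter fun w => v ≤ w ∧ ¬ (v < F m ∧ w ≤ F m)).card := by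
  rw [highSites, ← Finset.card_image_of_injective
    ((activeSites F (m + 1)).filter fun w => v ≤ w ∧ ¬ (v < F m ∧ w ≤ F m)) (add_left_injective 1)]
  congr 1
  ext w
  rw [Finset.mem_filter, Finset.mem_image, mem_activeSites, isForbidden_appendValue hF hv,
    show m + 2 - 1 = m + 1 from rfl, appendValue_self]
  constructor
  · rintro ⟨⟨h1, h2⟩, h3⟩
    rw [if_neg (by omega), not_or] at h2
    refine ⟨w - 1, ?_, by omega⟩
    rw [Finset.mem_filter, mem_activeSites]
    exact ⟨⟨by omega, h2.1⟩, by omega, by omega⟩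
  · rintro ⟨u, hu, rfl⟩
    rw [Finset.mem_filter, mem_activeSites] at hu
    refine ⟨⟨by omega, ?_⟩, by omega⟩
    rw [if_neg (by omega), Nat.add_sub_cancel, not_or]
    exact ⟨hu.1.2, by omega⟩

theorem sum_card_filter_le (S : Finset ℕ) {M : Type*} [AddCommMonoid M] (g : ℕ → M) :
    ∑ v ∈ S, g (S.filter fun w => w ≤ v).card = ∑ i ∈ Finset.range S.card, g (i + 1) := by
  induction S using Finset.induction_on_max with
  | empty => simp
  | insert a S ha ih =>
    have haS : a ∉ S := fun h => lt_irrefl a (ha a h)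
    rw [Finset.sum_insert haS, Finset.card_insert_of_notMem haS, Finset.sum_range_succ, ← ih,
      add_comm]
    congr 1
    · refine Finset.sum_congr rfl fun v hv => ?_
      rw [Finset.filter_insert, if_neg (not_le.2 (ha v hv))]
    · rw [Finset.filter_true_of_mem, Finset.card_insert_of_notMem haS]
      intro w hw
      rcases Finset.mem_insert.1 hw with rfl | hw
      · exact le_rfl
      · exact (ha w hw).le

theorem sum_card_filter_ge (S : Finset ℕ) {M : Type*} [AddCommMonoid M] (g : ℕ → M) :
    ∑ v ∈ S, g (S.filter fun w => v ≤ w).card = ∑ i ∈ Finset.range S.card, g (i + 1) := by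
  induction S using Finset.induction_on_min with
  | empty => simp
  | insert a S ha ih =>
    have haS : a ∉ S := fun h => lt_irrefl a (ha a h)
    rw [Finset.sum_insert haS, Finset.card_insert_of_notMem haS, Finset.sum_range_succ, ← ih,
      add_comm]
    congr 1
    · refine Finset.sum_congr rfl fun v hv => ?_
      rw [Finset.filter_insert, if_neg (not_le.2 (ha v hv))]
    · rw [Finset.filter_true_of_mem, Finset.card_insert_of_notMem haS]
      intro w hw
      rcases Finset.mem_insert.1 hw with rfl | hw
      · exact le_rfl
      · exact (ha w hw).le

/-- The labels of the words obtained by appending an admissible value. -/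
theorem sum_label_appendValue (hF : IsPermWord F (m + 1)) (h : ¬ HasPattern F (m + 1))
    (Φ : ℕ → ℕ → ℕ) :
    ∑ v ∈ activeSites F (m + 1), Φ (lowSites (appendValue F (m + 1) v) (m + 2) - 1)
        (highSites (appendValue F (m + 1) v) (m + 2) - 1) =
      ∑ x ∈ Finset.range (lowSites F (m + 1) - 1), Φ x (highSites F (m + 1) - 1) +
      Φ (lowSites F (m + 1) - 1) (highSites F (m + 1)) +
      ∑ y ∈ Finset.range (highSites F (m + 1)), Φ (lowSites F (m + 1)) y := by
  set A := activeSites F (m + 1) with hA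
  have hAm : ∀ v ∈ A, v ≤ m + 1 := fun v hv => (mem_activeSites.1 hv).1
  have hlast : F m ∈ A :=
    mem_activeSites.2 ⟨(hF.lt m (by omega)).le, not_isForbidden_last hF h⟩
  set lo := A.filter fun w => w < F m with hlo
  set hi := A.filter fun w => F m < w with hhi
  have hlow : lowSites F (m + 1) = lo.card + 1 := by
    have : (A.filter fun w => w ≤ F m) = insert (F m) lo := by
      ext w
      simp only [hlo, Finset.mem_filter, Finset.mem_insert]
      constructor
      · rintro ⟨h1, h2⟩
        rcases h2.lt_or_eq with h2 | h2
        · exact Or.inr ⟨h1, h2⟩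
        · exact Or.inl h2
      · rintro (rfl | ⟨h1, h2⟩)
        · exact ⟨hlast, le_rfl⟩
        · exact ⟨h1, h2.le⟩
    rw [lowSites, Nat.add_sub_cancel, ← hA, this, Finset.card_insert_of_notMem]
    simp [hlo]
  have hhigh : highSites F (m + 1) = hi.card := rfl
  have hsplit : A = lo ∪ ({F m} ∪ hi) := by
    ext w
    simp only [hlo, hhi, Finset.mem_filter, Finset.mem_union, Finset.mem_singleton]
    constructor
    · intro hw
      rcases lt_trichotomy w (F m) with h | h | h
      · exact Or.inl ⟨hw, h⟩
      · exact Or.inr (Or.inl h)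
      · exact Or.inr (Or.inr ⟨hw, h⟩)
    · rintro (h | rfl | h)
      · exact h.1
      · exact hlast
      · exact h.1
  have hmid : Φ (lowSites (appendValue F (m + 1) (F m)) (m + 2) - 1)
      (highSites (appendValue F (m + 1) (F m)) (m + 2) - 1) = Φ lo.card hi.card := by
    rw [lowSites_appendValue hF (hAm _ hlast), highSites_appendValue hF (hAm _ hlast), ← hA]
    have e1 : (A.filter fun w => w ≤ F m ∧ ¬ (F m < w ∧ w < F m)) = insert (F m) lo := by
      ext w
      simp only [hlo, Finset.mem_filter, Finset.mem_insert]
      constructor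
      · rintro ⟨h1, h2, -⟩
        rcases h2.lt_or_eq with h2 | h2
        · exact Or.inr ⟨h1, h2⟩
        · exact Or.inl h2
      · rintro (rfl | ⟨h1, h2⟩)
        · exact ⟨hlast, by omega⟩
        · exact ⟨h1, by omega⟩
    have e2 : (A.filter fun w => F m ≤ w ∧ ¬ (F m < F m ∧ w ≤ F m)) = insert (F m) hi := by
      ext w
      simp only [hhi, Finset.mem_filter, Finset.mem_insert]
      constructor
      · rintro ⟨h1, h2, -⟩
        rcases h2.lt_or_eq with h2 | h2
        · exact Or.inr ⟨h1, h2⟩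
        · exact Or.inl h2.symm
      · rintro (rfl | ⟨h1, h2⟩)
        · exact ⟨hlast, by omega⟩
        · exact ⟨h1, by omega⟩
    rw [e1, e2, Finset.card_insert_of_notMem (by simp [hlo]),
      Finset.card_insert_of_notMem (by simp [hhi]), Nat.add_sub_cancel, Nat.add_sub_cancel]
  have hlos : ∀ v ∈ lo, Φ (lowSites (appendValue F (m + 1) v) (m + 2) - 1)
      (highSites (appendValue F (m + 1) v) (m + 2) - 1) =
        Φ ((lo.filter fun w => w ≤ v).card - 1) (hi.card - 1) := by
    intro v hv
    rw [hlo, Finset.mem_filter] at hv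
    rw [lowSites_appendValue hF (hAm _ hv.1), highSites_appendValue hF (hAm _ hv.1), ← hA]
    congr 3
    · ext w
      simp only [hlo, Finset.mem_filter]
      constructor
      · rintro ⟨h1, h2⟩
        exact ⟨⟨h1, by omega⟩, by omega⟩
      · rintro ⟨⟨h1, h2⟩, h3⟩
        exact ⟨h1, by omega⟩
    · ext w
      simp only [hhi, Finset.mem_filter]
      constructor
      · rintro ⟨h1, h2⟩
        exact ⟨h1, by omega⟩
      · rintro ⟨h1, h2⟩
        exact ⟨h1, by omega⟩
  have hhis : ∀ v ∈ hi, Φ (lowSites (appendValue F (m + 1) v) (m + 2) - 1)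
      (highSites (appendValue F (m + 1) v) (m + 2) - 1) =
        Φ (lo.card + 1) ((hi.filter fun w => v ≤ w).card - 1) := by
    intro v hv
    rw [hhi, Finset.mem_filter] at hv
    rw [lowSites_appendValue hF (hAm _ hv.1), highSites_appendValue hF (hAm _ hv.1), ← hA]
    have e1 : (A.filter fun w => w ≤ v ∧ ¬ (F m < w ∧ w < v)) = insert v (insert (F m) lo) := by
      ext w
      simp only [hlo, Finset.mem_filter, Finset.mem_insert]
      constructor
      · rintro ⟨h1, h2⟩
        rcases lt_trichotomy w (F m) with h3 | h3 | h3
        · exact Or.inr (Or.inr ⟨h1, h3⟩)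
        · exact Or.inr (Or.inl h3)
        · exact Or.inl (by omega)
      · rintro (rfl | rfl | ⟨h1, h2⟩)
        · exact ⟨hv.1, by omega⟩
        · exact ⟨hlast, by omega⟩
        · exact ⟨h1, by omega⟩
    have e2 : (A.filter fun w => v ≤ w ∧ ¬ (v < F m ∧ w ≤ F m)) =
        hi.filter fun w => v ≤ w := by
      ext w
      simp only [hhi, Finset.mem_filter]
      constructor
      · rintro ⟨h1, h2⟩
        exact ⟨⟨h1, by omega⟩, by omega⟩
      · rintro ⟨⟨h1, h2⟩, h3⟩
        exact ⟨h1, by omega⟩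
    have hne : v ≠ F m := by omega
    have hnl : ¬ v < F m := by omega
    rw [e1, e2, Finset.card_insert_of_notMem (by simp [hlo, hne, hnl]),
      Finset.card_insert_of_notMem (by simp [hlo]), Nat.add_sub_cancel]
  conv_lhs => rw [hsplit]
  rw [Finset.sum_union, Finset.sum_union, Finset.sum_singleton, hmid, Finset.sum_congr rfl hlos,
    Finset.sum_congr rfl hhis, sum_card_filter_le lo fun i => Φ (i - 1) (hi.card - 1),
    sum_card_filter_ge hi fun i => Φ (lo.card + 1) (i - 1), hlow, hhigh]
  · simp only [Nat.add_sub_cancel]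
    ring
  · rw [Finset.disjoint_left]
    simp [hhi]
  · rw [Finset.disjoint_left]
    intro w hw
    simp only [hlo, hhi, Finset.mem_filter, Finset.mem_union, Finset.mem_singleton] at hw ⊢
    omega

theorem one_le_lowSites (hF : IsPermWord F (m + 1)) (h : ¬ HasPattern F (m + 1)) :
    1 ≤ lowSites F (m + 1) :=
  Finset.card_pos.2 ⟨F m, Finset.mem_filter.2
    ⟨mem_activeSites.2 ⟨(hF.lt m (by omega)).le, not_isForbidden_last hF h⟩, le_rfl⟩⟩

theorem one_le_highSites (hF : IsPermWord F (m + 1)) : 1 ≤ highSites F (m + 1) := by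
  refine Finset.card_pos.2 ⟨m + 1, Finset.mem_filter.2 ⟨mem_activeSites.2 ⟨le_rfl, ?_⟩, ?_⟩⟩
  · rintro ⟨i, j, hij, hjm, h⟩
    have := hF.lt i (by omega)
    have := hF.lt j (by omega)
    omega
  · exact hF.lt m (by omega)

end Label

section FinWord

/-- The word of a function on `Fin m`, extended by zero. -/
def finWord {m : ℕ} (f : Fin m → Fin m) : ℕ → ℕ :=
  fun i => if h : i < m then f ⟨i, h⟩ else 0

/-- The self-map of `Fin (m + 1)` obtained from a self-map of `Fin m` by appending `v`. -/
def appendFin {m : ℕ} (f : Fin m → Fin m) (v : Fin (m + 1)) : Fin (m + 1) → Fin (m + 1) :=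
  Fin.snoc (α := fun _ => Fin (m + 1)) (fun i => v.succAbove (f i)) v

theorem finWord_val {m : ℕ} (f : Fin m → Fin m) (i : Fin m) : finWord f i = f i := by
  simp [finWord]

theorem finWord_appendFin {m : ℕ} (f : Fin m → Fin m) (v : Fin (m + 1)) :
    finWord (appendFin f v) = appendValue (finWord f) m v := by
  funext i
  unfold appendValue
  split_ifs with h1 h2
  · lift i to Fin m using h1
    have : (i : ℕ) = (i.castSucc : ℕ) := rfl
    rw [finWord_val, this, finWord_val, appendFin, Fin.snoc_castSucc, bumpValue]
    simp only [Fin.succAbove, Fin.lt_def, Fin.val_castSucc]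
    split_ifs <;> simp
  · subst h2
    have := finWord_val (appendFin f v) (Fin.last i)
    rw [Fin.val_last] at this
    rw [this, appendFin, Fin.snoc_last]
  · rw [finWord, dif_neg (by omega)]

theorem appendFin_injective_iff {m : ℕ} (f : Fin m → Fin m) (v : Fin (m + 1)) :
    Function.Injective (appendFin f v) ↔ Function.Injective f := by
  constructor
  · intro h i j hij
    have : appendFin f v i.castSucc = appendFin f v j.castSucc := by
      simp [appendFin, hij]
    exact Fin.castSucc_injective _ (h this)
  · intro h i j
    refine Fin.lastCases ?_ (fun i => ?_) i <;> refine Fin.lastCases ?_ (fun j => ?_) j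
    · simp
    · simp [appendFin, (Fin.succAbove_ne v (f j)).symm]
    · simp [appendFin, Fin.succAbove_ne v (f i)]
    · simp [appendFin, h.eq_iff]

theorem exists_appendFin_eq {m : ℕ} {g : Fin (m + 1) → Fin (m + 1)} (hg : Function.Injective g) :
    ∃ f v, appendFin f v = g := by
  have h : ∀ i : Fin m, ∃ y, (g (Fin.last m)).succAbove y = g i.castSucc := fun i =>
    Fin.exists_succAbove_eq fun he => (Fin.castSucc_lt_last i).ne (hg he)
  choose f hf using h
  refine ⟨f, g (Fin.last m), ?_⟩
  funext i
  refine Fin.lastCases ?_ (fun i => ?_) i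
  · simp [appendFin]
  · simp [appendFin, hf]

theorem isPermWord_finWord {m : ℕ} {f : Fin m → Fin m} (hf : Function.Injective f) :
    IsPermWord (finWord f) m where
  lt i hi := by
    lift i to Fin m using hi
    rw [finWord_val]
    exact (f i).2
  inj i j hi hj h := by
    lift i to Fin m using hi
    lift j to Fin m using hj
    rw [finWord_val, finWord_val] at h
    rw [hf (Fin.ext h)]
  surj y hy := by
    lift y to Fin m using hy
    obtain ⟨i, rfl⟩ := Finite.injective_iff_surjective.1 hf y
    exact ⟨i, i.2, finWord_val f i⟩

open Classical in
/-- The injective pattern-avoiding self-maps of `Fin m`. -/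
noncomputable def avoiders (m : ℕ) : Finset (Fin m → Fin m) :=
  Finset.univ.filter fun f => Function.Injective f ∧ ¬ HasPattern (finWord f) m

theorem mem_avoiders {m : ℕ} {f : Fin m → Fin m} :
    f ∈ avoiders m ↔ Function.Injective f ∧ ¬ HasPattern (finWord f) m := by
  simp [avoiders]

theorem sum_avoiders_succ (m : ℕ) (Φ : (ℕ → ℕ) → ℕ) :
    ∑ g ∈ avoiders (m + 1), Φ (finWord g) =
      ∑ f ∈ avoiders m, ∑ v ∈ activeSites (finWord f) m, Φ (appendValue (finWord f) m v) := by
  have key : ∀ (f : Fin m → Fin m) (v : Fin (m + 1)), appendFin f v ∈ avoiders (m + 1) ↔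
      f ∈ avoiders m ∧ (v : ℕ) ∈ activeSites (finWord f) m := by
    intro f v
    rw [mem_avoiders, mem_avoiders, appendFin_injective_iff, finWord_appendFin,
      hasPattern_appendValue, mem_activeSites]
    have := v.is_le
    tauto
  rw [Finset.sum_sigma']
  symm
  refine Finset.sum_nbij (fun a => appendFin a.1 (Fin.ofNat (m + 1) a.2)) ?_ ?_ ?_ ?_
  · rintro ⟨f, v⟩ h
    rw [Finset.mem_sigma] at h
    have hv : v < m + 1 := Nat.lt_succ_of_le (mem_activeSites.1 h.2).1
    rw [key, Fin.val_ofNat, Nat.mod_eq_of_lt hv]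
    exact h
  · rintro ⟨f, v⟩ h ⟨f', v'⟩ h' heq
    rw [Finset.mem_coe, Finset.mem_sigma] at h h'
    have hv : v < m + 1 := Nat.lt_succ_of_le (mem_activeSites.1 h.2).1
    have hv' : v' < m + 1 := Nat.lt_succ_of_le (mem_activeSites.1 h'.2).1
    obtain ⟨rfl, h2⟩ : f = f' ∧ Fin.ofNat (m + 1) v = Fin.ofNat (m + 1) v' := by
      have e : Fin.ofNat (m + 1) v = Fin.ofNat (m + 1) v' := by
        simpa [appendFin] using congrFun heq (Fin.last m)
      refine ⟨?_, e⟩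
      funext i
      have := congrFun heq i.castSucc
      simp only [appendFin, Fin.snoc_castSucc, e] at this
      exact Fin.succAbove_right_injective this
    have h3 := congrArg Fin.val h2
    rw [Fin.val_ofNat, Fin.val_ofNat, Nat.mod_eq_of_lt hv, Nat.mod_eq_of_lt hv'] at h3
    rw [h3]
  · intro g hg
    obtain ⟨f, v, rfl⟩ := exists_appendFin_eq (mem_avoiders.1 hg).1
    refine ⟨⟨f, v⟩, ?_, by simp⟩
    rw [Finset.mem_coe, Finset.mem_sigma]
    exact (key f v).1 hg
  · rintro ⟨f, v⟩ h
    rw [Finset.mem_sigma] at h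
    have hv : v < m + 1 := Nat.lt_succ_of_le (mem_activeSites.1 h.2).1
    simp only
    rw [finWord_appendFin, Fin.val_ofNat, Nat.mod_eq_of_lt hv]

/-- The number of ways to append `m` values to a word with `H + 1` low and `K + 1` high sites. -/
def labelCount : ℕ → ℕ → ℕ → ℕ
  | 0, _, _ => 1
  | m + 1, H, K => ∑ x ∈ Finset.range H, labelCount m x K + labelCount m H (K + 1) +
      ∑ y ∈ Finset.range (K + 1), labelCount m (H + 1) y

theorem card_avoiders_add (n m : ℕ) :
    (avoiders (n + 1 + m)).card = ∑ f ∈ avoiders (n + 1),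
      labelCount m (lowSites (finWord f) (n + 1) - 1) (highSites (finWord f) (n + 1) - 1) := by
  induction m generalizing n with
  | zero => simp [labelCount]
  | succ m ih =>
    rw [show n + 1 + (m + 1) = n + 1 + 1 + m by ring, ih,
      sum_avoiders_succ (n + 1) fun F =>
        labelCount m (lowSites F (n + 1 + 1) - 1) (highSites F (n + 1 + 1) - 1)]
    refine Finset.sum_congr rfl fun f hf => ?_
    obtain ⟨hf1, hf2⟩ := mem_avoiders.1 hf
    have hF := isPermWord_finWord hf1
    rw [sum_label_appendValue hF hf2, labelCount, Nat.sub_add_cancel (one_le_highSites hF),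
      Nat.sub_add_cancel (one_le_lowSites hF hf2)]

theorem card_avoiders_succ (m : ℕ) : (avoiders (m + 1)).card = labelCount m 0 0 := by
  rw [add_comm m, show 1 + m = 0 + 1 + m by ring, card_avoiders_add]
  have h : ∀ f : Fin (0 + 1) → Fin (0 + 1), f ∈ avoiders (0 + 1) := by
    intro f
    refine mem_avoiders.2 ⟨fun i j _ => Fin.ext (by omega), ?_⟩
    rintro ⟨i, j, k, hij, hjk, hk, -⟩
    omega
  have hcard : (avoiders (0 + 1)).card = 1 := by
    rw [Finset.eq_univ_of_forall h]
    simp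
  suffices hlab : ∀ f ∈ avoiders (0 + 1), labelCount m (lowSites (finWord f) (0 + 1) - 1)
      (highSites (finWord f) (0 + 1) - 1) = labelCount m 0 0 by
    rw [Finset.sum_congr rfl hlab, Finset.sum_const, hcard, one_smul]
  intro f _
  have hf : finWord f 0 = 0 := by
    have := (f 0).2
    have h2 := finWord_val f 0
    rw [Fin.val_zero] at h2
    omega
  have h1 : lowSites (finWord f) (0 + 1) - 1 = 0 := by
    have : lowSites (finWord f) (0 + 1) ≤ 1 := by
      rw [lowSites, Finset.card_le_one]
      intro a ha b hb
      simp only [Finset.mem_filter, zero_add, Nat.sub_self, hf] at ha hb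
      omega
    omega
  have h2 : highSites (finWord f) (0 + 1) - 1 = 0 := by
    have : highSites (finWord f) (0 + 1) ≤ 1 := by
      rw [highSites, Finset.card_le_one]
      intro a ha b hb
      simp only [Finset.mem_filter, mem_activeSites, zero_add, Nat.sub_self, hf] at ha hb
      omega
    omega
  rw [h1, h2]

end FinWord

section BinomialTransform

/-- The binomial transform `∑ i, K.choose i * g i`. -/
def binomialTransform : ℕ → (ℕ → ℕ) → ℕ
  | 0, g => g 0
  | K + 1, g => binomialTransform K g + binomialTransform K fun i => g (i + 1)

/-- The right shift of a sequence. -/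
def rightShift (g : ℕ → ℕ) : ℕ → ℕ
  | 0 => 0
  | i + 1 => g i

theorem binomialTransform_add (K : ℕ) (g h : ℕ → ℕ) :
    binomialTransform K (fun i => g i + h i) = binomialTransform K g + binomialTransform K h := by
  induction K generalizing g h with
  | zero => rfl
  | succ K ih =>
    simp only [binomialTransform, ih]
    ring

theorem binomialTransform_zero (K : ℕ) : binomialTransform K (fun _ => 0) = 0 := by
  induction K with
  | zero => rfl
  | succ K ih => simp [binomialTransform, ih]

theorem binomialTransform_sum {ι : Type*} (s : Finset ι) (K : ℕ) (g : ι → ℕ → ℕ) :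
    binomialTransform K (fun i => ∑ x ∈ s, g x i) = ∑ x ∈ s, binomialTransform K (g x) := by
  classical
  induction s using Finset.induction_on with
  | empty => simp [binomialTransform_zero]
  | insert a s ha ih => simp only [Finset.sum_insert ha, binomialTransform_add, ih]

theorem sum_range_binomialTransform (K : ℕ) (g : ℕ → ℕ) :
    ∑ y ∈ Finset.range K, binomialTransform y g = binomialTransform K (rightShift g) := by
  induction K with
  | zero => rfl
  | succ K ih => rw [Finset.sum_range_succ, ih, binomialTransform]; rfl

/-- The coefficients of `labelCount` in the binomial basis. -/
def binomialCoord : ℕ → ℕ → ℕ → ℕ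
  | 0, i, j => if i = 0 ∧ j = 0 then 1 else 0
  | n + 1, i, j => 2 * binomialCoord n i j + binomialCoord n (i + 1) j + binomialCoord n i (j + 1) +
      rightShift (fun a => binomialCoord n a j) i + rightShift (binomialCoord n i) j +
      rightShift (binomialCoord n (i + 1)) j

theorem labelCount_eq_binomialTransform (m H K : ℕ) :
    labelCount m H K =
      binomialTransform H fun i => binomialTransform K fun j => binomialCoord m i j := by
  induction m generalizing H K with
  | zero =>
    have h : ∀ K, binomialTransform K (fun j => if j = 0 then 1 else 0) = 1 := by
      intro K
      induction K with
      | zero => rfl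
      | succ K ih => simp [binomialTransform, ih, binomialTransform_zero]
    have h2 : ∀ i, binomialTransform K (fun j => binomialCoord 0 i j) = if i = 0 then 1 else 0 := by
      intro i
      by_cases hi : i = 0
      · simp [binomialCoord, hi, h]
      · simp [binomialCoord, hi, binomialTransform_zero]
    simp only [h2, h, labelCount]
  | succ m ih =>
    have e1 : ∑ x ∈ Finset.range H, labelCount m x K = binomialTransform H fun i =>
        binomialTransform K fun j => rightShift (fun a => binomialCoord m a j) i := by
      simp only [ih]
      rw [sum_range_binomialTransform]
      congr 1
      funext i
      cases i
      · exact (binomialTransform_zero K).symm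
      · rfl
    have e2 : labelCount m H (K + 1) = binomialTransform H fun i =>
        binomialTransform K fun j => binomialCoord m i j + binomialCoord m i (j + 1) := by
      simp only [ih, binomialTransform, binomialTransform_add]
    have e3 : ∑ y ∈ Finset.range (K + 1), labelCount m (H + 1) y = binomialTransform H fun i =>
        binomialTransform K fun j => rightShift (binomialCoord m i) j + binomialCoord m i j +
          (rightShift (binomialCoord m (i + 1)) j + binomialCoord m (i + 1) j) := by
      simp only [ih]
      rw [← binomialTransform_sum]
      simp only [sum_range_binomialTransform, binomialTransform, binomialTransform_add]
      rfl
    rw [labelCount, e1, e2, e3]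
    simp only [← binomialTransform_add]
    congr 1
    funext i
    congr 1
    funext j
    rw [binomialCoord]
    ring

theorem labelCount_zero_zero (m : ℕ) : labelCount m 0 0 = binomialCoord m 0 0 :=
  labelCount_eq_binomialTransform m 0 0

theorem quadrantWalk_eq_binomialCoord {c : ℝ≥0} (hc : c ^ 3 + c ^ 2 = 1) (n i j : ℕ) :
    quadrantWalk (baxterWt c) baxterStep n ((i : ℤ), (j : ℤ)) 0 * baxterTotal c ^ n * c ^ i =
      binomialCoord n i j * c ^ j := by
  have hT := (baxterTotal_pos c).ne'
  have hcc : c * (c + c ^ 2) = 1 := by rw [← hc]; ring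
  have hz : ∀ i j : ℕ, (0 : ℤ × ℤ) ≤ ((i : ℤ), (j : ℤ)) := fun i j => by
    rw [Prod.le_def]
    simp
  induction n generalizing i j with
  | zero =>
    by_cases hij : i = 0 ∧ j = 0
    · obtain ⟨rfl, rfl⟩ := hij
      simp [quadrantWalk, binomialCoord, show (0 : ℤ × ℤ) ≤ (0, 0) from le_rfl]
    · have : ¬ ((i : ℤ), (j : ℤ)) = 0 := by
        rw [Prod.ext_iff]
        simpa using hij
      simp [quadrantWalk, binomialCoord, hij, this]
  | succ n ih =>
    rw [quadrantWalk_succ _ _ (hz i j)]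
    have hsum : (∑ a, baxterWt c a *
        quadrantWalk (baxterWt c) baxterStep n (((i : ℤ), (j : ℤ)) + baxterStep a) 0) *
          baxterTotal c =
        2 * quadrantWalk (baxterWt c) baxterStep n ((i : ℤ), (j : ℤ)) 0 +
        (c + c ^ 2) * quadrantWalk (baxterWt c) baxterStep n ((i : ℤ) - 1, (j : ℤ)) 0 +
        c * quadrantWalk (baxterWt c) baxterStep n (((i + 1 : ℕ) : ℤ), (j : ℤ)) 0 +
        (c + c ^ 2) * quadrantWalk (baxterWt c) baxterStep n ((i : ℤ), ((j + 1 : ℕ) : ℤ)) 0 +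
        c * quadrantWalk (baxterWt c) baxterStep n ((i : ℤ), (j : ℤ) - 1) 0 +
        c ^ 2 * quadrantWalk (baxterWt c) baxterStep n (((i + 1 : ℕ) : ℤ), (j : ℤ) - 1) 0 := by
      simp only [Fin.sum_univ_six, baxterWt, baxterStep]
      simp [← sub_eq_add_neg, add_mul]
      field_simp
    have hw : (c + c ^ 2) * quadrantWalk (baxterWt c) baxterStep n ((i : ℤ) - 1, (j : ℤ)) 0 *
        baxterTotal c ^ n * c ^ i = rightShift (fun a => binomialCoord n a j) i * c ^ j := by
      cases i with
      | zero =>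
        rw [quadrantWalk_eq_zero_left _ _ _ (by simp [Prod.le_def])]
        simp [rightShift]
      | succ i =>
        rw [show ((i + 1 : ℕ) : ℤ) - 1 = i by push_cast; ring, rightShift, ← ih i j]
        calc _ = (c * (c + c ^ 2)) * (quadrantWalk (baxterWt c) baxterStep n ((i : ℤ), (j : ℤ)) 0 *
              baxterTotal c ^ n * c ^ i) := by ring
          _ = _ := by rw [hcc, one_mul]
    have hs : ∀ i : ℕ, c * quadrantWalk (baxterWt c) baxterStep n ((i : ℤ), (j : ℤ) - 1) 0 *
        baxterTotal c ^ n * c ^ i = rightShift (binomialCoord n i) j * c ^ j := by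
      intro i
      cases j with
      | zero =>
        rw [quadrantWalk_eq_zero_left _ _ _ (by simp [Prod.le_def])]
        simp [rightShift]
      | succ j =>
        rw [show ((j + 1 : ℕ) : ℤ) - 1 = j by push_cast; ring, rightShift, pow_succ c j,
          ← mul_assoc, ← ih i j]
        ring
    have hn : (c + c ^ 2) * quadrantWalk (baxterWt c) baxterStep n ((i : ℤ), ((j + 1 : ℕ) : ℤ)) 0 *
        baxterTotal c ^ n * c ^ i = binomialCoord n i (j + 1) * c ^ j := by
      calc _ = (c + c ^ 2) * (quadrantWalk (baxterWt c) baxterStep n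
              ((i : ℤ), ((j + 1 : ℕ) : ℤ)) 0 * baxterTotal c ^ n * c ^ i) := by ring
        _ = (c * (c + c ^ 2)) * (binomialCoord n i (j + 1) * c ^ j) := by rw [ih]; ring
        _ = _ := by rw [hcc, one_mul]
    have h0 := ih i j
    have he := ih (i + 1) j
    have hse := hs (i + 1)
    have hso := hs i
    rw [pow_succ (baxterTotal c), mul_comm (baxterTotal c ^ n), ← mul_assoc, hsum, binomialCoord]
    push_cast
    push_cast at hw hn hso hse he h0
    simp only [add_mul, ← hw, ← hn, ← hso, ← hse, ← he, ← h0, mul_assoc]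
    ring

end BinomialTransform

section Counting

theorem hasPattern_finWord {m : ℕ} {f : Fin m → Fin m} :
    HasPattern (finWord f) m ↔ Contains2413 f ∨ Contains3142 f ∨ Contains3412 f := by
  constructor
  · rintro ⟨i, j, k, hij, hjk, hk, h⟩
    have hi : finWord f i = f ⟨i, by omega⟩ := finWord_val f ⟨i, by omega⟩
    have hj : finWord f j = f ⟨j, by omega⟩ := finWord_val f ⟨j, by omega⟩
    have hj' : finWord f (j + 1) = f ⟨j + 1, by omega⟩ := finWord_val f ⟨j + 1, by omega⟩
    have hk' : finWord f k = f ⟨k, hk⟩ := finWord_val f ⟨k, hk⟩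
    rw [hi, hj, hj', hk'] at h
    rcases h with h | h | h
    · exact Or.inl ⟨_, _, _, _, hij, rfl, hjk, h⟩
    · exact Or.inr (Or.inl ⟨_, _, _, _, hij, rfl, hjk, h⟩)
    · exact Or.inr (Or.inr ⟨_, _, _, _, hij, rfl, hjk, h⟩)
  · rintro (⟨i, j, j', k, hij, hj, hjk, h⟩ | ⟨i, j, j', k, hij, hj, hjk, h⟩ |
      ⟨i, j, j', k, hij, hj, hjk, h⟩) <;>
    · refine ⟨i, j, k, hij, hj ▸ hjk, k.2, ?_⟩
      rw [← hj]
      simp only [finWord_val, Fin.lt_def] at h ⊢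
      omega

theorem strongBaxterCount_eq_card_avoiders (n : ℕ) : strongBaxterCount n = (avoiders n).card := by
  have hmem : ∀ π : Equiv.Perm (Fin n), IsStrongBaxter π ↔ ⇑π ∈ avoiders n := by
    intro π
    rw [mem_avoiders, hasPattern_finWord, not_or, not_or]
    exact (and_iff_right π.injective).symm
  rw [strongBaxterCount, ← Fintype.card_coe, ← Nat.card_eq_fintype_card]
  refine Nat.card_eq_of_bijective (fun π => ⟨⇑π.1, (hmem π.1).1 π.2⟩) ⟨fun π σ h => ?_, ?_⟩
  · exact Subtype.ext (DFunLike.coe_injective (congrArg Subtype.val h))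
  · rintro ⟨f, hf⟩
    have hbij := Finite.injective_iff_bijective.1 (mem_avoiders.1 hf).1
    exact ⟨⟨Equiv.ofBijective f hbij, (hmem _).2 hf⟩, rfl⟩

theorem coeff_strongBaxterGF_succ {c : ℝ≥0} (hc : c ^ 3 + c ^ 2 = 1) (n : ℕ) :
    ((PowerSeries.coeff (n + 1) strongBaxterGF : ℚ) : ℝ) =
      quadrantWalk (baxterWt c) baxterStep n 0 0 * (baxterTotal c : ℝ) ^ n := by
  have h := quadrantWalk_eq_binomialCoord hc n 0 0
  rw [pow_zero, mul_one, mul_one] at h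
  rw [strongBaxterGF, PowerSeries.coeff_mk, if_neg n.succ_ne_zero,
    strongBaxterCount_eq_card_avoiders, card_avoiders_succ, labelCount_zero_zero, Rat.cast_natCast]
  exact_mod_cast h.symm

theorem isTheta_add_one_rpow (s : ℝ) :
    (fun n : ℕ => ((n + 1 : ℕ) : ℝ) ^ s) =Θ[Filter.atTop] fun n : ℕ => (n : ℝ) ^ s := by
  refine Asymptotics.IsTheta.rpow (Filter.Eventually.of_forall fun n => by simp; positivity)
    (Filter.Eventually.of_forall fun n => by simp) ⟨?_, ?_⟩
  · refine Asymptotics.IsBigO.of_bound 2 ?_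
    filter_upwards [Filter.eventually_ge_atTop 1] with n hn
    have : (1 : ℝ) ≤ n := by exact_mod_cast hn
    rw [Real.norm_of_nonneg (by positivity), Real.norm_of_nonneg (by positivity)]
    push_cast
    linarith
  · refine Asymptotics.IsBigO.of_bound 1 (Filter.Eventually.of_forall fun n => ?_)
    rw [Real.norm_of_nonneg (by positivity), Real.norm_of_nonneg (by positivity)]
    push_cast
    linarith

theorem summable_coeff_strongBaxterGF_iff {c : ℝ≥0} (hc : c ^ 3 + c ^ 2 = 1) (s : ℝ) :
    (Summable fun n : ℕ => ((PowerSeries.coeff n strongBaxterGF : ℚ) : ℝ) /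
        (baxterTotal c : ℝ) ^ n * (n : ℝ) ^ s) ↔
      Summable fun n : ℕ => (quadrantWalk (baxterWt c) baxterStep n 0 0 : ℝ) * (n : ℝ) ^ s := by
  have hT : (baxterTotal c : ℝ) ≠ 0 := by exact_mod_cast (baxterTotal_pos c).ne'
  rw [← summable_nat_add_iff 1]
  have h : (fun n : ℕ => ((PowerSeries.coeff (n + 1) strongBaxterGF : ℚ) : ℝ) /
      (baxterTotal c : ℝ) ^ (n + 1) * ((n + 1 : ℕ) : ℝ) ^ s) = fun n : ℕ =>
        (baxterTotal c : ℝ)⁻¹ * (quadrantWalk (baxterWt c) baxterStep n 0 0 *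
          ((n + 1 : ℕ) : ℝ) ^ s) := by
    funext n
    rw [coeff_strongBaxterGF_succ hc, pow_succ]
    field_simp
  rw [h, summable_mul_left_iff (inv_ne_zero hT)]
  have := (Asymptotics.isTheta_refl (fun n : ℕ =>
    (quadrantWalk (baxterWt c) baxterStep n 0 0 : ℝ)) Filter.atTop).mul (isTheta_add_one_rpow s)
  exact ⟨fun hs => summable_of_isBigO_nat hs this.2, fun hs => summable_of_isBigO_nat hs this.1⟩

end Counting

section Angle

theorem exists_cube_add_sq_eq_one : ∃ c : ℝ≥0, 0 < c ∧ c < 1 ∧ c ^ 3 + c ^ 2 = 1 := by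
  have hcont : ContinuousOn (fun x : ℝ => x ^ 3 + x ^ 2) (Set.Icc 0 1) := by fun_prop
  obtain ⟨x, hx, hx1⟩ := intermediate_value_Ioo zero_le_one hcont
    (show (1 : ℝ) ∈ Set.Ioo ((0 : ℝ) ^ 3 + 0 ^ 2) (1 ^ 3 + 1 ^ 2) by norm_num)
  exact ⟨⟨x, hx.1.le⟩, hx.1, hx.2, NNReal.eq hx1⟩

theorem isAlgebraic_of_cube_add_sq {c : ℝ≥0} (hc : (c : ℝ) ^ 3 + c ^ 2 = 1) :
    IsAlgebraic ℚ ((c : ℝ) : ℂ) := by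
  have hc' : ((c : ℝ) : ℂ) ^ 3 + ((c : ℝ) : ℂ) ^ 2 = 1 := by exact_mod_cast hc
  refine ⟨Polynomial.X ^ 3 + Polynomial.X ^ 2 - 1, ?_, ?_⟩
  · intro h
    have := congrArg (Polynomial.eval 0) h
    simp at this
  · simp [hc']

theorem isAlgebraic_exp_mul_I {c : ℝ≥0} (hc : (c : ℝ) ^ 3 + c ^ 2 = 1) {θ : ℝ}
    (hθ : Real.cos θ = (c : ℝ) ^ 3 / 2) : IsAlgebraic ℚ (Complex.exp (θ * Complex.I)) := by
  have hca := isAlgebraic_of_cube_add_sq hc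
  have hcos : IsAlgebraic ℚ ((Real.cos θ : ℝ) : ℂ) := by
    rw [hθ]
    push_cast
    rw [div_eq_mul_inv]
    exact (hca.pow 3).mul (isAlgebraic_algebraMap (2 : ℚ)).inv
  have hsin : IsAlgebraic ℚ ((Real.sin θ : ℝ) : ℂ) := by
    refine IsAlgebraic.of_pow two_pos ?_
    have : ((Real.sin θ : ℝ) : ℂ) ^ 2 = 1 - ((Real.cos θ : ℝ) : ℂ) ^ 2 := by
      exact_mod_cast Real.sin_sq θ
    rw [this]
    exact isAlgebraic_one.sub (hcos.pow 2)
  have hI : IsAlgebraic ℚ Complex.I := by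
    refine IsAlgebraic.of_pow two_pos ?_
    rw [Complex.I_sq]
    exact isAlgebraic_one.neg
  rw [Complex.exp_mul_I, ← Complex.ofReal_cos, ← Complex.ofReal_sin]
  exact hcos.add (hsin.mul hI)

end Angle

/-- Theorem 5.7: the generating function of strong-Baxter numbers is not D-finite. -/
theorem strongBaxterGF_not_DFinite :
    ¬ ∃ (k : ℕ) (Q : Polynomial ℚ) (c : ℕ → Polynomial ℚ), c k ≠ 0 ∧
      (∑ i ∈ Finset.range (k + 1),
          (c i : PowerSeries ℚ) * (⇑(PowerSeries.derivative ℚ))^[i] strongBaxterGF) =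
        (Q : PowerSeries ℚ) := by
  rintro ⟨k, Q, q, hq, hode⟩
  obtain ⟨c, hc0, hc1, hc⟩ := exists_cube_add_sq_eq_one
  have hcR : (c : ℝ) ^ 3 + c ^ 2 = 1 := by exact_mod_cast hc
  have hc3 : 0 < (c : ℝ) ^ 3 := by positivity
  have hc31 : (c : ℝ) ^ 3 < 1 := by
    have : (0 : ℝ) < (c : ℝ) ^ 2 := by positivity
    linarith
  obtain ⟨θ, hθ⟩ : ∃ θ, θ = Real.arccos ((c : ℝ) ^ 3 / 2) := ⟨_, rfl⟩
  have hcos : Real.cos θ = (c : ℝ) ^ 3 / 2 := by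
    rw [hθ, Real.cos_arccos] <;> linarith
  have hθ1 : θ < Real.pi / 2 := by
    rw [hθ, Real.arccos_lt_pi_div_two]
    linarith
  have hθ2 : Real.pi / 3 < θ := by
    by_contra! h
    have := Real.cos_le_cos_of_nonneg_of_le_pi (hθ ▸ Real.arccos_nonneg _)
      (by linarith [Real.pi_pos]) h
    rw [Real.cos_pi_div_three, hcos] at this
    linarith
  have hπ := Real.pi_pos
  have hθ0 : 0 < θ := by linarith
  have hTpos : (0 : ℝ) < baxterTotal c := baxterTotal_pos c
  have hTalg : IsAlgebraic ℚ ((baxterTotal c : ℝ) : ℂ) := by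
    have hca := isAlgebraic_of_cube_add_sq hcR
    rw [baxterTotal]
    push_cast
    exact ((isAlgebraic_algebraMap (2 : ℚ)).add ((isAlgebraic_algebraMap (4 : ℚ)).mul hca)).add
      ((isAlgebraic_algebraMap (3 : ℚ)).mul (hca.pow 2))
  have hnonneg : ∀ n, 0 ≤ PowerSeries.coeff n strongBaxterGF := by
    intro n
    rw [strongBaxterGF, PowerSeries.coeff_mk]
    positivity
  have hlam : Real.pi / θ < 3 := by
    rw [div_lt_iff₀ hθ0]
    linarith
  have halg := isAlgebraic_exponent_of_ode strongBaxterGF hnonneg k Q q hq hode hTpos hTalg hlam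
    (fun s hs => (summable_coeff_strongBaxterGF_iff hc s).2
      (summable_baxterWalk_mul_rpow hc0 hcR hθ0 hθ1 hcos hs))
    (fun s hs => (summable_coeff_strongBaxterGF_iff hc s).not.2
      (not_summable_baxterWalk_mul_rpow hc0 hcR hθ0 hθ1 hcos hs))
  have hγ : IsAlgebraic ℚ ((θ / Real.pi : ℝ) : ℂ) := by
    rw [← inv_div, Complex.ofReal_inv]
    exact halg.inv
  have hexp : IsAlgebraic ℚ (Complex.exp (Real.pi * Complex.I * (θ / Real.pi : ℝ))) := by
    have : (Real.pi : ℂ) * Complex.I * ((θ / Real.pi : ℝ) : ℂ) = θ * Complex.I := by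
      have : (Real.pi : ℂ) ≠ 0 := by exact_mod_cast hπ.ne'
      push_cast
      field_simp
    rw [this]
    exact isAlgebraic_exp_mul_I hcR hcos
  exact not_irrational_of_isAlgebraic_exp (by positivity) ((div_lt_one hπ).2 (by linarith)) hγ hexp
    (irrational_angle_div_pi hc0 hcR hcos)
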